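/- Let Σ_Γ be a subshift of finite type without isolated points or empty cones, let E ⊆ Σ_Γ be a nonempty clopen set, and let G ≤ R_{Γ,E} be a contracting RSG that is full as a group of homeomorphisms of E. Let S' be a finite set of rational points in E. Then the setwise stabilizer Stab_G(S') = {g ∈ G : g(S') = S'} is a finitely generated group. -/

import Mathlib

open scoped Classical

noncomputable section

/-- A finite directed graph (loops and parallel edges are allowed). -/
structure FinDigraph : Type 1 where
  V : Type
  E : Type
  [fintypeV : Fintype V]
  [fintypeE : Fintype E]
  o : E → V
  t : E → V

attribute [instance] FinDigraph.fintypeV FinDigraph.fintypeE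

instance (Γ : FinDigraph) : TopologicalSpace Γ.E := ⊥
instance (Γ : FinDigraph) : DiscreteTopology Γ.E := ⟨rfl⟩

namespace FinDigraph

variable (Γ : FinDigraph)

/-- The subshift of finite type `Σ_Γ`: the set of all infinite directed paths in `Γ`,
viewed as a subset of the product space of all edge sequences (each edge's terminus is
the origin of the next edge). -/
def shift : Set (ℕ → Γ.E) := {x | ∀ i, Γ.t (x i) = Γ.o (x (i + 1))}

/-- Validity of a finite directed path starting at a given node. -/
def pathOk : Γ.V → List Γ.E → Prop
  | _, [] => True
  | v, e :: l => Γ.o e = v ∧ pathOk (Γ.t e) l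

/-- A finite directed path in `Γ` (a node together with a compatible list of edges;
a path with no edges is a node, regarded as a path of length `0`). -/
structure FinPath where
  start : Γ.V
  edges : List Γ.E
  ok : Γ.pathOk start edges

/-- Terminus of a list of edges starting at a given node. -/
def pathEndAux : Γ.V → List Γ.E → Γ.V
  | v, [] => v
  | _, e :: l => pathEndAux (Γ.t e) l

/-- The terminus `t(α)` of a finite directed path. -/
def pathEnd (α : Γ.FinPath) : Γ.V := Γ.pathEndAux α.start α.edges

/-- The length-0 path at a node `v`. -/
def trivPath (v : Γ.V) : Γ.FinPath := ⟨v, [], by simp [pathOk]⟩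

/-- The cone `C_α ⊆ Σ_Γ` of all infinite directed paths having `α` as a prefix. -/
def cone (α : Γ.FinPath) : Set (ℕ → Γ.E) :=
  {x | x ∈ Γ.shift ∧ Γ.o (x 0) = α.start ∧
    ∀ (i : ℕ) (h : i < α.edges.length), x i = α.edges.get ⟨i, h⟩}

/-- The canonical similarity `C_α → C_β` (for `t(α) = t(β)`) on the level of edge
sequences: delete the prefix `α` and attach the prefix `β`. -/
def splice (α β : Γ.FinPath) (x : ℕ → Γ.E) : ℕ → Γ.E := fun i =>
  if h : i < β.edges.length then β.edges.get ⟨i, h⟩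
  else x (i - β.edges.length + α.edges.length)

/-- Concatenation `α · ω` of a finite path with an infinite path (on sequences). -/
def catPath (α : Γ.FinPath) (x : ℕ → Γ.E) : ℕ → Γ.E :=
  Γ.splice (Γ.trivPath (Γ.pathEnd α)) α x

/-- The length of the path `f̄(α)`, i.e. of the greatest common prefix of all points
of `f(C_α)`. -/
def barLen (f : (ℕ → Γ.E) → ℕ → Γ.E) (α : Γ.FinPath) : ℕ :=
  sSup {n | ∀ x ∈ Γ.cone α, ∀ y ∈ Γ.cone α, ∀ i < n, f x i = f y i}

/-- The local action `f|_α : C_{t(α)} → C_{t(f̄(α))}`, determined by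
`f(α·ω) = f̄(α)·(f|_α)(ω)`.  It is recorded together with the node `t(α)`
(the node of its domain cone), and is extended by the identity off the cone
`C_{t(α)}`. -/
def localAction (f : (ℕ → Γ.E) → ℕ → Γ.E) (α : Γ.FinPath) :
    Γ.V × ((ℕ → Γ.E) → ℕ → Γ.E) :=
  (Γ.pathEnd α, fun w =>
    if w ∈ Γ.cone (Γ.trivPath (Γ.pathEnd α)) then
      fun i => f (Γ.catPath α w) (i + Γ.barLen f α)
    else w)

/-- A map is rational (on a domain `D`) if it has only finitely many distinct local
actions at cones contained in `D`. -/
def RationalOn (f : (ℕ → Γ.E) → ℕ → Γ.E) (D : Set (ℕ → Γ.E)) : Prop :=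
  (Γ.localAction f '' {α : Γ.FinPath | Γ.cone α ⊆ D}).Finite

/-- The nucleus `𝒩_f` of a map: the set of local actions `f|_α` that occur for
infinitely many finite paths `α` with `C_α` contained in the domain. -/
def nucleusOf (f : (ℕ → Γ.E) → ℕ → Γ.E) (D : Set (ℕ → Γ.E)) :
    Set (Γ.V × ((ℕ → Γ.E) → ℕ → Γ.E)) :=
  {p | {α : Γ.FinPath | Γ.cone α ⊆ D ∧ Γ.localAction f α = p}.Infinite}

/-- A nondegenerate map on `Σ_Γ` with domain `D`: it takes values in `Σ_Γ` and maps no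
cone contained in `D` to a single point. -/
def Nondegenerate (f : (ℕ → Γ.E) → ℕ → Γ.E) (D : Set (ℕ → Γ.E)) : Prop :=
  (∀ x ∈ D, f x ∈ Γ.shift) ∧
  ∀ α : Γ.FinPath, Γ.cone α ⊆ D → ¬∃ p, ∀ x ∈ Γ.cone α, f x = p

/-- Extension of a map `E → E'` between subsets of the sequence space to a globally
defined map (by the identity off `E`). -/
def homExt (E E' : Set (ℕ → Γ.E)) (f : ↥E → ↥E') : (ℕ → Γ.E) → ℕ → Γ.E :=
  fun x => if h : x ∈ E then ↑(f ⟨x, h⟩) else x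

/-- Extension of a permutation of `E` to a globally defined map. -/
def permExt (E : Set (ℕ → Γ.E)) (g : Equiv.Perm ↥E) : (ℕ → Γ.E) → ℕ → Γ.E :=
  Γ.homExt E E ⇑g

/-- `E` is a clopen subset of the subshift `Σ_Γ`. -/
def ClopenIn (E : Set (ℕ → Γ.E)) : Prop :=
  IsClopen {x : ↥Γ.shift | (x : ℕ → Γ.E) ∈ E}

/-- `U ⊆ Σ_Γ` is open in the subshift. -/
def OpenInShift (U : Set (ℕ → Γ.E)) : Prop :=
  IsOpen {x : ↥Γ.shift | (x : ℕ → Γ.E) ∈ U}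

/-- The subshift `Σ_Γ` has no isolated points. -/
def NoIsolatedPoints : Prop := ∀ x : ↥Γ.shift, ¬IsOpen ({x} : Set ↥Γ.shift)

/-- The subshift `Σ_Γ` has no empty cones. -/
def NoEmptyCones : Prop := ∀ α : Γ.FinPath, (Γ.cone α).Nonempty

/-- A permutation of `E` which is a homeomorphism and is a rational map:
an element of the rational group `R_{Γ,E}`. -/
def IsRatHomeo (E : Set (ℕ → Γ.E)) (g : Equiv.Perm ↥E) : Prop :=
  Continuous ⇑g ∧ Continuous ⇑g.symm ∧ Γ.RationalOn (Γ.permExt E g) E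

/-- `g` maps the cone `C_α` to the cone `C_β` by the canonical similarity
`α·ω ↦ β·ω`. -/
def RealizesCanonSim (E : Set (ℕ → Γ.E)) (g : Equiv.Perm ↥E) (α β : Γ.FinPath) : Prop :=
  ∀ x, ∀ hx : x ∈ E, x ∈ Γ.cone α → ↑(g ⟨x, hx⟩) = Γ.splice α β x

/-- A rational similarity group (RSG): a subgroup of the rational group `R_{Γ,E}` that
realizes the canonical similarity between any two cones `C_α, C_β ⊊ E` with
`t(α) = t(β)`. -/
def IsRSG (E : Set (ℕ → Γ.E)) (G : Subgroup (Equiv.Perm ↥E)) : Prop :=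
  (∀ g ∈ G, Γ.IsRatHomeo E g) ∧
  ∀ α β : Γ.FinPath, Γ.pathEnd α = Γ.pathEnd β → Γ.cone α ⊂ E → Γ.cone β ⊂ E →
    ∃ g ∈ G, Γ.RealizesCanonSim E g α β

/-- `h` locally agrees with the group `G`: every point has an open neighborhood on
which `h` coincides with some element of `G`. -/
def LocallyAgrees (E : Set (ℕ → Γ.E)) (G : Subgroup (Equiv.Perm ↥E))
    (h : Equiv.Perm ↥E) : Prop :=
  ∀ x : ↥E, ∃ U : Set ↥E, IsOpen U ∧ x ∈ U ∧ ∃ g ∈ G, ∀ u ∈ U, h u = g u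

/-- `G` is full as a group of homeomorphisms of `E`: every homeomorphism of `E` that
locally agrees with `G` already belongs to `G`. -/
def IsFullOn (E : Set (ℕ → Γ.E)) (G : Subgroup (Equiv.Perm ↥E)) : Prop :=
  ∀ h : Equiv.Perm ↥E, Continuous ⇑h → Continuous ⇑h.symm →
    Γ.LocallyAgrees E G h → h ∈ G

/-- The nucleus `𝒩_G` of a subgroup `G ≤ R_{Γ,E}`: the union of the nuclei of its
elements. -/
def groupNucleus (E : Set (ℕ → Γ.E)) (G : Subgroup (Equiv.Perm ↥E)) :
    Set (Γ.V × ((ℕ → Γ.E) → ℕ → Γ.E)) :=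
  ⋃ g ∈ G, Γ.nucleusOf (Γ.permExt E g) E

/-- An edge of the induced subgraph on a set `W` of nodes. -/
def InducedEdge (W : Set Γ.V) (e : Γ.E) : Prop := Γ.o e ∈ W ∧ Γ.t e ∈ W

/-- A path of the induced subgraph on `W`. -/
def PathIn (W : Set Γ.V) (α : Γ.FinPath) : Prop :=
  α.start ∈ W ∧ ∀ e ∈ α.edges, Γ.InducedEdge W e

/-- The induced subgraph on `W` is strongly connected and is not a directed cycle,
i.e. `Σ_{Γ₀}` is irreducible (where `Γ₀` is the induced subgraph on `W`). -/
def IrreducibleOn (W : Set Γ.V) : Prop :=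
  (∀ v ∈ W, ∀ w ∈ W, ∃ α : Γ.FinPath,
      α.start = v ∧ Γ.pathEnd α = w ∧ α.edges ≠ [] ∧ Γ.PathIn W α) ∧
  ¬∀ v ∈ W, ∃! e : Γ.E, Γ.InducedEdge W e ∧ Γ.o e = v

/-- `Σ_Γ` has an irreducible core: an induced subgraph `Γ₀` (on a node set `W`) with
`Σ_{Γ₀}` irreducible, such that every node has a directed path to `Γ₀` and every
sufficiently long directed path ends in `Γ₀`. -/
def HasIrreducibleCore : Prop :=
  ∃ W : Set Γ.V, Γ.IrreducibleOn W ∧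
    (∀ v : Γ.V, ∃ α : Γ.FinPath, α.start = v ∧ Γ.pathEnd α ∈ W) ∧
    ∃ N : ℕ, ∀ α : Γ.FinPath, α.edges.length = N → Γ.pathEnd α ∈ W

/-- `G ≤ R_{Γ,E}` is contracting: `Σ_Γ` has an irreducible core and the nucleus `𝒩_G`
is finite. -/
def IsContracting (E : Set (ℕ → Γ.E)) (G : Subgroup (Equiv.Perm ↥E)) : Prop :=
  Γ.HasIrreducibleCore ∧ (Γ.groupNucleus E G).Finite

/-- An element of the Thompson group `V_{Γ,E}`: there are partitions of `E` into cones
`C_{α_1},…,C_{α_k}` and `C_{β_1},…,C_{β_k}` with `t(α_i) = t(β_i)` such that `g` maps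
each `C_{α_i}` to `C_{β_i}` by the canonical similarity. -/
def IsThompson (E : Set (ℕ → Γ.E)) (g : Equiv.Perm ↥E) : Prop :=
  ∃ (k : ℕ) (α β : Fin k → Γ.FinPath),
    (∀ i, Γ.pathEnd (α i) = Γ.pathEnd (β i)) ∧
    E = (⋃ i, Γ.cone (α i)) ∧
    Pairwise (fun i j => Disjoint (Γ.cone (α i)) (Γ.cone (α j))) ∧
    E = (⋃ i, Γ.cone (β i)) ∧
    Pairwise (fun i j => Disjoint (Γ.cone (β i)) (Γ.cone (β j))) ∧
    ∀ i, Γ.RealizesCanonSim E g (α i) (β i)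

/-- A rational (eventually repeating) point `σ·τ^∞` of `Σ_Γ`. -/
def IsRationalPt (x : ℕ → Γ.E) : Prop :=
  ∃ σ τ : Γ.FinPath, τ.edges ≠ [] ∧
    (∀ (i : ℕ) (h : i < σ.edges.length), x i = σ.edges.get ⟨i, h⟩) ∧
    ∀ i : ℕ, σ.edges.length ≤ i →
      ∀ h : (i - σ.edges.length) % τ.edges.length < τ.edges.length,
        x i = τ.edges.get ⟨(i - σ.edges.length) % τ.edges.length, h⟩

/-- `β = f̄(α)`: the cone `C_β` is the smallest cone containing `f(C_α)`, with `β` the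
greatest common prefix of the points of `f(C_α)`. -/
def IsBar (f : (ℕ → Γ.E) → ℕ → Γ.E) (α β : Γ.FinPath) : Prop :=
  f '' Γ.cone α ⊆ Γ.cone β ∧
  ∀ γ : Γ.FinPath, f '' Γ.cone α ⊆ Γ.cone γ →
    Γ.cone β ⊆ Γ.cone γ ∧ γ.edges.length ≤ β.edges.length

end FinDigraph

namespace ChartGroup

/-- A chart of type `w` in `X` is a map from the model space `C w` to `X`. -/
abbrev Chart {W : Type} (C : W → Type) (X : Type) := Σ w : W, (C w → X)

variable {W : Type} {C : W → Type} {X Y : Type}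

/-- Postcomposition of a chart with a map. -/
def push (f : X → Y) (φ : Chart C X) : Chart C Y := ⟨φ.1, f ∘ φ.2⟩

/-- The image of a chart. -/
def img (φ : Chart C X) : Set X := Set.range φ.2

@[simp] theorem push_mk (f : X → Y) (w : W) (h : C w → X) :
    push f (⟨w, h⟩ : Chart C X) = ⟨w, f ∘ h⟩ := rfl

@[simp] theorem push_one (φ : Chart C X) : push (1 : Equiv.Perm X) φ = φ := rfl

theorem push_mul (g h : Equiv.Perm X) (φ : Chart C X) :
    push (g * h) φ = push g (push h φ) := rfl

@[simp] theorem push_inv_push (g : Equiv.Perm X) (φ : Chart C X) :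
    push (g⁻¹ : Equiv.Perm X) (push g φ) = φ := by
  rw [← push_mul, inv_mul_cancel, push_one]

theorem img_push (f : X → Y) (φ : Chart C X) : img (push f φ) = f '' img φ :=
  Set.range_comp f φ.2

theorem push_eq_self {g : X → X} {φ : Chart C X} (h : ∀ x ∈ img φ, g x = x) :
    push g φ = φ := by
  obtain ⟨w, f⟩ := φ
  simp only [push_mk]
  congr 1
  funext c
  exact h _ ⟨c, rfl⟩

theorem eq_of_push_eq_self {g : X → X} {φ : Chart C X} (h : push g φ = φ) {x : X}
    (hx : x ∈ img φ) : g x = x := by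
  obtain ⟨w, f⟩ := φ
  obtain ⟨c, rfl⟩ := hx
  simp only [push_mk, Sigma.mk.injEq, heq_eq_eq, true_and] at h
  exact congrFun h c

/-- `s` exchanges the charts `φ` and `ψ` and is the identity off their images. -/
structure IsSwap (s : Equiv.Perm X) (φ ψ : Chart C X) : Prop where
  left : push s φ = ψ
  right : push s ψ = φ
  off : ∀ x, x ∉ img φ → x ∉ img ψ → s x = x

namespace IsSwap

variable {s t : Equiv.Perm X} {φ ψ κ : Chart C X}

theorem symm (h : IsSwap s φ ψ) : IsSwap s ψ φ :=
  ⟨h.right, h.left, fun x h₁ h₂ => h.off x h₂ h₁⟩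

theorem conj (h : IsSwap s φ ψ) (g : Equiv.Perm X) :
    IsSwap (g * s * g⁻¹) (push g φ) (push g ψ) := by
  refine ⟨?_, ?_, ?_⟩
  · rw [push_mul, push_inv_push, push_mul, h.left]
  · rw [push_mul, push_inv_push, push_mul, h.right]
  · intro x h₁ h₂
    rw [img_push] at h₁ h₂
    have := h.off (g⁻¹ x) (fun hx => h₁ ⟨_, hx, by simp⟩) (fun hx => h₂ ⟨_, hx, by simp⟩)
    rw [Equiv.Perm.mul_apply, Equiv.Perm.mul_apply, this]
    exact g.apply_symm_apply x

theorem eq (h : IsSwap s φ ψ) (h' : IsSwap t φ ψ) : s = t := by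
  have key : t⁻¹ * s = 1 := by
    ext x
    by_cases h₁ : x ∈ img φ
    · refine eq_of_push_eq_self ?_ h₁
      rw [push_mul, h.left, ← h'.left, push_inv_push]
    by_cases h₂ : x ∈ img ψ
    · refine eq_of_push_eq_self ?_ h₂
      rw [push_mul, h.right, ← h'.right, push_inv_push]
    · rw [Equiv.Perm.mul_apply, h.off x h₁ h₂, Equiv.Perm.inv_eq_iff_eq]
      exact (h'.off x h₁ h₂).symm
  exact (inv_mul_eq_one.1 key).symm

/-- If `κ` is exchanged with both `φ` and `ψ`, then conjugation exchanges `φ` and `ψ`. -/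
theorem third (h : IsSwap s φ κ) (h' : IsSwap t ψ κ) (h₁ : Disjoint (img φ) (img ψ))
    (h₂ : Disjoint (img ψ) (img κ)) : IsSwap (s * t * s⁻¹) φ ψ := by
  have := h'.conj s
  rw [h.right, push_eq_self (fun x hx => h.off x (h₁.notMem_of_mem_right hx)
    (h₂.notMem_of_mem_left hx))] at this
  exact this.symm

end IsSwap

theorem exists_isSwap {φ ψ : Chart C X} (hw : φ.1 = ψ.1) (hφ : Function.Injective φ.2)
    (hψ : Function.Injective ψ.2) (hd : Disjoint (img φ) (img ψ)) :
    ∃ s : Equiv.Perm X, IsSwap s φ ψ := by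
  obtain ⟨w, f⟩ := φ
  obtain ⟨w', f'⟩ := ψ
  obtain rfl : w = w' := hw
  simp only at hφ hψ
  have hne : ∀ c c', f c ≠ f' c' := fun c c' h =>
    Set.disjoint_left.1 hd ⟨c, rfl⟩ ⟨c', h.symm⟩
  let σ : X → X := fun x =>
    if h : ∃ c, f c = x then f' h.choose else if h : ∃ c, f' c = x then f h.choose else x
  have h₁ : ∀ c, σ (f c) = f' c := by
    intro c
    have h : ∃ c', f c' = f c := ⟨c, rfl⟩
    simp only [σ, dif_pos h, hφ h.choose_spec]
  have h₂ : ∀ c, σ (f' c) = f c := by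
    intro c
    have h : ∃ c', f' c' = f' c := ⟨c, rfl⟩
    have h' : ¬ ∃ c', f c' = f' c := fun ⟨c', h⟩ => hne _ _ h
    simp only [σ, dif_neg h', dif_pos h, hψ h.choose_spec]
  have h₃ : ∀ x, x ∉ Set.range f → x ∉ Set.range f' → σ x = x := by
    intro x h h'
    have h : ¬ ∃ c, f c = x := h
    have h' : ¬ ∃ c, f' c = x := h'
    simp only [σ, dif_neg h, dif_neg h']
  have hσ : Function.Involutive σ := by
    intro x
    by_cases h : x ∈ Set.range f
    · obtain ⟨c, rfl⟩ := h
      rw [h₁, h₂]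
    by_cases h' : x ∈ Set.range f'
    · obtain ⟨c, rfl⟩ := h'
      rw [h₂, h₁]
    rw [h₃ x h h', h₃ x h h']
  refine ⟨hσ.toPerm, ?_, ?_, h₃⟩
  · simp only [push_mk, Function.Involutive.coe_toPerm]
    congr 1
    exact funext h₁
  · simp only [push_mk, Function.Involutive.coe_toPerm]
    congr 1
    exact funext h₂

/-- The group generated by the exchanges of disjoint charts from a given set. -/
def swapGroup (Φ : Set (Chart C X)) : Subgroup (Equiv.Perm X) :=
  Subgroup.closure {s | ∃ φ ∈ Φ, ∃ ψ ∈ Φ, Disjoint (img φ) (img ψ) ∧ IsSwap s φ ψ}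

theorem finite_swaps {Φ : Set (Chart C X)} (hΦ : Φ.Finite) :
    {s : Equiv.Perm X | ∃ φ ∈ Φ, ∃ ψ ∈ Φ,
      Disjoint (img φ) (img ψ) ∧ IsSwap s φ ψ}.Finite := by
  have : (⋃ φ ∈ Φ, ⋃ ψ ∈ Φ, {s : Equiv.Perm X | IsSwap s φ ψ}).Finite :=
    hΦ.biUnion fun φ _ => hΦ.biUnion fun ψ _ =>
      Set.Subsingleton.finite fun s hs t ht => IsSwap.eq hs ht
  refine this.subset ?_
  rintro s ⟨φ, hφ, ψ, hψ, -, h⟩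
  simp only [Set.mem_iUnion]
  exact ⟨φ, hφ, ψ, hψ, h⟩

/-- The number of charts of a family whose image contains a given point. -/
def cover (A : Multiset (Chart C X)) (x : X) : ℕ := A.countP (fun φ => x ∈ img φ)

@[simp] theorem cover_zero (x : X) : cover (0 : Multiset (Chart C X)) x = 0 := rfl

theorem cover_add (A B : Multiset (Chart C X)) (x : X) :
    cover (A + B) x = cover A x + cover B x := Multiset.countP_add _ _ _

theorem cover_cons (φ : Chart C X) (A : Multiset (Chart C X)) (x : X) :
    cover (φ ::ₘ A) x = cover A x + if x ∈ img φ then 1 else 0 := Multiset.countP_cons _ _ _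

theorem cover_singleton (φ : Chart C X) (x : X) :
    cover {φ} x = if x ∈ img φ then 1 else 0 := by
  rw [← Multiset.cons_zero, cover_cons, cover_zero, zero_add]

theorem cover_eq_zero {A : Multiset (Chart C X)} {x : X} :
    cover A x = 0 ↔ ∀ φ ∈ A, x ∉ img φ := Multiset.countP_eq_zero

theorem cover_pos {A : Multiset (Chart C X)} {x : X} :
    0 < cover A x ↔ ∃ φ ∈ A, x ∈ img φ := Multiset.countP_pos

theorem cover_map (g : Equiv.Perm X) (A : Multiset (Chart C X)) (x : X) :
    cover (A.map (push g)) x = cover A (g⁻¹ x) := by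
  induction A using Multiset.induction_on with
  | empty => rfl
  | cons φ A ih =>
    rw [Multiset.map_cons, cover_cons, cover_cons, ih, img_push]
    congr 2
    rw [Equiv.image_eq_preimage_symm]
    rfl

/-- An elementary move: a finite partition of the model space `C src` by injective charts. -/
structure Move (C : W → Type) where
  src : W
  ch : List (Chart C (C src))
  inj : ∀ ψ ∈ ch, Function.Injective ψ.2
  cov : ∀ c, cover (ch : Multiset (Chart C (C src))) c = 1

/-- The charts into which a move subdivides a chart. -/
def Move.app (μ : Move C) (f : C μ.src → X) : List (Chart C X) := μ.ch.map (push f)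

theorem Move.app_comp (μ : Move C) (g : X → Y) (f : C μ.src → X) :
    (μ.app f).map (push g) = μ.app (g ∘ f) := by
  simp [Move.app, List.map_map]
  intros; rfl

theorem Move.cover_app (μ : Move C) {f : C μ.src → X} (hf : Function.Injective f) (x : X) :
    cover (μ.app f : Multiset (Chart C X)) x = if x ∈ Set.range f then 1 else 0 := by
  split_ifs with h
  · obtain ⟨c, rfl⟩ := h
    rw [← μ.cov c, cover, cover, Move.app, ← Multiset.map_coe, Multiset.countP_map,
      Multiset.countP_eq_card_filter]
    congr 1
    refine Multiset.filter_congr fun ψ _ => ?_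
    rw [img_push]
    exact hf.mem_set_image
  · rw [cover_eq_zero]
    intro φ hφ hx
    simp only [Move.app, Multiset.mem_coe, List.mem_map] at hφ
    obtain ⟨ψ, -, rfl⟩ := hφ
    obtain ⟨c, rfl⟩ := hx
    exact h ⟨_, rfl⟩

theorem Move.eq_of_app_eq (μ : Move C) {f f' : C μ.src → X} (h : μ.app f = μ.app f') :
    f = f' := by
  funext c
  have h₁ : 0 < cover (μ.ch : Multiset (Chart C (C μ.src))) c := by rw [μ.cov c]; exact one_pos
  obtain ⟨ψ, hψ, a, rfl⟩ := cover_pos.1 h₁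
  have h₂ := (List.map_inj_left.1 h) ψ (by simpa using hψ)
  obtain ⟨w, u⟩ := ψ
  simp only [push_mk, Sigma.mk.injEq, heq_eq_eq, true_and] at h₂
  exact congrFun h₂ a

variable {ι : Type}

/-- `Path mv A k B`: the family `B` is obtained from `A` by applying moves and inverse moves,
and `k` records how often each move was applied, counted with sign. -/
inductive Path (mv : ι → Move C) (A : Multiset (Chart C X)) :
    (ι → ℤ) → Multiset (Chart C X) → Prop
  | refl : Path mv A 0 A
  | fwd {k : ι → ℤ} {R : Multiset (Chart C X)} (i : ι) (f : C (mv i).src → X) :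
      Path mv A k (⟨(mv i).src, f⟩ ::ₘ R) →
      Path mv A (k + Pi.single i 1) (((mv i).app f : Multiset (Chart C X)) + R)
  | bwd {k : ι → ℤ} {R : Multiset (Chart C X)} (i : ι) (f : C (mv i).src → X) :
      Path mv A k (((mv i).app f : Multiset (Chart C X)) + R) →
      Path mv A (k - Pi.single i 1) (⟨(mv i).src, f⟩ ::ₘ R)

namespace Path

variable {mv : ι → Move C} {A B D : Multiset (Chart C X)} {k l : ι → ℤ}

theorem trans (h : Path mv A k B) (h' : Path mv B l D) : Path mv A (k + l) D := by
  induction h' with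
  | refl => simpa using h
  | fwd i f _ ih => rw [← add_assoc]; exact ih.fwd i f
  | bwd i f _ ih => rw [← add_sub_assoc]; exact ih.bwd i f

theorem symm (h : Path mv A k B) : Path mv B (-k) A := by
  induction h with
  | refl => simpa using Path.refl
  | fwd i f _ ih =>
    have := ((Path.refl (mv := mv)).bwd i f).trans ih
    rw [zero_sub, ← neg_add_rev] at this
    exact this
  | bwd i f _ ih =>
    have := ((Path.refl (mv := mv)).fwd i f).trans ih
    rw [zero_add, ← sub_eq_add_neg, ← neg_sub] at this
    exact this

theorem map (h : Path mv A k B) (g : X → X) :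
    Path mv (A.map (push g)) k (B.map (push g)) := by
  induction h with
  | refl => exact Path.refl
  | fwd i f _ ih =>
    rw [Multiset.map_cons, push_mk] at ih
    rw [Multiset.map_add, Multiset.map_coe, Move.app_comp]
    exact ih.fwd i _
  | bwd i f _ ih =>
    rw [Multiset.map_add, Multiset.map_coe, Move.app_comp] at ih
    rw [Multiset.map_cons, push_mk]
    exact ih.bwd i _

theorem add_right (h : Path mv A k B) (R : Multiset (Chart C X)) :
    Path mv (A + R) k (B + R) := by
  induction h with
  | refl => exact Path.refl
  | fwd i f _ ih =>
    rw [Multiset.cons_add] at ih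
    rw [add_assoc]
    exact ih.fwd i _
  | bwd i f _ ih =>
    rw [add_assoc] at ih
    rw [Multiset.cons_add]
    exact ih.bwd i _

theorem add (h : Path mv A k B) {A' B' : Multiset (Chart C X)} (h' : Path mv A' l B') :
    Path mv (A + A') (k + l) (B + B') := by
  have h₂ := h'.add_right B
  rw [add_comm A', add_comm B'] at h₂
  exact (h.add_right A').trans h₂

end Path

end ChartGroup

namespace ChartGroup

variable {W : Type} {C : W → Type} {X : Type} {ι : Type}

/-- A set of root charts in three disjoint pieces, such that every model space embeds into every
piece by a root chart, together with moves subdividing the model spaces. -/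
structure System (ι : Type) (C : W → Type) (X : Type) where
  mv : ι → Move C
  root : Set (Chart C X)
  piece : Fin 3 → Set X
  disj : ∀ i j, i ≠ j → Disjoint (piece i) (piece j)
  root_inj : ∀ φ ∈ root, Function.Injective φ.2
  root_mem : ∀ φ ∈ root, ∃ i, img φ ⊆ piece i
  exists_root : ∀ i w, ∃ φ ∈ root, φ.1 = w ∧ img φ ⊆ piece i

namespace System

variable (S : System ι C X)

/-- The charts obtained by subdividing a root chart once. -/
def kids : Set (Chart C X) :=
  {χ | ∃ (i : ι) (f : C (S.mv i).src → X) (ψ : Chart C (C (S.mv i).src)),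
    ⟨(S.mv i).src, f⟩ ∈ S.root ∧ ψ ∈ (S.mv i).ch ∧ χ = push f ψ}

/-- The group generated by exchanges of root charts and their children. -/
def group : Subgroup (Equiv.Perm X) := swapGroup (S.root ∪ S.kids)

/-- The charts obtained by iterated subdivision of root charts. -/
inductive Gen : Chart C X → Prop
  | root {φ : Chart C X} : φ ∈ S.root → Gen φ
  | kid (i : ι) (f : C (S.mv i).src → X) (ψ : Chart C (C (S.mv i).src)) :
      Gen ⟨(S.mv i).src, f⟩ → ψ ∈ (S.mv i).ch → Gen (push f ψ)

variable {S}

theorem img_push_subset {Z : Type} (f : Z → X) (ψ : Chart C Z) :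
    img (push f ψ) ⊆ Set.range f := by
  rw [img_push]; exact Set.image_subset_range _ _

theorem push_injective {Z : Type} {f : Z → X} {ψ : Chart C Z} (hf : Function.Injective f)
    (hψ : Function.Injective ψ.2) : Function.Injective (push f ψ).2 := hf.comp hψ

theorem Gen.inj {φ : Chart C X} (h : S.Gen φ) : Function.Injective φ.2 := by
  induction h with
  | root h => exact S.root_inj _ h
  | kid i f ψ _ hψ ih => exact push_injective ih ((S.mv i).inj ψ hψ)

theorem Gen.piece {φ : Chart C X} (h : S.Gen φ) : ∃ i, img φ ⊆ S.piece i := by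
  induction h with
  | root h => exact S.root_mem _ h
  | kid i f ψ _ hψ ih =>
    obtain ⟨j, hj⟩ := ih
    exact ⟨j, (img_push_subset f ψ).trans hj⟩

theorem exists_ne_ne (a b : Fin 3) : ∃ c : Fin 3, c ≠ a ∧ c ≠ b := by
  revert a b; decide

theorem disjoint_of_piece {φ ψ : Chart C X} {i j : Fin 3} (h : i ≠ j) (hφ : img φ ⊆ S.piece i)
    (hψ : img ψ ⊆ S.piece j) : Disjoint (img φ) (img ψ) :=
  (S.disj i j h).mono hφ hψ

theorem swap_mem {φ ψ : Chart C X} (hφ : φ ∈ S.root ∪ S.kids) (hψ : ψ ∈ S.root ∪ S.kids)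
    (hw : φ.1 = ψ.1) (hφi : Function.Injective φ.2) (hψi : Function.Injective ψ.2)
    (hd : Disjoint (img φ) (img ψ)) : ∃ s ∈ S.group, IsSwap s φ ψ := by
  obtain ⟨s, hs⟩ := exists_isSwap hw hφi hψi hd
  exact ⟨s, Subgroup.subset_closure ⟨φ, hφ, ψ, hψ, hd, hs⟩, hs⟩

theorem third_mem {φ ψ κ : Chart C X} (h : ∃ s ∈ S.group, IsSwap s φ κ)
    (h' : ∃ s ∈ S.group, IsSwap s ψ κ) (h₁ : Disjoint (img φ) (img ψ))
    (h₂ : Disjoint (img ψ) (img κ)) : ∃ s ∈ S.group, IsSwap s φ ψ := by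
  obtain ⟨s, hs, h⟩ := h
  obtain ⟨t, ht, h'⟩ := h'
  exact ⟨s * t * s⁻¹, S.group.mul_mem (S.group.mul_mem hs ht) (S.group.inv_mem hs),
    h.third h' h₁ h₂⟩

theorem Gen.swap_root {φ : Chart C X} (h : S.Gen φ) :
    ∀ κ ∈ S.root, φ.1 = κ.1 → Disjoint (img φ) (img κ) → ∃ s ∈ S.group, IsSwap s φ κ := by
  induction h with
  | root h =>
    intro κ hκ hw hd
    exact swap_mem (Or.inl h) (Or.inl hκ) hw (S.root_inj _ h) (S.root_inj _ hκ) hd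
  | kid i f ψ hf hψ ih =>
    intro κ hκ hw hd
    obtain ⟨a, ha⟩ := hf.piece
    obtain ⟨d, hdp⟩ := S.root_mem κ hκ
    obtain ⟨b, hba, hbd⟩ := exists_ne_ne a d
    obtain ⟨c, hca, hcb⟩ := exists_ne_ne a b
    obtain ⟨κ₂, hκ₂, hκ₂w, hκ₂b⟩ := S.exists_root b ψ.1
    obtain ⟨⟨w', f'⟩, hκ₁, hκ₁w, hκ₁c⟩ := S.exists_root c (S.mv i).src
    simp only at hκ₁w
    subst hκ₁w
    obtain ⟨s, hs, hsw⟩ := ih _ hκ₁ rfl (disjoint_of_piece hca.symm ha hκ₁c)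
    have hf' : img (push f' ψ) ⊆ S.piece c := (img_push_subset f' ψ).trans hκ₁c
    have hφa : img (push f ψ) ⊆ S.piece a := (img_push_subset f ψ).trans ha
    obtain ⟨t, ht, htw⟩ := swap_mem (S := S) (φ := push f' ψ) (ψ := κ₂)
      (Or.inr ⟨i, f', ψ, hκ₁, hψ, rfl⟩) (Or.inl hκ₂) hκ₂w.symm
      (push_injective (S.root_inj ⟨_, f'⟩ hκ₁) ((S.mv i).inj ψ hψ)) (S.root_inj _ hκ₂)
      (disjoint_of_piece hcb hf' hκ₂b)
    have hc := htw.conj s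
    have e₁ : push s (push f' ψ) = push f ψ := by
      have := hsw.right
      simp only [push_mk, Sigma.mk.injEq, heq_eq_eq, true_and] at this
      rw [← this]; rfl
    have e₂ : push s κ₂ = κ₂ := push_eq_self fun x hx => hsw.off x
      ((disjoint_of_piece hba hκ₂b ha).notMem_of_mem_left hx)
      ((disjoint_of_piece hcb.symm hκ₂b hκ₁c).notMem_of_mem_left hx)
    rw [e₁, e₂] at hc
    have hdκ : Disjoint (img κ) (img κ₂) := disjoint_of_piece hbd.symm hdp hκ₂b
    exact third_mem ⟨_, S.group.mul_mem (S.group.mul_mem hs ht) (S.group.inv_mem hs), hc⟩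
      (swap_mem (Or.inl hκ) (Or.inl hκ₂) (hw.symm.trans hκ₂w.symm) (S.root_inj _ hκ)
        (S.root_inj _ hκ₂) hdκ) hd hdκ

theorem Gen.swap {φ ψ : Chart C X} (h : S.Gen φ) (h' : S.Gen ψ) (hw : φ.1 = ψ.1)
    (hd : Disjoint (img φ) (img ψ)) : ∃ s ∈ S.group, IsSwap s φ ψ := by
  obtain ⟨a, ha⟩ := h.piece
  obtain ⟨b, hb⟩ := h'.piece
  obtain ⟨c, hca, hcb⟩ := exists_ne_ne a b
  obtain ⟨κ, hκ, hκw, hκc⟩ := S.exists_root c φ.1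
  have hdκ := disjoint_of_piece hcb.symm hb hκc
  exact third_mem (h.swap_root κ hκ hκw.symm (disjoint_of_piece hca.symm ha hκc))
    (h'.swap_root κ hκ (hw.symm.trans hκw.symm) hdκ) hd hdκ

theorem disjoint_of_cover {φ ψ : Chart C X} {A : Multiset (Chart C X)}
    (h : ∀ x, cover (φ ::ₘ A) x ≤ 1) (hψ : ψ ∈ A) : Disjoint (img φ) (img ψ) := by
  rw [Set.disjoint_left]
  intro x hx hx'
  have h₁ := h x
  have h₂ : 0 < cover A x := cover_pos.2 ⟨ψ, hψ, hx'⟩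
  rw [cover_cons, if_pos hx] at h₁
  omega

theorem map_push_eq_self {g : X → X} {A : Multiset (Chart C X)}
    (h : ∀ φ ∈ A, ∀ x ∈ img φ, g x = x) : A.map (push g) = A :=
  (Multiset.map_congr rfl fun φ hφ => push_eq_self (h φ hφ)).trans (Multiset.map_id _)

theorem map_push_one (A : Multiset (Chart C X)) : A.map (push (1 : Equiv.Perm X)) = A :=
  map_push_eq_self fun _ _ _ _ => rfl

theorem map_push_mul (g h : Equiv.Perm X) (A : Multiset (Chart C X)) :
    A.map (push (g * h)) = (A.map (push h)).map (push g) := by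
  rw [Multiset.map_map]; rfl

/-- Charts of a disjoint family can be permuted arbitrarily by the group. -/
theorem rearrange (l₁ l₂ : List (Chart C X)) (A : Multiset (Chart C X))
    (hA : ∀ φ ∈ A, S.Gen φ) (hc : ∀ x, cover A x ≤ 1)
    (h₁ : (l₁ : Multiset (Chart C X)) ≤ A) (h₂ : (l₂ : Multiset (Chart C X)) ≤ A)
    (hw : l₁.map Sigma.fst = l₂.map Sigma.fst) :
    ∃ s ∈ S.group, A.map (push s) = A ∧ (∀ x, cover A x = 0 → s x = x) ∧
      l₁.map (push s) = l₂ := by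
  induction hn : l₁.length generalizing l₁ l₂ A with
  | zero =>
    obtain rfl := List.eq_nil_of_length_eq_zero hn
    obtain rfl : l₂ = [] := by
      cases l₂ with
      | nil => rfl
      | cons => simp at hw
    exact ⟨1, S.group.one_mem, map_push_eq_self fun _ _ _ _ => rfl, fun _ _ => rfl, rfl⟩
  | succ n ih =>
    obtain _ | ⟨φ, l₁⟩ := l₁
    · simp at hn
    obtain _ | ⟨ψ, l₂⟩ := l₂
    · simp at hw
    simp only [List.map_cons, List.cons.injEq] at hw
    have key : ∃ s ∈ S.group, A.map (push s) = A ∧ (∀ x, cover A x = 0 → s x = x) ∧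
        push s φ = ψ := by
      by_cases hφψ : φ = ψ
      · exact ⟨1, S.group.one_mem, map_push_eq_self fun _ _ _ _ => rfl, fun _ _ => rfl, hφψ⟩
      have hφ : φ ∈ A := Multiset.mem_of_le h₁ (by simp)
      have hψ : ψ ∈ A := Multiset.mem_of_le h₂ (by simp)
      obtain ⟨A, rfl⟩ := Multiset.exists_cons_of_mem hφ
      have hψ' : ψ ∈ A := by
        rcases Multiset.mem_cons.1 hψ with h | h
        exacts [absurd h.symm hφψ, h]
      obtain ⟨s, hs, hsw⟩ := (hA _ hφ).swap (hA _ hψ) hw.1 (disjoint_of_cover hc hψ')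
      have hφA := fun χ hχ => disjoint_of_cover (ψ := χ) hc hχ
      have hc' := hc
      obtain ⟨A, rfl⟩ := Multiset.exists_cons_of_mem hψ'
      rw [show ∀ A : Multiset (Chart C X), φ ::ₘ ψ ::ₘ A = ψ ::ₘ φ ::ₘ A from
        fun A => Multiset.cons_swap _ _ _] at hc'
      have hψA := fun χ hχ => disjoint_of_cover (ψ := χ) hc' (Multiset.mem_cons_of_mem hχ)
      refine ⟨s, hs, ?_, ?_, hsw.left⟩
      · rw [Multiset.map_cons, Multiset.map_cons, hsw.left, hsw.right, Multiset.cons_swap]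
        congr 2
        refine map_push_eq_self fun χ hχ x hx => hsw.off x ?_ ?_
        · exact (hφA χ (Multiset.mem_cons_of_mem hχ)).notMem_of_mem_right hx
        · exact (hψA χ hχ).notMem_of_mem_right hx
      · intro x hx
        rw [cover_eq_zero] at hx
        exact hsw.off x (hx _ hφ) (hx _ hψ)
    obtain ⟨s, hs, hsA, hsx, hsφ⟩ := key
    obtain ⟨A', rfl⟩ := Multiset.exists_cons_of_mem (Multiset.mem_of_le h₂ (by simp) : ψ ∈ A)
    have h₁' : ((l₁.map (push s) : List (Chart C X)) : Multiset (Chart C X)) ≤ A' := by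
      have := Multiset.map_le_map h₁ (f := push s)
      rw [hsA, Multiset.map_coe, List.map_cons, hsφ, ← Multiset.cons_coe,
        Multiset.cons_le_cons_iff] at this
      exact this
    have h₂' : (l₂ : Multiset (Chart C X)) ≤ A' := by
      rwa [← Multiset.cons_coe, Multiset.cons_le_cons_iff] at h₂
    have hc' : ∀ x, cover A' x + (if x ∈ img ψ then 1 else 0) ≤ 1 := fun x => by
      rw [← cover_cons]; exact hc x
    obtain ⟨t, ht, htA, htx, htl⟩ := ih (l₁.map (push s)) l₂ A' (fun χ hχ => hA χ (Multiset.mem_cons_of_mem hχ))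
      (fun x => (Nat.le_add_right _ _).trans (hc' x)) h₁' h₂' (by
        rw [List.map_map]; exact hw.2) (by simpa using hn)
    have htψ : push t ψ = ψ := push_eq_self fun x hx => htx x (by
      have := hc' x
      rw [if_pos hx] at this
      omega)
    refine ⟨t * s, S.group.mul_mem ht hs, ?_, ?_, ?_⟩
    · rw [map_push_mul, hsA, Multiset.map_cons, htA, htψ]
    · intro x hx
      rw [Equiv.Perm.mul_apply, hsx x hx]
      rw [cover_cons] at hx
      exact htx x (by omega)
    · rw [List.map_cons, push_mul, hsφ, htψ, ← htl, List.map_map]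
      rfl

variable [Fintype ι]

/-- The family consisting of the first `2 * N` catalysts of every type; for each `i`, all but
the first `N + k i` of them are subdivided. -/
def catalysts (mv : ι → Move C) (cat : (i : ι) → ℕ → C (mv i).src → X) (N : ℕ) (k : ι → ℤ) :
    Multiset (Chart C X) :=
  ∑ p ∈ (Finset.univ : Finset ι) ×ˢ Finset.range (2 * N),
    if (p.2 : ℤ) < N + k p.1 then {⟨(mv p.1).src, cat p.1 p.2⟩}
    else ((mv p.1).app (cat p.1 p.2) : Multiset (Chart C X))

theorem catalysts_split {mv : ι → Move C} (cat : (i : ι) → ℕ → C (mv i).src → X) {N : ℕ}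
    {k : ι → ℤ} {i : ι} (h₁ : 0 ≤ N + k i) (h₂ : N + k i < 2 * N) :
    ∃ (j : ℕ) (R : Multiset (Chart C X)),
      catalysts mv cat N (k + Pi.single i 1) = ⟨(mv i).src, cat i j⟩ ::ₘ R ∧
      catalysts mv cat N k = ((mv i).app (cat i j) : Multiset (Chart C X)) + R := by
  obtain ⟨j, hj⟩ := Int.eq_ofNat_of_zero_le h₁
  have hp : (i, j) ∈ (Finset.univ : Finset ι) ×ˢ Finset.range (2 * N) := by
    simp only [Finset.mem_product, Finset.mem_univ, Finset.mem_range, true_and]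
    omega
  refine ⟨j, ∑ p ∈ ((Finset.univ : Finset ι) ×ˢ Finset.range (2 * N)).erase (i, j),
    if (p.2 : ℤ) < N + k p.1 then {⟨(mv p.1).src, cat p.1 p.2⟩}
    else ((mv p.1).app (cat p.1 p.2) : Multiset (Chart C X)), ?_, ?_⟩
  · rw [catalysts, ← Finset.add_sum_erase _ _ hp, ← Multiset.singleton_add]
    congr 1
    · simp only [Pi.add_apply, Pi.single_eq_same]
      rw [if_pos (by omega)]
    · refine Finset.sum_congr rfl ?_
      rintro ⟨i', j'⟩ hp'
      have hne := (Finset.mem_erase.1 hp').1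
      congr 1
      simp only [Pi.add_apply]
      by_cases hi : i' = i
      · subst hi
        have : j' ≠ j := fun h => hne (by rw [h])
        rw [Pi.single_eq_same]
        exact propext ⟨fun h => by omega, fun h => by omega⟩
      · rw [Pi.single_eq_of_ne hi, add_zero]
  · rw [catalysts, ← Finset.add_sum_erase _ _ hp]
    congr 1
    simp only
    rw [if_neg (by omega)]

theorem cover_catalysts {mv : ι → Move C} {cat : (i : ι) → ℕ → C (mv i).src → X}
    (hcat : ∀ i j, Function.Injective (cat i j)) (N : ℕ) (k : ι → ℤ) (x : X) :
    cover (catalysts mv cat N k) x = ∑ p ∈ (Finset.univ : Finset ι) ×ˢ Finset.range (2 * N),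
      if x ∈ Set.range (cat p.1 p.2) then 1 else 0 := by
  have : cover (catalysts mv cat N k) x
      = Multiset.countPAddMonoidHom (fun φ : Chart C X => x ∈ img φ) (catalysts mv cat N k) := rfl
  rw [this, catalysts, map_sum]
  refine Finset.sum_congr rfl fun p _ => ?_
  split_ifs with h₁ h₂ h₂
  · exact (cover_singleton _ _).trans (if_pos h₂)
  · exact (cover_singleton _ _).trans (if_neg h₂)
  · exact ((mv p.1).cover_app (hcat _ _) x).trans (if_pos h₂)
  · exact ((mv p.1).cover_app (hcat _ _) x).trans (if_neg h₂)

/-- A family of pairwise disjoint charts outside a given family. -/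
structure IsCatalyst (S : System ι C X) (A : Multiset (Chart C X))
    (cat : (i : ι) → ℕ → C (S.mv i).src → X) : Prop where
  gen : ∀ i j, S.Gen ⟨(S.mv i).src, cat i j⟩
  disj : ∀ i j i' j', (i, j) ≠ (i', j') →
    Disjoint (Set.range (cat i j)) (Set.range (cat i' j'))
  off : ∀ i j c, cover A (cat i j c) = 0

section

variable {A : Multiset (Chart C X)} {cat : (i : ι) → ℕ → C (S.mv i).src → X}

theorem IsCatalyst.cover_le (h : IsCatalyst S A cat) (hA : ∀ x, cover A x ≤ 1) (N : ℕ)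
    (k : ι → ℤ) (x : X) : cover (A + catalysts S.mv cat N k) x ≤ 1 := by
  rw [cover_add, cover_catalysts fun i j => (h.gen i j).inj]
  by_cases hx : ∃ p : ι × ℕ, x ∈ Set.range (cat p.1 p.2)
  · obtain ⟨⟨i, j⟩, hp⟩ := hx
    have h₀ : cover A x = 0 := by
      obtain ⟨c, rfl⟩ := hp
      exact h.off _ _ c
    rw [h₀, zero_add]
    refine (Finset.sum_le_sum (g := fun p => if p = (i, j) then 1 else 0) ?_).trans ?_
    · rintro ⟨i', j'⟩ -
      simp only
      split_ifs with h₁ h₂ h₂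
      · exact le_rfl
      · exact absurd hp (Set.disjoint_left.1 (h.disj _ _ _ _ h₂) h₁)
      · exact zero_le_one
      · exact le_rfl
    · rw [Finset.sum_ite_eq']
      split_ifs <;> simp
  · rw [Finset.sum_eq_zero fun p _ => if_neg fun hp => hx ⟨p, hp⟩]
    exact hA x

theorem IsCatalyst.gen_all (h : IsCatalyst S A cat) (hA : ∀ φ ∈ A, S.Gen φ) (N : ℕ)
    (k : ι → ℤ) : ∀ φ ∈ A + catalysts S.mv cat N k, S.Gen φ := by
  intro φ hφ
  rcases Multiset.mem_add.1 hφ with hφ | hφ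
  · exact hA φ hφ
  · obtain ⟨⟨i, j⟩, -, hφ⟩ := Multiset.mem_sum.1 hφ
    simp only at hφ
    split_ifs at hφ
    · rw [Multiset.mem_singleton.1 hφ]
      exact h.gen i j
    · obtain ⟨ψ, hψ, rfl⟩ := List.mem_map.1 (Multiset.mem_coe.1 hφ)
      exact (h.gen i j).kid i _ ψ hψ

theorem IsCatalyst.exists_of_path (h : IsCatalyst S A cat) (hG : ∀ φ ∈ A, S.Gen φ)
    (hA : ∀ x, cover A x ≤ 1) {k : ι → ℤ} {B : Multiset (Chart C X)} (hB : Path S.mv A k B) :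
    ∃ N₀ : ℕ, ∀ N ≥ N₀, ∃ u ∈ S.group,
      (∀ x, cover (A + catalysts S.mv cat N 0) x = 0 → u x = x) ∧
      (B + catalysts S.mv cat N 0).map (push u) = A + catalysts S.mv cat N (-k) := by
  have hcov : ∀ N k x, cover (A + catalysts S.mv cat N k) x
      = cover (A + catalysts S.mv cat N 0) x := fun N k x => by
    rw [cover_add, cover_add, cover_catalysts fun i j => (h.gen i j).inj,
      cover_catalysts fun i j => (h.gen i j).inj]
  induction hB with
  | refl =>
    refine ⟨0, fun N _ => ⟨1, S.group.one_mem, fun _ _ => rfl, ?_⟩⟩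
    rw [neg_zero]
    exact map_push_eq_self fun _ _ _ _ => rfl
  | @fwd k R i f _ ih =>
    obtain ⟨N₀, ih⟩ := ih
    refine ⟨max N₀ ((k i).natAbs + 2), fun N hN => ?_⟩
    obtain ⟨u, hu, hux, hum⟩ := ih N (le_of_max_le_left hN)
    have hN' := le_of_max_le_right hN
    have hki : (-(k + Pi.single i 1) : ι → ℤ) i = - k i - 1 := by
      simp only [Pi.neg_apply, Pi.add_apply, Pi.single_eq_same]; ring
    obtain ⟨j, D, hD₁, hD₂⟩ := catalysts_split cat (N := N) (k := -(k + Pi.single i 1)) (i := i)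
      (by rw [hki]; omega) (by rw [hki]; omega)
    rw [neg_add, neg_add_cancel_right] at hD₁
    rw [Multiset.cons_add, Multiset.map_cons, push_mk] at hum
    obtain ⟨s, hs, hsA, hsx, hsl⟩ := rearrange (S := S) [⟨(S.mv i).src, u ∘ f⟩]
      [⟨(S.mv i).src, cat i j⟩] _ (h.gen_all hG N (-k)) (h.cover_le hA N (-k))
      (by rw [← hum]; simp) (by rw [hD₁]; simp) rfl
    simp only [List.map_cons, List.map_nil, List.cons.injEq, and_true, push_mk] at hsl
    refine ⟨s * u, S.group.mul_mem hs hu, fun x hx => ?_, ?_⟩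
    · rw [Equiv.Perm.mul_apply, hux x hx, hsx x (by rw [hcov, hx])]
    have e := congrArg (Multiset.map (push s)) hum
    rw [hsA, hD₁, Multiset.map_cons, push_mk, hsl, Multiset.add_cons, Multiset.cons_inj_right,
      ← map_push_mul] at e
    have e' : (⇑s ∘ ⇑u ∘ f) = cat i j := by simpa using hsl
    rw [add_assoc, Multiset.map_add, Multiset.map_coe, Move.app_comp, e, hD₂, Equiv.Perm.coe_mul,
      Function.comp_assoc, e', add_left_comm]
  | @bwd k R i f _ ih =>
    obtain ⟨N₀, ih⟩ := ih
    refine ⟨max N₀ ((k i).natAbs + 2), fun N hN => ?_⟩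
    obtain ⟨u, hu, hux, hum⟩ := ih N (le_of_max_le_left hN)
    have hN' := le_of_max_le_right hN
    obtain ⟨j, D, hD₁, hD₂⟩ := catalysts_split cat (N := N) (k := -k) (i := i)
      (by rw [Pi.neg_apply]; omega) (by rw [Pi.neg_apply]; omega)
    rw [add_assoc, Multiset.map_add, Multiset.map_coe, Move.app_comp] at hum
    obtain ⟨s, hs, hsA, hsx, hsl⟩ := rearrange (S := S) ((S.mv i).app (u ∘ f))
      ((S.mv i).app (cat i j)) _ (h.gen_all hG N (-k)) (h.cover_le hA N (-k))
      (by rw [← hum]; exact Multiset.le_add_right _ _)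
      (by rw [hD₂, add_left_comm]; exact Multiset.le_add_right _ _)
      (by simp only [Move.app, List.map_map]; rfl)
    refine ⟨s * u, S.group.mul_mem hs hu, fun x hx => ?_, ?_⟩
    · rw [Equiv.Perm.mul_apply, hux x hx, hsx x (by rw [hcov, hx])]
    have e := congrArg (Multiset.map (push s)) hum
    rw [hsA, hD₂, Multiset.map_add, Multiset.map_coe, hsl, add_left_comm, add_right_inj,
      ← map_push_mul] at e
    rw [Move.app_comp] at hsl
    have e' := (S.mv i).eq_of_app_eq hsl
    rw [Multiset.cons_add, Multiset.map_cons, e, push_mk, Equiv.Perm.coe_mul,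
      Function.comp_assoc, e', neg_sub, sub_eq_neg_add, hD₁, Multiset.add_cons]

theorem IsCatalyst.mem_of_path_zero (h : IsCatalyst S A cat) (hG : ∀ φ ∈ A, S.Gen φ)
    (hA : ∀ x, cover A x ≤ 1) {g : Equiv.Perm X} (hg : ∀ x, cover A x = 0 → g x = x)
    (hp : Path S.mv A 0 (A.map (push g))) : g ∈ S.group := by
  obtain ⟨N, hN⟩ := h.exists_of_path hG hA hp
  obtain ⟨u, hu, hux, hum⟩ := hN N le_rfl
  rw [neg_zero] at hum
  set D := A + catalysts S.mv cat N 0 with hD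
  have hcat : (catalysts S.mv cat N 0).map (push g) = catalysts S.mv cat N 0 := by
    refine map_push_eq_self fun φ hφ x hx => hg x ?_
    have h₁ : 0 < cover (catalysts S.mv cat N 0) x := cover_pos.2 ⟨φ, hφ, hx⟩
    have h₂ := h.cover_le hA N 0 x
    rw [cover_add] at h₂
    omega
  have hug : D.map (push (u * g)) = D := by
    rw [map_push_mul, hD, Multiset.map_add, hcat, hum]
  obtain ⟨s, hs, -, hsx, hsl⟩ := rearrange (S := S) (D.toList.map (push (u * g))) D.toList D
    (h.gen_all hG N 0) (h.cover_le hA N 0)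
    (by rw [← Multiset.map_coe, Multiset.coe_toList, hug]) (by rw [Multiset.coe_toList])
    (by rw [List.map_map]; rfl)
  have hone : s * (u * g) = 1 := by
    ext x
    by_cases hx : cover D x = 0
    · have hx' : cover A x = 0 := by
        rw [hD, cover_add] at hx; omega
      simp only [Equiv.Perm.mul_apply, Equiv.Perm.one_apply]
      rw [hg x hx', hux x hx, hsx x hx]
    · obtain ⟨φ, hφ, hxφ⟩ := cover_pos.1 (Nat.pos_of_ne_zero hx)
      rw [List.map_map] at hsl
      have := (List.map_inj_left.1 (hsl.trans (List.map_id _).symm)) φ (Multiset.mem_toList.2 hφ)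
      exact eq_of_push_eq_self (g := ⇑(s * (u * g))) (φ := φ) this hxφ
  rw [← mul_assoc] at hone
  rw [eq_inv_of_mul_eq_one_right hone]
  exact S.group.inv_mem (S.group.mul_mem hs hu)

theorem kids_finite (hr : S.root.Finite) : S.kids.Finite := by
  have : (⋃ i, ⋃ φ ∈ S.root, {χ : Chart C X | ∃ (f : C (S.mv i).src → X),
      φ = ⟨(S.mv i).src, f⟩ ∧ ∃ ψ ∈ (S.mv i).ch, χ = push f ψ}).Finite := by
    refine Set.finite_iUnion fun i => hr.biUnion fun φ _ => ?_
    by_cases hφ : ∃ f : C (S.mv i).src → X, φ = ⟨(S.mv i).src, f⟩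
    · obtain ⟨f, rfl⟩ := hφ
      refine ((S.mv i).ch.finite_toSet.image (push f)).subset ?_
      rintro χ ⟨f', hf', ψ, hψ, rfl⟩
      simp only [Sigma.mk.injEq, heq_eq_eq, true_and] at hf'
      subst hf'
      exact ⟨ψ, hψ, rfl⟩
    · refine Set.Finite.subset Set.finite_empty ?_
      rintro χ ⟨f', hf', -⟩
      exact hφ ⟨f', hf'⟩
  refine this.subset ?_
  rintro χ ⟨i, f, ψ, hf, hψ, rfl⟩
  simp only [Set.mem_iUnion]
  exact ⟨i, _, hf, f, rfl, ψ, hψ, rfl⟩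

/-- A group of permutations whose elements move a fixed disjoint family of charts along paths is
contained in the group generated by the exchanges of root charts and their children, up to
finitely many further generators. -/
theorem IsCatalyst.exists_finite (h : IsCatalyst S A cat)
    (hG : ∀ φ ∈ A, S.Gen φ) (hA : ∀ x, cover A x ≤ 1) (K : Subgroup (Equiv.Perm X))
    (hK : ∀ g ∈ K, (∀ x, cover A x = 0 → g x = x) ∧
      ∃ k, Path S.mv A k (A.map (push g))) :
    ∃ F : Set (Equiv.Perm X), F.Finite ∧ F ⊆ K ∧ K ≤ S.group ⊔ Subgroup.closure F := by
  have hmul : ∀ g g' : Equiv.Perm X, ∀ k k', Path S.mv A k (A.map (push g)) →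
      Path S.mv A k' (A.map (push g')) → Path S.mv A (k + k') (A.map (push (g * g'))) := by
    intro g g' k k' h h'
    have := h'.map g
    rw [← map_push_mul] at this
    exact h.trans this
  have hinv : ∀ g : Equiv.Perm X, ∀ k, Path S.mv A k (A.map (push g)) →
      Path S.mv A (-k) (A.map (push (g⁻¹ : Equiv.Perm X))) := by
    intro g k h
    have := (h.map (g⁻¹ : Equiv.Perm X)).symm
    rw [← map_push_mul, inv_mul_cancel, map_push_one] at this
    exact this
  have hone : Path S.mv A 0 (A.map (push (1 : Equiv.Perm X))) := by
    rw [map_push_one]; exact Path.refl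
  let D : AddSubgroup (ι → ℤ) :=
    { carrier := {k | ∃ g ∈ K, Path S.mv A k (A.map (push g))}
      add_mem' := by
        rintro k k' ⟨g, hg, h⟩ ⟨g', hg', h'⟩
        exact ⟨g * g', K.mul_mem hg hg', hmul _ _ _ _ h h'⟩
      zero_mem' := ⟨1, K.one_mem, hone⟩
      neg_mem' := by
        rintro k ⟨g, hg, h⟩
        exact ⟨g⁻¹, K.inv_mem hg, hinv _ _ h⟩ }
  have hD : D.FG := by
    have := IsNoetherian.noetherian (AddSubgroup.toIntSubmodule D)
    rw [Submodule.fg_iff_addSubgroup_fg] at this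
    exact this
  obtain ⟨T, hT⟩ := hD
  have hT' : ∀ k ∈ T, ∃ g ∈ K, Path S.mv A k (A.map (push g)) := fun k hk =>
    show k ∈ D from hT ▸ AddSubgroup.subset_closure hk
  choose! γ hγ hγp using hT'
  refine ⟨γ '' T, T.finite_toSet.image γ, ?_, ?_⟩
  · rintro _ ⟨k, hk, rfl⟩
    exact hγ k hk
  have hFK : Subgroup.closure (γ '' T) ≤ K := by
    rw [Subgroup.closure_le]
    rintro _ ⟨k, hk, rfl⟩
    exact hγ k hk
  have key : ∀ k ∈ AddSubgroup.closure (T : Set (ι → ℤ)), ∃ u ∈ Subgroup.closure (γ '' T),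
      Path S.mv A k (A.map (push u)) := by
    intro k hk
    induction hk using AddSubgroup.closure_induction with
    | mem k hk => exact ⟨γ k, Subgroup.subset_closure ⟨k, hk, rfl⟩, hγp k hk⟩
    | zero => exact ⟨1, Subgroup.one_mem _, hone⟩
    | add k k' _ _ h h' =>
      obtain ⟨u, hu, h⟩ := h
      obtain ⟨u', hu', h'⟩ := h'
      exact ⟨u * u', Subgroup.mul_mem _ hu hu', hmul _ _ _ _ h h'⟩
    | neg k _ h =>
      obtain ⟨u, hu, h⟩ := h
      exact ⟨u⁻¹, Subgroup.inv_mem _ hu, hinv _ _ h⟩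
  intro g hg
  obtain ⟨k, hk⟩ := (hK g hg).2
  obtain ⟨u, hu, hup⟩ := key k (by rw [hT]; exact ⟨g, hg, hk⟩)
  have h₀ := hmul _ _ _ _ (hinv _ _ hup) hk
  rw [neg_add_cancel] at h₀
  have hmem := h.mem_of_path_zero hG hA (hK _ (K.mul_mem (K.inv_mem (hFK hu)) hg)).1 h₀
  have e : g = u * (u⁻¹ * g) := by group
  rw [e]
  exact Subgroup.mul_mem _ (Subgroup.mem_sup_right hu) (Subgroup.mem_sup_left hmem)

end

end System

end ChartGroup

namespace FinDigraph

variable {Γ : FinDigraph}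

/-- The sequence starting with the first `n` terms of `x` and continuing with `ω`. -/
def glue (n : ℕ) (x ω : ℕ → Γ.E) : ℕ → Γ.E := fun i => if i < n then x i else ω (i - n)

/-- The points of the subshift that start with the first `n` terms of `x`. -/
def cyl (x : ℕ → Γ.E) (n : ℕ) : Set (ℕ → Γ.E) := {y | y ∈ Γ.shift ∧ ∀ i < n, y i = x i}

theorem glue_of_lt {n i : ℕ} (h : i < n) (x ω : ℕ → Γ.E) : glue n x ω i = x i := if_pos h

theorem glue_of_le {n i : ℕ} (h : n ≤ i) (x ω : ℕ → Γ.E) : glue n x ω i = ω (i - n) :=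
  if_neg (by omega)

@[simp] theorem glue_add (n i : ℕ) (x ω : ℕ → Γ.E) : glue n x ω (n + i) = ω i := by
  rw [glue_of_le (by omega)]; congr 1; omega

@[simp] theorem glue_self (n : ℕ) (x ω : ℕ → Γ.E) : glue n x ω n = ω 0 := by
  simpa using glue_add n 0 x ω

theorem glue_congr {n : ℕ} {x y : ℕ → Γ.E} (h : ∀ i < n, x i = y i) (ω : ℕ → Γ.E) :
    glue n x ω = glue n y ω := by
  funext i
  by_cases hi : i < n
  · rw [glue_of_lt hi, glue_of_lt hi, h i hi]
  · rw [glue_of_le (by omega), glue_of_le (by omega)]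

theorem glue_injective (n : ℕ) (x : ℕ → Γ.E) : Function.Injective (glue n x) := by
  intro ω ω' h
  funext i
  simpa using congrFun h (n + i)

theorem glue_tail {n : ℕ} {x y : ℕ → Γ.E} (h : ∀ i < n, y i = x i) :
    glue n x (fun i => y (n + i)) = y := by
  funext i
  by_cases hi : i < n
  · rw [glue_of_lt hi, h i hi]
  · rw [glue_of_le (by omega)]; congr 1; omega

theorem glue_glue (n m : ℕ) (x y ω : ℕ → Γ.E) :
    glue n x (glue m y ω) = glue (n + m) (glue n x y) ω := by
  funext i
  by_cases h₁ : i < n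
  · rw [glue_of_lt h₁, glue_of_lt (by omega), glue_of_lt h₁]
  by_cases h₂ : i < n + m
  · rw [glue_of_le (by omega), glue_of_lt (by omega), glue_of_lt h₂, glue_of_le (by omega)]
  · rw [glue_of_le (by omega), glue_of_le (by omega), glue_of_le (by omega)]; congr 1; omega

theorem tail_mem_shift {x : ℕ → Γ.E} (hx : x ∈ Γ.shift) (n : ℕ) :
    (fun i => x (n + i)) ∈ Γ.shift := fun i => hx (n + i)

theorem glue_mem_shift {n : ℕ} {x ω : ℕ → Γ.E} (hx : x ∈ Γ.shift) (hω : ω ∈ Γ.shift)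
    (h : Γ.o (ω 0) = Γ.o (x n)) : glue n x ω ∈ Γ.shift := by
  intro i
  by_cases h₁ : i + 1 < n
  · rw [glue_of_lt h₁, glue_of_lt (by omega)]
    exact hx i
  by_cases h₂ : i + 1 = n
  · subst h₂
    rw [glue_self, glue_of_lt (by omega), h]
    exact hx i
  · rw [glue_of_le (by omega), glue_of_le (by omega), hω (i - n)]
    congr 2; omega

theorem mem_cyl_self {x : ℕ → Γ.E} (hx : x ∈ Γ.shift) (n : ℕ) : x ∈ cyl x n :=
  ⟨hx, fun _ _ => rfl⟩

theorem cyl_subset_shift (x : ℕ → Γ.E) (n : ℕ) : cyl x n ⊆ Γ.shift := fun _ h => h.1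

theorem cyl_mono {x : ℕ → Γ.E} {n m : ℕ} (h : n ≤ m) : cyl x m ⊆ cyl x n :=
  fun _ hy => ⟨hy.1, fun i hi => hy.2 i (hi.trans_le h)⟩

theorem cyl_congr {x y : ℕ → Γ.E} {n : ℕ} (h : ∀ i < n, x i = y i) : cyl x n = cyl y n := by
  ext z
  exact and_congr_right fun _ => forall₂_congr fun i hi => by rw [h i hi]

theorem mem_cyl_symm {x y : ℕ → Γ.E} {n : ℕ} (hx : x ∈ Γ.shift) (h : y ∈ cyl x n) :
    x ∈ cyl y n := ⟨hx, fun i hi => (h.2 i hi).symm⟩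

theorem cyl_eq_of_mem {x y : ℕ → Γ.E} {n : ℕ} (h : y ∈ cyl x n) : cyl y n = cyl x n :=
  cyl_congr h.2

theorem origin_eq {x y : ℕ → Γ.E} {n : ℕ} (hn : 1 ≤ n) (hx : x ∈ Γ.shift) (h : y ∈ cyl x n) :
    Γ.o (y n) = Γ.o (x n) := by
  obtain ⟨k, rfl⟩ := Nat.exists_eq_add_of_le' hn
  rw [← hx k, ← h.1 k, h.2 k (by omega)]

theorem glue_mem_cyl {n : ℕ} {x ω : ℕ → Γ.E} (hx : x ∈ Γ.shift) (hω : ω ∈ Γ.shift)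
    (h : Γ.o (ω 0) = Γ.o (x n)) : glue n x ω ∈ cyl x n :=
  ⟨glue_mem_shift hx hω h, fun _ hi => glue_of_lt hi _ _⟩

theorem exists_glue {n : ℕ} {x y : ℕ → Γ.E} (hn : 1 ≤ n) (hx : x ∈ Γ.shift) (h : y ∈ cyl x n) :
    ∃ ω ∈ Γ.shift, Γ.o (ω 0) = Γ.o (x n) ∧ glue n x ω = y :=
  ⟨_, tail_mem_shift h.1 n, origin_eq hn hx h, glue_tail h.2⟩

/-- `Y` is a union of cylinders of level `n`. -/
structure Sat (Y : Set (ℕ → Γ.E)) (n : ℕ) : Prop where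
  sub : Y ⊆ Γ.shift
  cyl : ∀ x ∈ Y, cyl x n ⊆ Y

namespace Sat

variable {Y Z : Set (ℕ → Γ.E)} {n m : ℕ}

theorem mono (h : Sat Y n) (hnm : n ≤ m) : Sat Y m :=
  ⟨h.sub, fun x hx => (cyl_mono hnm).trans (h.cyl x hx)⟩

theorem mem_iff (h : Sat Y n) {x y : ℕ → Γ.E} (hx : x ∈ Γ.shift) (hy : y ∈ FinDigraph.cyl x n) :
    y ∈ Y ↔ x ∈ Y :=
  ⟨fun h' => h.cyl y h' (mem_cyl_symm hx hy), fun h' => h.cyl x h' hy⟩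

theorem union (h : Sat Y n) (h' : Sat Z n) : Sat (Y ∪ Z) n :=
  ⟨Set.union_subset h.sub h'.sub, fun x hx => hx.elim
    (fun hx => (h.cyl x hx).trans Set.subset_union_left)
    (fun hx => (h'.cyl x hx).trans Set.subset_union_right)⟩

theorem diff (h : Sat Y n) (h' : Sat Z n) : Sat (Y \ Z) n :=
  ⟨Set.sdiff_subset.trans h.sub, fun x hx _ hy => ⟨h.cyl x hx.1 hy, fun hyZ =>
    hx.2 ((h'.mem_iff (h.sub hx.1) hy).1 hyZ)⟩⟩

end Sat

theorem sat_cyl (x : ℕ → Γ.E) (n : ℕ) : Sat (cyl x n) n :=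
  ⟨cyl_subset_shift x n, fun _ hy => (cyl_eq_of_mem hy).subset⟩

theorem disjoint_cyl {x y : ℕ → Γ.E} {n m i : ℕ} (hn : i < n) (hm : i < m) (h : x i ≠ y i) :
    Disjoint (cyl x n) (cyl y m) :=
  Set.disjoint_left.2 fun _ hz hz' => h ((hz.2 i hn).symm.trans (hz'.2 i hm))

/-- The dynamical properties of a full contracting rational similarity group that are used in
the proof: `E` is a clopen subset of the subshift, `H` the group, extended by the identity
off `E`, and `core` the set of nodes reachable from everywhere. -/
structure Setting (Γ : FinDigraph) where
  E : Set (ℕ → Γ.E)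
  H : Subgroup (Equiv.Perm (ℕ → Γ.E))
  nuc : Set (Γ.V × ((ℕ → Γ.E) → ℕ → Γ.E))
  core : Set Γ.V
  level : ℕ
  level_pos : 1 ≤ level
  sat : Sat E level
  ne : E.Nonempty
  exists_mem : ∀ v, ∃ ω ∈ Γ.shift, Γ.o (ω 0) = v
  exists_ne : ∀ x ∈ Γ.shift, ∀ n, ∃ y ∈ cyl x n, y ≠ x
  core_succ : ∀ x ∈ Γ.shift, ∀ n, Γ.o (x n) ∈ core → Γ.o (x (n + 1)) ∈ core
  core_of_le : ∀ x ∈ Γ.shift, ∀ n, level ≤ n → Γ.o (x n) ∈ core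
  core_reach : ∀ x ∈ Γ.shift, ∀ n, ∀ w ∈ core, ∃ y ∈ cyl x n, ∃ m, n ≤ m ∧ Γ.o (y m) = w
  off : ∀ g ∈ H, ∀ x, x ∉ E → g x = x
  cont : ∀ g ∈ H, ∀ m, ∃ n, ∀ x ∈ E, ∀ y ∈ E, (∀ i < n, x i = y i) → ∀ i < m, g x i = g y i
  sim : ∀ x ∈ Γ.shift, ∀ y ∈ Γ.shift, ∀ n m, 1 ≤ n → 1 ≤ m → Γ.o (x n) = Γ.o (y m) →
    cyl x n ⊂ E → cyl y m ⊂ E → ∃ g ∈ H, ∀ ω ∈ Γ.shift, Γ.o (ω 0) = Γ.o (x n) →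
      g (glue n x ω) = glue m y ω
  nuc_finite : nuc.Finite
  nuc_act : ∀ g ∈ H, ∀ M, ∃ N, ∀ x ∈ E, ∀ n, N ≤ n → ∃ m, M ≤ m ∧ ∃ p ∈ nuc, p.1 = Γ.o (x n) ∧
    ∀ ω ∈ Γ.shift, Γ.o (ω 0) = Γ.o (x n) → g (glue n x ω) = glue m (g x) (p.2 ω)
  full : ∀ s : Equiv.Perm (ℕ → Γ.E), (∀ x, x ∉ E → s x = x) →
    (∃ n, ∀ x ∈ E, ∃ g ∈ H, ∀ y ∈ cyl x n, s y = g y) → s ∈ H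

end FinDigraph

namespace FinDigraph

variable {Γ : FinDigraph}

theorem isCompact_shift (Γ : FinDigraph) : IsCompact Γ.shift := by
  refine IsClosed.isCompact ?_
  have : Γ.shift = ⋂ i, {x | Γ.t (x i) = Γ.o (x (i + 1))} := by
    ext x; simp [shift]
  rw [this]
  refine isClosed_iInter fun i => ?_
  have h : Continuous fun x : ℕ → Γ.E => (x i, x (i + 1)) := by fun_prop
  exact (isClosed_discrete {p : Γ.E × Γ.E | Γ.t p.1 = Γ.o p.2}).preimage h

theorem isOpen_agree (x : ℕ → Γ.E) (n : ℕ) : IsOpen {y : ℕ → Γ.E | ∀ i < n, y i = x i} := by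
  have : {y : ℕ → Γ.E | ∀ i < n, y i = x i} = ⋂ i ∈ Finset.range n, {y | y i = x i} := by
    ext y; simp
  rw [this]
  refine isOpen_biInter_finset fun i _ => ?_
  have h : Continuous fun y : ℕ → Γ.E => y i := by fun_prop
  exact (isOpen_discrete {x i}).preimage h

theorem exists_agree_of_mem_nhds {x : ℕ → Γ.E} {U : Set (ℕ → Γ.E)} (h : U ∈ nhds x) :
    ∃ n, ∀ y, (∀ i < n, y i = x i) → y ∈ U := by
  rw [nhds_pi, Filter.mem_pi] at h
  obtain ⟨I, hI, t, ht, hU⟩ := h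
  obtain ⟨n, hn⟩ := hI.bddAbove
  refine ⟨n + 1, fun y hy => hU fun i hi => ?_⟩
  rw [hy i (Nat.lt_succ_of_le (hn hi))]
  exact mem_of_mem_nhds (ht i)

theorem exists_uniform {K : Set (ℕ → Γ.E)} (hK : IsCompact K) (Q : (ℕ → Γ.E) → ℕ → Prop)
    (mono : ∀ x n m, n ≤ m → Q x n → Q x m)
    (loc : ∀ x ∈ K, ∃ n, ∀ y ∈ K, (∀ i < n, y i = x i) → Q y n) : ∃ N, ∀ x ∈ K, Q x N := by
  refine IsCompact.induction_on (p := fun s => ∃ N, ∀ x ∈ s, x ∈ K → Q x N) hK ?_ ?_ ?_ ?_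
    |>.imp fun N hN x hx => hN x hx hx
  · exact ⟨0, fun x hx => absurd hx (Set.notMem_empty x)⟩
  · rintro s t hst ⟨N, hN⟩
    exact ⟨N, fun x hx => hN x (hst hx)⟩
  · rintro s t ⟨N, hN⟩ ⟨M, hM⟩
    refine ⟨max N M, ?_⟩
    rintro x (hx | hx) hxK
    · exact mono _ _ _ (le_max_left _ _) (hN x hx hxK)
    · exact mono _ _ _ (le_max_right _ _) (hM x hx hxK)
  · intro x hx
    obtain ⟨n, hn⟩ := loc x hx
    exact ⟨{y | ∀ i < n, y i = x i}, mem_nhdsWithin_of_mem_nhds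
      ((isOpen_agree x n).mem_nhds fun _ _ => rfl), n, fun y hy hyK => hn y hyK hy⟩

theorem exists_sat {E : Set (ℕ → Γ.E)} (hE : E ⊆ Γ.shift) (h : Γ.ClopenIn E) :
    IsCompact E ∧ ∃ n, Sat E n := by
  have hc : IsCompact E := by
    have : E = Subtype.val '' {x : ↥Γ.shift | (x : ℕ → Γ.E) ∈ E} := by
      ext x
      simp only [Set.mem_image, Set.mem_ofPred_eq, Subtype.exists, exists_and_right,
        exists_eq_right]
      exact ⟨fun hx => ⟨hE hx, hx⟩, fun ⟨_, hx⟩ => hx⟩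
    rw [this]
    have := isCompact_iff_compactSpace.1 (isCompact_shift Γ)
    exact h.isClosed.isCompact.image continuous_subtype_val
  refine ⟨hc, ?_⟩
  obtain ⟨N, hN⟩ := exists_uniform hc (fun x n => cyl x n ⊆ E)
    (fun x n m hnm hx => (cyl_mono hnm).trans hx) (fun x hx => by
      obtain ⟨U, hU, hUE⟩ := isOpen_induced_iff.1 h.isOpen
      have hxU : x ∈ U := by
        have : (⟨x, hE hx⟩ : ↥Γ.shift) ∈ Subtype.val ⁻¹' U := by rw [hUE]; exact hx
        exact this
      obtain ⟨n, hn⟩ := exists_agree_of_mem_nhds (hU.mem_nhds hxU)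
      refine ⟨n, fun y _ hyx z hz => ?_⟩
      have : (⟨z, hz.1⟩ : ↥Γ.shift) ∈ Subtype.val ⁻¹' U :=
        hn z fun i hi => (hz.2 i hi).trans (hyx i hi)
      rw [hUE] at this
      exact this)
  exact ⟨N, hE, hN⟩

/-! ### Finite prefixes of infinite paths -/

theorem pathOk_ofFn (n : ℕ) (x : ℕ → Γ.E) (hx : x ∈ Γ.shift) :
    Γ.pathOk (Γ.o (x 0)) (List.ofFn fun i : Fin n => x i) := by
  induction n generalizing x with
  | zero => simp [pathOk]
  | succ n ih =>
    rw [List.ofFn_succ]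
    refine ⟨rfl, ?_⟩
    have := ih (fun i => x (i + 1)) fun i => hx (i + 1)
    simp only [zero_add] at this
    rw [← hx 0] at this
    exact this

theorem pathEndAux_ofFn (n : ℕ) (x : ℕ → Γ.E) (hx : x ∈ Γ.shift) :
    Γ.pathEndAux (Γ.o (x 0)) (List.ofFn fun i : Fin n => x i) = Γ.o (x n) := by
  induction n generalizing x with
  | zero => simp [pathEndAux]
  | succ n ih =>
    rw [List.ofFn_succ]
    have := ih (fun i => x (i + 1)) fun i => hx (i + 1)
    simp only [zero_add] at this
    rw [← hx 0] at this
    exact this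

/-- The finite path consisting of the first `n` edges of an infinite path. -/
def pfx (x : ↥Γ.shift) (n : ℕ) : Γ.FinPath :=
  ⟨Γ.o (x.1 0), List.ofFn fun i : Fin n => x.1 i, pathOk_ofFn n x.1 x.2⟩

theorem pathEnd_pfx (x : ↥Γ.shift) (n : ℕ) : Γ.pathEnd (pfx x n) = Γ.o (x.1 n) :=
  pathEndAux_ofFn n x.1 x.2

theorem length_pfx (x : ↥Γ.shift) (n : ℕ) : (pfx x n).edges.length = n := by simp [pfx]

theorem get_pfx (x : ↥Γ.shift) (n i : ℕ) (h : i < (pfx x n).edges.length) :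
    (pfx x n).edges.get ⟨i, h⟩ = x.1 i := by simp [pfx]

theorem cone_pfx (x : ↥Γ.shift) {n : ℕ} (hn : 1 ≤ n) : Γ.cone (pfx x n) = cyl x.1 n := by
  ext y
  simp only [cone, cyl, Set.mem_ofPred_eq, get_pfx, length_pfx]
  refine and_congr_right fun _ => ⟨fun h => h.2, fun h => ⟨?_, h⟩⟩
  rw [h 0 (by omega)]
  rfl

theorem mem_cone_trivPath {v : Γ.V} {ω : ℕ → Γ.E} :
    ω ∈ Γ.cone (Γ.trivPath v) ↔ ω ∈ Γ.shift ∧ Γ.o (ω 0) = v := by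
  simp [cone, trivPath]

theorem splice_pfx (x y : ↥Γ.shift) (n m : ℕ) (ω : ℕ → Γ.E) :
    Γ.splice (pfx x n) (pfx y m) (glue n x.1 ω) = glue m y.1 ω := by
  funext i
  simp only [splice, get_pfx, length_pfx]
  split_ifs with h
  · rw [glue_of_lt h]
  · rw [add_comm, glue_add, glue_of_le (by omega)]

theorem catPath_pfx (x : ↥Γ.shift) (n : ℕ) (ω : ℕ → Γ.E) :
    Γ.catPath (pfx x n) ω = glue n x.1 ω := by
  funext i
  simp only [catPath, splice, get_pfx, length_pfx]
  split_ifs with h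
  · rw [glue_of_lt h]
  · rw [glue_of_le (by omega)]; rfl

theorem finite_length_le (Γ : FinDigraph) (A : Set Γ.FinPath) (hA : A.Finite) :
    ∃ N, ∀ α ∈ A, α.edges.length ≤ N := by
  obtain ⟨N, hN⟩ := (hA.image fun α => α.edges.length).bddAbove
  exact ⟨N, fun α hα => hN ⟨α, hα, rfl⟩⟩

/-- Elements of a group with finite nucleus act on small cylinders by elements of the nucleus. -/
theorem exists_nucleus {E : Set (ℕ → Γ.E)} {f : (ℕ → Γ.E) → ℕ → Γ.E} {L : ℕ} (hE : Sat E L)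
    (hf : Function.Injective f)
    (hne : ∀ x ∈ Γ.shift, ∀ n, ∃ y ∈ cyl x n, y ≠ x)
    (hcont : ∀ m, ∃ n, ∀ x ∈ E, ∀ y ∈ E, (∀ i < n, x i = y i) → ∀ i < m, f x i = f y i)
    (hrat : Γ.RationalOn f E) (M : ℕ) :
    ∃ N, ∀ x ∈ E, ∀ n, N ≤ n → ∃ m, M ≤ m ∧ ∃ p ∈ Γ.nucleusOf f E, p.1 = Γ.o (x n) ∧
      ∀ ω ∈ Γ.shift, Γ.o (ω 0) = Γ.o (x n) → f (glue n x ω) = glue m (f x) (p.2 ω) := by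
  obtain ⟨N₁, hN₁⟩ := hcont M
  have hbad : (⋃ p ∈ (Γ.localAction f '' {α : Γ.FinPath | Γ.cone α ⊆ E}) \ Γ.nucleusOf f E,
      {α : Γ.FinPath | Γ.cone α ⊆ E ∧ Γ.localAction f α = p}).Finite := by
    refine (hrat.subset Set.sdiff_subset).biUnion fun p hp => ?_
    exact Set.not_infinite.1 hp.2
  obtain ⟨N₂, hN₂⟩ := finite_length_le Γ _ hbad
  refine ⟨max (max N₁ (N₂ + 1)) (max L 1), fun x hx n hn => ?_⟩
  have hn₁ : N₁ ≤ n := le_trans (le_max_left _ _) (le_of_max_le_left hn)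
  have hn₂ : N₂ + 1 ≤ n := le_trans (le_max_right _ _) (le_of_max_le_left hn)
  have hn₃ : L ≤ n := le_trans (le_max_left _ _) (le_of_max_le_right hn)
  have hn₄ : 1 ≤ n := le_trans (le_max_right _ _) (le_of_max_le_right hn)
  set ξ : ↥Γ.shift := ⟨x, hE.sub hx⟩ with hξ
  have hcone : Γ.cone (pfx ξ n) = cyl x n := cone_pfx ξ hn₄
  have hsub : cyl x n ⊆ E := (hE.mono hn₃).cyl x hx
  set T : Set ℕ := {k | ∀ y ∈ Γ.cone (pfx ξ n), ∀ z ∈ Γ.cone (pfx ξ n), ∀ i < k, f y i = f z i}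
    with hT
  have hMT : M ∈ T := by
    intro y hy z hz
    rw [hcone] at hy hz
    exact hN₁ y (hsub hy) z (hsub hz) fun i hi =>
      (hy.2 i (by omega)).trans (hz.2 i (by omega)).symm
  have hbdd : BddAbove T := by
    obtain ⟨y, hy, hyx⟩ := hne x (hE.sub hx) n
    obtain ⟨i, hi⟩ := Function.ne_iff.1 (hf.ne hyx)
    refine ⟨i, fun k hk => ?_⟩
    by_contra hlt
    exact hi (hk y (by rwa [hcone]) x (by rw [hcone]; exact mem_cyl_self (hE.sub hx) n) i
      (by omega))
  have hB : Γ.barLen f (pfx ξ n) ∈ T := Nat.sSup_mem ⟨M, hMT⟩ hbdd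
  refine ⟨Γ.barLen f (pfx ξ n), le_csSup hbdd hMT, Γ.localAction f (pfx ξ n), ?_,
    pathEnd_pfx ξ n, ?_⟩
  · by_contra hp
    have := hN₂ (pfx ξ n) (by
      simp only [Set.mem_iUnion]
      exact ⟨_, ⟨⟨pfx ξ n, by rw [Set.mem_ofPred_eq, hcone]; exact hsub, rfl⟩, hp⟩,
        by rw [hcone]; exact hsub, rfl⟩)
    rw [length_pfx] at this
    omega
  · intro ω hω hωo
    funext i
    by_cases hi : i < Γ.barLen f (pfx ξ n)
    · rw [glue_of_lt hi]
      refine hB _ ?_ _ ?_ i hi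
      · rw [hcone]; exact glue_mem_cyl (hE.sub hx) hω hωo
      · rw [hcone]; exact mem_cyl_self (hE.sub hx) n
    · rw [glue_of_le (by omega)]
      simp only [localAction]
      rw [if_pos (mem_cone_trivPath.2 ⟨hω, by rw [pathEnd_pfx]; exact hωo⟩), catPath_pfx]
      congr 1
      omega

/-! ### Reachability -/

/-- There is an edge from `u` to `v`. -/
def Step (Γ : FinDigraph) (u v : Γ.V) : Prop := ∃ e, Γ.o e = u ∧ Γ.t e = v

theorem reach_pathEndAux (v : Γ.V) (l : List Γ.E) (h : Γ.pathOk v l) :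
    Relation.ReflTransGen Γ.Step v (Γ.pathEndAux v l) := by
  induction l generalizing v with
  | nil => exact Relation.ReflTransGen.refl
  | cons e l ih => exact Relation.ReflTransGen.head ⟨e, h.1, rfl⟩ (ih _ h.2)

theorem reach_pathEnd (α : Γ.FinPath) :
    Relation.ReflTransGen Γ.Step α.start (Γ.pathEnd α) := reach_pathEndAux _ _ α.ok

theorem exists_of_reach (hne : ∀ v, ∃ ω ∈ Γ.shift, Γ.o (ω 0) = v) {u w : Γ.V}
    (h : Relation.ReflTransGen Γ.Step u w) :
    ∃ y ∈ Γ.shift, Γ.o (y 0) = u ∧ ∃ k, Γ.o (y k) = w := by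
  induction h using Relation.ReflTransGen.head_induction_on with
  | refl =>
    obtain ⟨ω, hω, h⟩ := hne w
    exact ⟨ω, hω, h, 0, h⟩
  | head h _ ih =>
    obtain ⟨e, he, he'⟩ := h
    obtain ⟨y, hy, hy₀, k, hk⟩ := ih
    refine ⟨fun i => Nat.casesOn i e y, ?_, he, k + 1, hk⟩
    intro i
    cases i with
    | zero => exact he'.trans hy₀.symm
    | succ i => exact hy i

/-! ### The setting of a full contracting rational similarity group -/

theorem permExt_eq {E : Set (ℕ → Γ.E)} (g : Equiv.Perm ↥E) :
    Γ.permExt E g = ⇑(Equiv.Perm.ofSubtype g) := by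
  funext x
  by_cases h : x ∈ E
  · rw [Equiv.Perm.ofSubtype_apply_of_mem g h, permExt, homExt, dif_pos h]
  · rw [Equiv.Perm.ofSubtype_apply_of_not_mem g h, permExt, homExt, dif_neg h]

theorem exists_setting (hiso : Γ.NoIsolatedPoints) (hcones : Γ.NoEmptyCones)
    (E : Set (ℕ → Γ.E)) (hEsub : E ⊆ Γ.shift) (hEne : E.Nonempty)
    (hEclopen : Γ.ClopenIn E)
    (G : Subgroup (Equiv.Perm ↥E)) (hRSG : Γ.IsRSG E G)
    (hContr : Γ.IsContracting E G) (hFull : Γ.IsFullOn E G) :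
    ∃ S : Setting Γ, S.E = E ∧ S.H = G.map Equiv.Perm.ofSubtype := by
  obtain ⟨hEc, L₀, hL₀⟩ := exists_sat hEsub hEclopen
  obtain ⟨⟨W, hW, hWr, N, hN⟩, hfin⟩ := hContr
  have hne : ∀ v, ∃ ω ∈ Γ.shift, Γ.o (ω 0) = v := fun v => by
    obtain ⟨ω, hω⟩ := hcones (Γ.trivPath v)
    exact ⟨ω, mem_cone_trivPath.1 hω⟩
  have hne₂ : ∀ x ∈ Γ.shift, ∀ n, ∃ y ∈ cyl x n, y ≠ x := by
    intro x hx n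
    by_contra! h
    refine hiso ⟨x, hx⟩ ?_
    have : ({⟨x, hx⟩} : Set ↥Γ.shift) = Subtype.val ⁻¹' {y : ℕ → Γ.E | ∀ i < n, y i = x i} := by
      ext y
      simp only [Set.mem_singleton_iff, Set.mem_preimage, Set.mem_ofPred_eq]
      constructor
      · rintro rfl; exact fun _ _ => rfl
      · exact fun hy => Subtype.ext (h y.1 ⟨y.2, hy⟩)
    rw [this]
    exact (isOpen_agree x n).preimage continuous_subtype_val
  set L := max (max L₀ 1) N with hLdef
  have hL : Sat E L := hL₀.mono ((le_max_left _ _).trans (le_max_left _ _))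
  have hcont : ∀ g ∈ G, ∀ m, ∃ n, ∀ x ∈ E, ∀ y ∈ E, (∀ i < n, x i = y i) → ∀ i < m,
      Equiv.Perm.ofSubtype g x i = Equiv.Perm.ofSubtype g y i := by
    intro g hg m
    refine exists_uniform hEc (fun x n => ∀ y ∈ E, (∀ i < n, x i = y i) → ∀ i < m,
      Equiv.Perm.ofSubtype g x i = Equiv.Perm.ofSubtype g y i)
      (fun x n k hnk h y hy hxy => h y hy fun i hi => hxy i (hi.trans_le hnk)) ?_
    intro x hx
    have hU : {z : ↥E | ∀ i < m, (g z).1 i = (g ⟨x, hx⟩).1 i} ∈ nhds (⟨x, hx⟩ : ↥E) := by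
      refine IsOpen.mem_nhds ?_ fun _ _ => rfl
      exact (isOpen_agree (g ⟨x, hx⟩).1 m).preimage
        (continuous_subtype_val.comp (hRSG.1 g hg).1)
    rw [nhds_subtype_eq_comap] at hU
    obtain ⟨U, hU, hUs⟩ := hU
    obtain ⟨n, hn⟩ := exists_agree_of_mem_nhds hU
    refine ⟨n, fun y hy hyx z hz hyz i hi => ?_⟩
    rw [Equiv.Perm.ofSubtype_apply_of_mem g hy, Equiv.Perm.ofSubtype_apply_of_mem g hz]
    have h₁ : (⟨y, hy⟩ : ↥E) ∈ {z : ↥E | ∀ i < m, (g z).1 i = (g ⟨x, hx⟩).1 i} :=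
      hUs (hn y hyx)
    have h₂ : (⟨z, hz⟩ : ↥E) ∈ {z : ↥E | ∀ i < m, (g z).1 i = (g ⟨x, hx⟩).1 i} :=
      hUs (hn z fun i hi => (hyz i hi).symm.trans (hyx i hi))
    exact (h₁ i hi).trans (h₂ i hi).symm
  refine ⟨{
    E := E
    H := G.map Equiv.Perm.ofSubtype
    nuc := Γ.groupNucleus E G
    core := {v | ∀ u, Relation.ReflTransGen Γ.Step u v}
    level := L
    level_pos := (le_max_right _ _).trans (le_max_left _ _)
    sat := hL
    ne := hEne
    exists_mem := hne
    exists_ne := hne₂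
    core_succ := fun x hx n h u => (h u).tail ⟨x n, rfl, hx n⟩
    core_of_le := ?_
    core_reach := ?_
    off := ?_
    cont := ?_
    sim := ?_
    nuc_finite := hfin
    nuc_act := ?_
    full := ?_ }, rfl, rfl⟩
  · intro x hx n hn u
    have hNn : N ≤ n := (le_max_right _ _).trans hn
    have h₁ := hN (pfx ⟨_, tail_mem_shift hx (n - N)⟩ N) (length_pfx _ _)
    rw [pathEnd_pfx] at h₁
    simp only [Nat.sub_add_cancel hNn] at h₁
    obtain ⟨α, rfl, hα⟩ := hWr u
    obtain ⟨β, hβ, hβ', -⟩ := hW.1 _ hα _ h₁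
    have := reach_pathEnd β
    rw [hβ, hβ'] at this
    exact (reach_pathEnd α).trans this
  · intro x hx n w hw
    obtain ⟨y, hy, hy₀, k, hk⟩ := exists_of_reach hne (hw (Γ.o (x n)))
    exact ⟨glue n x y, glue_mem_cyl hx hy hy₀, n + k, by omega, by rw [glue_add]; exact hk⟩
  · rintro _ ⟨g, hg, rfl⟩ x hx
    exact Equiv.Perm.ofSubtype_apply_of_not_mem g hx
  · rintro _ ⟨g, hg, rfl⟩
    exact hcont g hg
  · intro x hx y hy n m hn hm hxy hxE hyE
    obtain ⟨g, hg, h⟩ := hRSG.2 (pfx ⟨x, hx⟩ n) (pfx ⟨y, hy⟩ m)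
      (by rw [pathEnd_pfx, pathEnd_pfx]; exact hxy) (by rw [cone_pfx _ hn]; exact hxE)
      (by rw [cone_pfx _ hm]; exact hyE)
    refine ⟨_, ⟨g, hg, rfl⟩, fun ω hω hωo => ?_⟩
    have hmem := glue_mem_cyl hx hω hωo
    have := h _ (hxE.1 hmem) (by rw [cone_pfx _ hn]; exact hmem)
    rw [splice_pfx] at this
    rw [← this]
    exact Equiv.Perm.ofSubtype_apply_of_mem g (hxE.1 hmem)
  · rintro _ ⟨g, hg, rfl⟩ M
    have hr := (hRSG.1 g hg).2.2
    rw [permExt_eq] at hr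
    obtain ⟨N', hN'⟩ := exists_nucleus hL (Equiv.injective _) hne₂ (hcont g hg) hr M
    refine ⟨N', fun x hx n hn => ?_⟩
    obtain ⟨m, hm, p, hp, h⟩ := hN' x hx n hn
    refine ⟨m, hm, p, ?_, h⟩
    rw [← permExt_eq] at hp
    exact Set.mem_biUnion hg hp
  · rintro s hs ⟨n, hn⟩
    have hsE : ∀ x, x ∈ E ↔ s x ∈ E := by
      intro x
      refine ⟨fun hx => ?_, fun hx => ?_⟩
      · by_contra h
        have := s.injective (hs _ h)
        rw [this] at h
        exact h hx
      · by_contra h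
        rw [hs x h] at hx
        exact h hx
    set h : Equiv.Perm ↥E := s.subtypePerm (fun x => (hsE x).symm) with hh
    have hloc : Γ.LocallyAgrees E G h := by
      intro x
      obtain ⟨_, ⟨g, hg, rfl⟩, hgx⟩ := hn x.1 x.2
      refine ⟨Subtype.val ⁻¹' {y : ℕ → Γ.E | ∀ i < n, y i = x.1 i},
        (isOpen_agree x.1 n).preimage continuous_subtype_val, fun _ _ => rfl, g, hg, ?_⟩
      intro u hu
      refine Subtype.ext ?_
      have := hgx u.1 ⟨hEsub u.2, hu⟩
      rw [Equiv.Perm.ofSubtype_apply_of_mem g u.2] at this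
      exact this
    have hc : Continuous ⇑h := by
      rw [continuous_iff_continuousAt]
      intro x
      obtain ⟨U, hU, hxU, g, hg, hgU⟩ := hloc x
      exact ((hRSG.1 g hg).1.continuousAt).congr
        (Filter.eventuallyEq_of_mem (hU.mem_nhds hxU) fun u hu => (hgU u hu).symm)
    have := isCompact_iff_compactSpace.1 hEc
    have hc' : Continuous ⇑h.symm := Continuous.continuous_symm_of_equiv_compact_to_t2 hc
    refine ⟨h, hFull h hc hc' hloc, ?_⟩
    ext1 x
    by_cases hx : x ∈ E
    · exact Equiv.Perm.ofSubtype_apply_of_mem h hx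
    · rw [hs x hx]
      exact Equiv.Perm.ofSubtype_apply_of_not_mem h hx

theorem IsRationalPt.eventually_periodic {x : ℕ → Γ.E} (h : Γ.IsRationalPt x) :
    ∃ n T, 1 ≤ T ∧ ∀ i, n ≤ i → x (i + T) = x i := by
  obtain ⟨σ, τ, hτ, -, h⟩ := h
  have hl : 0 < τ.edges.length := List.length_pos_iff.2 hτ
  refine ⟨σ.edges.length, τ.edges.length, hl, fun i hi => ?_⟩
  rw [h i hi (Nat.mod_lt _ hl), h (i + τ.edges.length) (by omega) (Nat.mod_lt _ hl)]
  congr 2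
  rw [Nat.sub_add_comm hi, Nat.add_mod_right]

end FinDigraph

namespace FinDigraph
namespace Setting

open ChartGroup

variable {Γ : FinDigraph} (S : Setting Γ)

/-- The set of infinite paths starting at a node. -/
def nodeCone (v : Γ.V) : Set (ℕ → Γ.E) := {ω | ω ∈ Γ.shift ∧ Γ.o (ω 0) = v}

/-- The model space of all infinite paths starting at a given node of the core. -/
abbrev Mod (w : {v // v ∈ S.core}) : Type := {ω : ℕ → Γ.E // ω ∈ nodeCone w.1}

/-- The chart given by a map on sequences. -/
def nodeChart {X : Type} {v : Γ.V} (hv : v ∈ S.core) (f : (ℕ → Γ.E) → X) : Chart S.Mod X :=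
  ⟨⟨v, hv⟩, fun ω => f ω.1⟩

/-- The canonical chart of a cylinder. -/
def coneChart (x : ℕ → Γ.E) (n : ℕ) (h : Γ.o (x n) ∈ S.core) : Chart S.Mod (ℕ → Γ.E) :=
  S.nodeChart h (glue n x)

variable {S}

theorem push_nodeChart {X Y : Type} {v : Γ.V} (hv : v ∈ S.core) (f : (ℕ → Γ.E) → X) (g : X → Y) :
    push g (S.nodeChart hv f) = S.nodeChart hv (g ∘ f) := rfl

theorem nodeChart_congr {X : Type} {v v' : Γ.V} {hv : v ∈ S.core} {hv' : v' ∈ S.core}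
    {f f' : (ℕ → Γ.E) → X} (h : v = v') (hf : ∀ ω ∈ nodeCone v, f ω = f' ω) :
    S.nodeChart hv f = S.nodeChart hv' f' := by
  subst h
  simp only [nodeChart]
  congr 1
  funext ω
  exact hf ω.1 ω.2

theorem coneChart_congr {x y : ℕ → Γ.E} {n : ℕ} (hn : 1 ≤ n) (hx : x ∈ Γ.shift)
    (hy : y ∈ cyl x n) (h : Γ.o (x n) ∈ S.core) (h' : Γ.o (y n) ∈ S.core) :
    S.coneChart y n h' = S.coneChart x n h :=
  nodeChart_congr (origin_eq hn hx hy) fun ω _ => glue_congr hy.2 ω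

theorem img_coneChart {x : ℕ → Γ.E} {n : ℕ} (hn : 1 ≤ n) (hx : x ∈ Γ.shift)
    (h : Γ.o (x n) ∈ S.core) : img (S.coneChart x n h) = cyl x n := by
  ext y
  constructor
  · rintro ⟨ω, rfl⟩
    exact glue_mem_cyl hx ω.2.1 ω.2.2
  · intro hy
    obtain ⟨ω, hω, hωo, rfl⟩ := exists_glue hn hx hy
    exact ⟨⟨ω, hω, hωo⟩, rfl⟩

theorem coneChart_injective (x : ℕ → Γ.E) (n : ℕ) (h : Γ.o (x n) ∈ S.core) :
    Function.Injective (S.coneChart x n h).2 := fun _ _ hω =>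
  Subtype.ext (glue_injective n x hω)

theorem push_glue_coneChart (y z : ℕ → Γ.E) (d m : ℕ) (h : Γ.o (y d) ∈ S.core)
    (h' : Γ.o (glue m z y (m + d)) ∈ S.core) :
    push (glue m z) (S.coneChart y d h) = S.coneChart (glue m z y) (m + d) h' := by
  rw [coneChart, push_nodeChart]
  exact nodeChart_congr (congrArg Γ.o (glue_add _ _ _ _).symm) fun τ _ => glue_glue _ _ _ _ _

theorem push_left_injective {X Y : Type} {f : X → Y} (hf : Function.Injective f) :
    Function.Injective (push f : Chart S.Mod X → Chart S.Mod Y) := by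
  rintro ⟨w, a⟩ ⟨w', b⟩ h
  obtain rfl : w = w' := congrArg Sigma.fst h
  simp only [ChartGroup.push_mk, Sigma.mk.injEq, heq_eq_eq, true_and] at h ⊢
  exact hf.comp_left h

/-- The charts of all cylinders of level `n`. -/
def coneCharts (S : Setting Γ) (n : ℕ) : Set (Chart S.Mod (ℕ → Γ.E)) :=
  {φ | ∃ x ∈ Γ.shift, ∃ h, φ = S.coneChart x n h}

theorem finite_coneCharts {n : ℕ} (hn : 1 ≤ n) : (S.coneCharts n).Finite := by
  have key : ∀ φ : ↥(S.coneCharts n), ∃ x ∈ Γ.shift, ∃ h, φ.1 = S.coneChart x n h :=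
    fun φ => φ.2
  choose x hx h hφ using key
  have : Function.Injective fun (φ : ↥(S.coneCharts n)) (i : Fin n) => x φ i := by
    intro φ ψ hφψ
    refine Subtype.ext ?_
    rw [hφ, hφ]
    exact coneChart_congr hn (hx ψ) ⟨hx φ, fun i hi => congrFun hφψ ⟨i, hi⟩⟩ _ _
  have := Finite.of_injective _ this
  exact Set.toFinite _

theorem map_mem_iff {g : Equiv.Perm (ℕ → Γ.E)} (hg : g ∈ S.H) {x : ℕ → Γ.E} :
    g x ∈ S.E ↔ x ∈ S.E := by
  refine ⟨fun hx => ?_, fun hx => ?_⟩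
  · by_contra h
    rw [S.off g hg x h] at hx
    exact h hx
  · by_contra h
    have := g.injective (S.off g hg _ h)
    rw [this] at h
    exact h hx

theorem inv_apply_self (g : Equiv.Perm (ℕ → Γ.E)) (x : ℕ → Γ.E) : g⁻¹ (g x) = x :=
  g.symm_apply_apply x

theorem apply_inv_self (g : Equiv.Perm (ℕ → Γ.E)) (x : ℕ → Γ.E) : g (g⁻¹ x) = x :=
  g.apply_symm_apply x

theorem exists_sat_image {g : Equiv.Perm (ℕ → Γ.E)} (hg : g ∈ S.H) {A : Set (ℕ → Γ.E)} {n : ℕ}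
    (hA : Sat A n) (hAE : A ⊆ S.E) : ∃ m, Sat (g '' A) m := by
  obtain ⟨m, hm⟩ := S.cont g⁻¹ (S.H.inv_mem hg) n
  have hsub : g '' A ⊆ S.E := by
    rintro _ ⟨a, ha, rfl⟩
    exact (map_mem_iff hg).2 (hAE ha)
  refine ⟨max m S.level, hsub.trans S.sat.sub, ?_⟩
  rintro _ ⟨a, ha, rfl⟩ z hz
  have hzE : z ∈ S.E := (S.sat.mono (le_max_right _ _)).cyl _ (hsub ⟨a, ha, rfl⟩) hz
  refine ⟨g⁻¹ z, hA.cyl a ha ⟨S.sat.sub ((map_mem_iff (S.H.inv_mem hg)).2 hzE), ?_⟩,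
    apply_inv_self g z⟩
  intro i hi
  have := hm z hzE (g a) (hsub ⟨a, ha, rfl⟩)
    (fun i hi => hz.2 i (hi.trans_le (le_max_left _ _))) i hi
  rwa [inv_apply_self] at this

/-- `φ` is the image under the group of a canonical chart of a cylinder. -/
def IsGroupChart (S : Setting Γ) (φ : Chart S.Mod (ℕ → Γ.E)) : Prop :=
  ∃ g ∈ S.H, ∃ x ∈ Γ.shift, ∃ n, 1 ≤ n ∧ cyl x n ⊆ S.E ∧ ∃ h, φ = push g (S.coneChart x n h)

theorem isGroupChart_coneChart {x : ℕ → Γ.E} {n : ℕ} (hn : 1 ≤ n) (hx : x ∈ Γ.shift)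
    (hE : cyl x n ⊆ S.E) (h : Γ.o (x n) ∈ S.core) : S.IsGroupChart (S.coneChart x n h) :=
  ⟨1, S.H.one_mem, x, hx, n, hn, hE, h, (push_one _).symm⟩

namespace IsGroupChart

variable {φ ψ : Chart S.Mod (ℕ → Γ.E)}

theorem inj (h : S.IsGroupChart φ) : Function.Injective φ.2 := by
  obtain ⟨g, _, x, _, n, _, _, h, rfl⟩ := h
  exact System.push_injective g.injective (coneChart_injective x n h)

theorem sat (h : S.IsGroupChart φ) : ∃ n, Sat (img φ) n := by
  obtain ⟨g, hg, x, hx, n, hn, hE, h, rfl⟩ := h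
  rw [img_push, img_coneChart hn hx]
  exact exists_sat_image hg (sat_cyl x n) hE

theorem subset (h : S.IsGroupChart φ) : img φ ⊆ S.E := by
  obtain ⟨g, hg, x, hx, n, hn, hE, h, rfl⟩ := h
  rw [img_push, img_coneChart hn hx]
  rintro _ ⟨a, ha, rfl⟩
  exact (map_mem_iff hg).2 (hE ha)

end IsGroupChart

theorem nonempty_img (φ : Chart S.Mod (ℕ → Γ.E)) : (img φ).Nonempty := by
  obtain ⟨ω, hω⟩ := S.exists_mem φ.1.1
  exact ⟨_, ⟨ω, hω⟩, rfl⟩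

theorem exists_map_coneChart {x y : ℕ → Γ.E} {n m : ℕ} (hn : 1 ≤ n) (hm : 1 ≤ m)
    (hx : x ∈ Γ.shift) (hy : y ∈ Γ.shift) (hxE : cyl x n ⊂ S.E) (hyE : cyl y m ⊂ S.E)
    {h : Γ.o (x n) ∈ S.core} {h' : Γ.o (y m) ∈ S.core} (ho : Γ.o (x n) = Γ.o (y m)) :
    ∃ g ∈ S.H, push g (S.coneChart x n h) = S.coneChart y m h' := by
  obtain ⟨g, hg, hgs⟩ := S.sim x hx y hy n m hn hm ho hxE hyE
  exact ⟨g, hg, nodeChart_congr ho fun ω hω => hgs ω hω.1 hω.2⟩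

/-- Exchanges of group charts belong to the group. -/
theorem IsGroupChart.swap_mem {φ ψ : Chart S.Mod (ℕ → Γ.E)} (hφ : S.IsGroupChart φ)
    (hψ : S.IsGroupChart ψ) (hw : φ.1 = ψ.1) (hd : Disjoint (img φ) (img ψ))
    {s : Equiv.Perm (ℕ → Γ.E)} (hs : IsSwap s φ ψ) : s ∈ S.H := by
  obtain ⟨a, ha⟩ := hφ.sat
  obtain ⟨b, hb⟩ := hψ.sat
  have hφE := hφ.subset
  have hψE := hψ.subset
  have hmap : ∃ k ∈ S.H, push k φ = ψ := by
    obtain ⟨g, hg, x, hx, n, hn, hE, h, rfl⟩ := hφ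
    obtain ⟨g', hg', x', hx', n', hn', hE', h', rfl⟩ := hψ
    rw [img_push, img_coneChart hn hx, img_push, img_coneChart hn' hx'] at hd
    have hp : cyl x n ⊂ S.E := by
      refine hE.ssubset_of_not_subset fun hs => ?_
      have hz : g' x' ∈ S.E := (map_mem_iff hg').2 (hE' (mem_cyl_self hx' n'))
      refine Set.disjoint_left.1 hd ?_ ⟨x', mem_cyl_self hx' n', rfl⟩
      exact ⟨g⁻¹ (g' x'), hs ((map_mem_iff (S.H.inv_mem hg)).2 hz), apply_inv_self _ _⟩
    have hp' : cyl x' n' ⊂ S.E := by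
      refine hE'.ssubset_of_not_subset fun hs => ?_
      have hz : g x ∈ S.E := (map_mem_iff hg).2 (hE (mem_cyl_self hx n))
      refine Set.disjoint_left.1 hd ⟨x, mem_cyl_self hx n, rfl⟩ ?_
      exact ⟨g'⁻¹ (g x), hs ((map_mem_iff (S.H.inv_mem hg')).2 hz), apply_inv_self _ _⟩
    obtain ⟨k, hk, hkp⟩ := exists_map_coneChart (h := h) (h' := h') hn hn' hx hx' hp hp'
      (congrArg Subtype.val hw)
    refine ⟨g' * k * g⁻¹, S.H.mul_mem (S.H.mul_mem hg' hk) (S.H.inv_mem hg), ?_⟩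
    rw [push_mul, push_inv_push, push_mul, hkp]
  obtain ⟨k, hk, hkφ⟩ := hmap
  have h₁ : ∀ y ∈ img φ, s y = k y := by
    intro y hy
    have := (push_mul k⁻¹ s φ).trans (by rw [hs.left, ← hkφ, push_inv_push])
    have := eq_of_push_eq_self this hy
    rw [Equiv.Perm.mul_apply, Equiv.Perm.inv_eq_iff_eq] at this
    exact this
  have h₂ : ∀ y ∈ img ψ, s y = k⁻¹ y := by
    intro y hy
    have := (push_mul k s ψ).trans (by rw [hs.right, hkφ])
    have := eq_of_push_eq_self this hy
    rw [Equiv.Perm.mul_apply] at this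
    rw [← inv_apply_self k (s y), this]
  refine S.full s (fun x hx => hs.off x (fun h => hx (hφE h)) fun h => hx (hψE h))
    ⟨max a b, fun x hx => ?_⟩
  have ha' := ha.mono (le_max_left a b)
  have hb' := hb.mono (le_max_right a b)
  have hxs := S.sat.sub hx
  by_cases hxφ : x ∈ img φ
  · exact ⟨k, hk, fun y hy => h₁ y (ha'.cyl x hxφ hy)⟩
  by_cases hxψ : x ∈ img ψ
  · exact ⟨k⁻¹, S.H.inv_mem hk, fun y hy => h₂ y (hb'.cyl x hxψ hy)⟩
  · exact ⟨1, S.H.one_mem, fun y hy => hs.off y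
      (fun h => hxφ ((ha'.mem_iff hxs hy).1 h)) fun h => hxψ ((hb'.mem_iff hxs hy).1 h)⟩

/-- The map `p` embeds the infinite paths starting at `v` onto a union of cylinders of
level `d`. -/
structure MoveOK (S : Setting Γ) (v : Γ.V) (p : (ℕ → Γ.E) → ℕ → Γ.E) (d : ℕ) : Prop where
  mem : v ∈ S.core
  pos : 1 ≤ d
  inj : ∀ ω ∈ nodeCone v, ∀ ω' ∈ nodeCone v, p ω = p ω' → ω = ω'
  shift : ∀ ω ∈ nodeCone v, p ω ∈ Γ.shift
  sat : ∀ ω ∈ nodeCone v, ∀ z ∈ cyl (p ω) d, ∃ ω' ∈ nodeCone v, p ω' = z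
  core : ∀ ω ∈ nodeCone v, Γ.o (p ω d) ∈ S.core

namespace MoveOK

variable {v : Γ.V} {p : (ℕ → Γ.E) → ℕ → Γ.E} {d : ℕ}

/-- The preimages under `p` of the charts of cylinders. -/
def charts (h : S.MoveOK v p d) : Set (Chart S.Mod (S.Mod ⟨v, h.mem⟩)) :=
  {χ | ∃ ω, ∃ hω : ω ∈ nodeCone v,
    push (fun ω : S.Mod ⟨v, h.mem⟩ => p ω.1) χ = S.coneChart (p ω) d (h.core ω hω)}

theorem injective (h : S.MoveOK v p d) :
    Function.Injective (fun ω : S.Mod ⟨v, h.mem⟩ => p ω.1) := fun ω ω' e =>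
  Subtype.ext (h.inj ω.1 ω.2 ω'.1 ω'.2 e)

theorem finite_charts (h : S.MoveOK v p d) : h.charts.Finite := by
  refine ((finite_coneCharts (S := S) h.pos).preimage
    (push_left_injective h.injective).injOn).subset ?_
  rintro χ ⟨ω, hω, e⟩
  exact ⟨p ω, h.shift ω hω, _, e⟩

theorem exists_chart (h : S.MoveOK v p d) {ω : ℕ → Γ.E} (hω : ω ∈ nodeCone v) :
    ∃ χ ∈ h.charts,
      push (fun ω : S.Mod ⟨v, h.mem⟩ => p ω.1) χ = S.coneChart (p ω) d (h.core ω hω) := by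
  have key : ∀ τ : S.Mod ⟨_, h.core ω hω⟩, ∃ ω' ∈ nodeCone v, p ω' = glue d (p ω) τ.1 :=
    fun τ => h.sat ω hω _ (glue_mem_cyl (h.shift _ hω) τ.2.1 τ.2.2)
  choose f hf hpf using key
  have e : push (fun ω : S.Mod ⟨v, h.mem⟩ => p ω.1)
      (⟨⟨_, h.core ω hω⟩, fun τ => ⟨f τ, hf τ⟩⟩ : Chart S.Mod (S.Mod ⟨v, h.mem⟩))
      = S.coneChart (p ω) d (h.core ω hω) := by
    simp only [ChartGroup.push_mk, coneChart, nodeChart]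
    congr 1
    funext τ
    exact hpf τ
  exact ⟨_, ⟨ω, hω, e⟩, e⟩

/-- The subdivision of a node cone into the preimages of cylinders under `p`. -/
def move (h : S.MoveOK v p d) : Move S.Mod where
  src := ⟨v, h.mem⟩
  ch := h.finite_charts.toFinset.toList
  inj := by
    intro ψ hψ
    rw [Finset.mem_toList, Set.Finite.mem_toFinset] at hψ
    obtain ⟨ω, hω, e⟩ := hψ
    have h₁ : Function.Injective ((fun ω : S.Mod ⟨v, h.mem⟩ => p ω.1) ∘ ψ.2) := by
      have := coneChart_injective (S := S) (p ω) d (h.core ω hω)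
      rwa [← e] at this
    exact h₁.of_comp
  cov := by
    intro c
    have hc := c.2
    obtain ⟨χ, hχ, hχe⟩ := h.exists_chart hc
    have hmem : ∀ χ' ∈ h.charts, c ∈ img χ' → χ' = χ := by
      rintro χ' ⟨ω, hω, e⟩ hcχ
      have h₁ : p c.1 ∈ img (push (fun ω : S.Mod ⟨v, h.mem⟩ => p ω.1) χ') := by
        rw [img_push]; exact ⟨c, hcχ, rfl⟩
      rw [e, img_coneChart h.pos (h.shift ω hω)] at h₁
      refine push_left_injective h.injective ?_
      rw [e, hχe, coneChart_congr h.pos (h.shift ω hω) h₁]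
    have hcχ : c ∈ img χ := by
      have h₁ : p c.1 ∈ img (push (fun ω : S.Mod ⟨v, h.mem⟩ => p ω.1) χ) := by
        rw [hχe, img_coneChart h.pos (h.shift _ hc)]
        exact mem_cyl_self (h.shift _ hc) d
      rw [img_push] at h₁
      obtain ⟨c', hc', e⟩ := h₁
      rwa [← h.injective e]
    rw [cover, Finset.coe_toList, Multiset.countP_eq_card_filter, ← Finset.filter_val]
    refine Finset.card_eq_one.2 ⟨χ, ?_⟩
    ext χ'
    simp only [Finset.mem_filter, Set.Finite.mem_toFinset, Finset.mem_singleton]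
    exact ⟨fun h' => hmem χ' h'.1 h'.2, fun h' => h' ▸ ⟨hχ, hcχ⟩⟩

theorem mem_charts (h : S.MoveOK v p d) {χ : Chart S.Mod (S.Mod ⟨v, h.mem⟩)} :
    χ ∈ h.move.ch ↔ χ ∈ h.charts :=
  Finset.mem_toList.trans h.finite_charts.mem_toFinset

theorem exists_of_mem_app (h : S.MoveOK v p d) {f : S.Mod ⟨v, h.mem⟩ → ℕ → Γ.E}
    {z : ℕ → Γ.E} {m : ℕ} (hf : ∀ ω, f ω = glue m z (p ω.1)) {φ : Chart S.Mod (ℕ → Γ.E)}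
    (hφ : φ ∈ h.move.app f) : ∃ ω ∈ nodeCone v, ∃ h',
      φ = S.coneChart (glue m z (p ω)) (m + d) h' := by
  obtain ⟨χ, hχ, rfl⟩ := List.mem_map.1 hφ
  have hχ' : χ ∈ h.charts := h.mem_charts.1 hχ
  obtain ⟨ω, hω, e⟩ := hχ'
  have ho : glue m z (p ω) (m + d) = p ω d := glue_add _ _ _ _
  refine ⟨ω, hω, by rw [ho]; exact h.core ω hω, ?_⟩
  have hf' : f = glue m z ∘ fun ω : S.Mod ⟨v, h.mem⟩ => p ω.1 := funext hf
  have : push f χ = push (glue m z) (S.coneChart (p ω) d (h.core ω hω)) := by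
    rw [← e, hf']; rfl
  exact this.trans (push_glue_coneChart (p ω) z d m _ _)

end MoveOK

/-- A map that occurs as the local action of a group element on a small cylinder, together with
a level of its image. -/
structure MoveData (S : Setting Γ) (v : Γ.V) (p : (ℕ → Γ.E) → ℕ → Γ.E) (d : ℕ) : Prop
    extends S.MoveOK v p d where
  act : ∃ g ∈ S.H, ∃ x ∈ Γ.shift, ∃ n m, 1 ≤ n ∧ cyl x n ⊂ S.E ∧ Γ.o (x n) = v ∧
    ∀ ω ∈ nodeCone v, g (glue n x ω) = glue m (g x) (p ω)

theorem exists_moveData {g : Equiv.Perm (ℕ → Γ.E)} (hg : g ∈ S.H) {x : ℕ → Γ.E} {n m : ℕ}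
    (hn : 1 ≤ n) (hx : x ∈ Γ.shift) (hE : cyl x n ⊂ S.E) (hc : Γ.o (x n) ∈ S.core)
    {p : (ℕ → Γ.E) → ℕ → Γ.E}
    (hp : ∀ ω ∈ nodeCone (Γ.o (x n)), g (glue n x ω) = glue m (g x) (p ω)) :
    ∃ d, S.MoveData (Γ.o (x n)) p d := by
  obtain ⟨D, hD⟩ := S.cont g⁻¹ (S.H.inv_mem hg) n
  have hmem : ∀ ω ∈ nodeCone (Γ.o (x n)), glue m (g x) (p ω) ∈ S.E := fun ω hω => by
    rw [← hp ω hω]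
    exact (map_mem_iff hg).2 (hE.1 (glue_mem_cyl hx hω.1 hω.2))
  have hshift : ∀ ω ∈ nodeCone (Γ.o (x n)), p ω ∈ Γ.shift := fun ω hω => by
    have := tail_mem_shift (S.sat.sub (hmem ω hω)) m
    simpa using this
  refine ⟨max (max D S.level) 1, ⟨⟨hc, le_max_right _ _, ?_, hshift, ?_, ?_⟩,
    g, hg, x, hx, n, m, hn, hE, rfl, hp⟩⟩
  · intro ω hω ω' hω' e
    have := hp ω hω
    rw [e, ← hp ω' hω'] at this
    exact glue_injective n x (g.injective this)
  · intro ω hω z hz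
    set d := max (max D S.level) 1 with hd
    have hd₁ : D ≤ d := (le_max_left _ _).trans (le_max_left _ _)
    have hd₂ : S.level ≤ d := (le_max_right _ _).trans (le_max_left _ _)
    have hd₃ : 1 ≤ d := le_max_right _ _
    have hs := S.sat.sub (hmem ω hω)
    have ho : Γ.o (z 0) = Γ.o (glue m (g x) (p ω) m) := by
      rw [glue_self, hz.2 0 (by omega)]
    have hu : glue m (g x) z ∈ cyl (glue m (g x) (p ω)) (m + d) := by
      have e : glue m (g x) z = glue m (glue m (g x) (p ω)) z :=
        glue_congr (fun i hi => (glue_of_lt hi _ _).symm) z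
      rw [e]
      refine ⟨glue_mem_shift hs hz.1 ho, fun i hi => ?_⟩
      by_cases him : i < m
      · rw [glue_of_lt him]
      · rw [glue_of_le (by omega), glue_of_le (by omega)]
        exact hz.2 _ (by omega)
    have huE : glue m (g x) z ∈ S.E := (S.sat.mono (by omega)).cyl _ (hmem ω hω) hu
    have hu' : g⁻¹ (glue m (g x) z) ∈ cyl x n := by
      refine ⟨S.sat.sub ((map_mem_iff (S.H.inv_mem hg)).2 huE), fun i hi => ?_⟩
      have := hD _ huE _ (hmem ω hω) (fun i hi => hu.2 i (by omega)) i hi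
      rw [this, ← hp ω hω, inv_apply_self, glue_of_lt hi]
    obtain ⟨ω', hω', hωo', e⟩ := exists_glue hn hx hu'
    refine ⟨ω', ⟨hω', hωo'⟩, glue_injective m (g x) ?_⟩
    rw [← hp ω' ⟨hω', hωo'⟩, e, apply_inv_self]
  · intro ω hω
    have := S.core_of_le _ (S.sat.sub (hmem ω hω)) (m + max (max D S.level) 1) (by
      have := le_max_right D S.level
      have := le_max_left (max D S.level) 1
      omega)
    rwa [glue_add] at this

end Setting
end FinDigraph

namespace ChartGroup

theorem Path.exists_cover {ι W X : Type} {C : W → Type} {mv : ι → Move C}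
    {A : Multiset (Chart C X)} {p : Chart C X → Prop}
    (h : ∀ φ ∈ A, ∃ k B, Path mv {φ} k B ∧ (∀ χ ∈ B, p χ) ∧ ∀ x, cover B x = cover {φ} x) :
    ∃ k B, Path mv A k B ∧ (∀ χ ∈ B, p χ) ∧ ∀ x, cover B x = cover A x := by
  induction A using Multiset.induction_on with
  | empty => exact ⟨0, 0, ChartGroup.Path.refl, by simp, fun _ => rfl⟩
  | cons φ A ih =>
    obtain ⟨k, B, hB, hp, hc⟩ := ih fun ψ hψ => h ψ (Multiset.mem_cons_of_mem hψ)
    obtain ⟨k', B', hB', hp', hc'⟩ := h φ (Multiset.mem_cons_self φ A)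
    refine ⟨k' + k, B' + B, by simpa using hB'.add hB, fun χ hχ => ?_, fun x => ?_⟩
    · exact (Multiset.mem_add.1 hχ).elim (hp' χ) (hp χ)
    · rw [← Multiset.singleton_add, cover_add, cover_add, hc, hc']

end ChartGroup

namespace FinDigraph
namespace Setting

open ChartGroup

variable {Γ : FinDigraph} {S : Setting Γ}

theorem eq_of_mem_img {φ ψ : Chart S.Mod (ℕ → Γ.E)} {n : ℕ} (hn : 1 ≤ n)
    (hφ : φ ∈ S.coneCharts n) (hψ : ψ ∈ S.coneCharts n) {z : ℕ → Γ.E} (h : z ∈ img φ)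
    (h' : z ∈ img ψ) : φ = ψ := by
  obtain ⟨x, hx, hc, rfl⟩ := hφ
  obtain ⟨y, hy, hc', rfl⟩ := hψ
  rw [img_coneChart hn hx] at h
  rw [img_coneChart hn hy] at h'
  have hz : Γ.o (z n) ∈ S.core := by rwa [origin_eq hn hx h]
  rw [← coneChart_congr hn hx h hc hz, ← coneChart_congr hn hy h' hc' hz]

/-- A disjoint family of cylinder charts of the same level is determined by its union. -/
theorem eq_of_cover_eq {A B : Multiset (Chart S.Mod (ℕ → Γ.E))} {n : ℕ} (hn : 1 ≤ n)
    (hA : ∀ φ ∈ A, φ ∈ S.coneCharts n) (hB : ∀ φ ∈ B, φ ∈ S.coneCharts n)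
    (h₁ : ∀ x, cover A x ≤ 1) (h : ∀ x, cover A x = cover B x) : A = B := by
  have hnodup : ∀ D : Multiset (Chart S.Mod (ℕ → Γ.E)), (∀ x, cover D x ≤ 1) → D.Nodup := by
    intro D hD
    rw [Multiset.nodup_iff_count_le_one]
    intro φ
    obtain ⟨x, hx⟩ := nonempty_img φ
    refine le_trans ?_ (hD x)
    rw [cover, Multiset.count, Multiset.countP_eq_card_filter, Multiset.countP_eq_card_filter]
    refine Multiset.card_le_card (Multiset.monotone_filter_right D ?_)
    rintro ψ rfl
    exact hx
  have hsub : ∀ A B : Multiset (Chart S.Mod (ℕ → Γ.E)), (∀ φ ∈ A, φ ∈ S.coneCharts n) →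
      (∀ φ ∈ B, φ ∈ S.coneCharts n) → (∀ x, cover A x = cover B x) → ∀ φ ∈ A, φ ∈ B := by
    intro A B hA hB h φ hφ
    obtain ⟨x, hx⟩ := nonempty_img φ
    have h₀ : 0 < cover A x := cover_pos.2 ⟨φ, hφ, hx⟩
    rw [h] at h₀
    obtain ⟨ψ, hψ, hxψ⟩ := cover_pos.1 h₀
    rwa [eq_of_mem_img hn (hA φ hφ) (hB ψ hψ) hx hxψ]
  refine (Multiset.Nodup.ext (hnodup A h₁) (hnodup B fun x => (h x) ▸ h₁ x)).2 fun φ =>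
    ⟨hsub A B hA hB h φ, hsub B A hB hA (fun x => (h x).symm) φ⟩

theorem exists_cones {Y : Set (ℕ → Γ.E)} {n : ℕ} (hY : Sat Y n) (hn : S.level ≤ n) :
    ∃ A : Multiset (Chart S.Mod (ℕ → Γ.E)), (∀ φ ∈ A, φ ∈ S.coneCharts n ∧ img φ ⊆ Y) ∧
      ∀ x, cover A x = if x ∈ Y then 1 else 0 := by
  have hn₁ : 1 ≤ n := S.level_pos.trans hn
  have hfin : {φ | φ ∈ S.coneCharts n ∧ img φ ⊆ Y}.Finite :=
    (finite_coneCharts (S := S) hn₁).subset fun φ h => h.1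
  refine ⟨hfin.toFinset.val, fun φ hφ => ?_, fun x => ?_⟩
  · simpa using hφ
  split_ifs with hx
  · rw [cover, Multiset.countP_eq_card_filter, ← Finset.filter_val]
    have hc := S.core_of_le x (hY.sub hx) n hn
    have hxc : x ∈ img (S.coneChart x n hc) := by
      rw [img_coneChart hn₁ (hY.sub hx)]
      exact mem_cyl_self (hY.sub hx) n
    have hmem : S.coneChart x n hc ∈ S.coneCharts n := ⟨x, hY.sub hx, hc, rfl⟩
    refine Finset.card_eq_one.2 ⟨S.coneChart x n hc, ?_⟩
    ext φ
    simp only [Finset.mem_filter, Set.Finite.mem_toFinset, Finset.mem_singleton]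
    constructor
    · rintro ⟨h, hφ⟩
      exact eq_of_mem_img hn₁ h.1 hmem hφ hxc
    · rintro rfl
      refine ⟨⟨hmem, ?_⟩, hxc⟩
      rw [img_coneChart hn₁ (hY.sub hx)]
      exact hY.cyl x hx
  · refine cover_eq_zero.2 fun φ hφ h => hx ?_
    have : φ ∈ hfin.toFinset := hφ
    exact ((Set.Finite.mem_toFinset hfin).1 this).2 h

/-- The proper subset condition for cylinders that miss a point. -/
theorem ssubset_of_notMem {A : Set (ℕ → Γ.E)} (h : A ⊆ S.E) {x : ℕ → Γ.E} (hx : x ∈ S.E)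
    (hxA : x ∉ A) : A ⊂ S.E := h.ssubset_of_not_subset fun h' => hxA (h' hx)

theorem exists_two (S : Setting Γ) {Y : Set (ℕ → Γ.E)} {n : ℕ} (hY : Sat Y n) (hne : Y.Nonempty) :
    ∃ x ∈ Y, ∃ y ∈ Y, ∃ i, n ≤ i ∧ x i ≠ y i := by
  obtain ⟨x, hx⟩ := hne
  obtain ⟨y, hy, hyx⟩ := S.exists_ne x (hY.sub hx) n
  obtain ⟨i, hi⟩ := Function.ne_iff.1 hyx
  refine ⟨x, hx, y, hY.cyl x hx hy, i, ?_, hi.symm⟩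
  by_contra h
  exact hi (hy.2 i (by omega))

theorem moveData_id {v : Γ.V} (hv : v ∈ S.core) : S.MoveData v id 1 := by
  refine ⟨⟨hv, le_rfl, fun ω _ ω' _ h => h, fun ω h => h.1, ?_, ?_⟩, ?_⟩
  · intro ω hω z hz
    exact ⟨z, ⟨hz.1, by rw [hz.2 0 one_pos]; exact hω.2⟩, rfl⟩
  · intro ω hω
    refine S.core_succ ω hω.1 0 ?_
    rw [hω.2]
    exact hv
  · obtain ⟨x, hx, y, hy, i, hi, hxy⟩ := S.exists_two S.sat S.ne
    have hxs := S.sat.sub hx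
    obtain ⟨z, hz, m, hm, hzv⟩ := S.core_reach x hxs (i + 1) v hv
    have hsub : cyl z m ⊆ cyl x (i + 1) :=
      (cyl_mono hm).trans (cyl_eq_of_mem hz).subset
    refine ⟨1, S.H.one_mem, z, hz.1, m, m, by omega, ?_, hzv, fun ω _ => rfl⟩
    refine ssubset_of_notMem (hsub.trans ((cyl_mono (by omega)).trans (S.sat.cyl x hx))) hy ?_
    exact fun h => hxy ((hsub h).2 i (by omega)).symm

/-- A finite supply of subdivisions. -/
structure Moves (S : Setting Γ) where
  I : Set (Γ.V × ((ℕ → Γ.E) → ℕ → Γ.E) × ℕ)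
  fin : I.Finite
  data : ∀ q ∈ I, S.MoveData q.1 q.2.1 q.2.2
  id_mem : ∀ v ∈ S.core, (v, id, 1) ∈ I
  nuc_mem : ∀ p ∈ S.nuc, (∃ d, S.MoveData p.1 p.2 d) → ∃ d, (p.1, p.2, d) ∈ I

instance : Nonempty S.Moves := by
  set J : Set (Γ.V × ((ℕ → Γ.E) → ℕ → Γ.E)) := {p | p ∈ S.nuc ∧ ∃ d, S.MoveData p.1 p.2 d}
  have hJ : J.Finite := S.nuc_finite.subset fun p hp => hp.1
  choose f hf using fun p : J => p.2.2
  refine ⟨⟨(fun v => (v, id, 1)) '' S.core ∪ Set.range fun p : J => (p.1.1, p.1.2, f p),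
    ?_, ?_, ?_, ?_⟩⟩
  · have := hJ.to_subtype
    exact ((Set.toFinite S.core).image _).union (Set.finite_range _)
  · rintro q (⟨v, hv, rfl⟩ | ⟨p, rfl⟩)
    · exact moveData_id hv
    · exact hf p
  · exact fun v hv => Or.inl ⟨v, hv, rfl⟩
  · exact fun p hp hd => ⟨f ⟨p, hp, hd⟩, Or.inr ⟨⟨p, hp, hd⟩, rfl⟩⟩

namespace Moves

variable (M : S.Moves)

/-- The subdivisions as an indexed family. -/
def mv (q : ↥M.I) : Move S.Mod := (M.data q q.2).toMoveOK.move

theorem path_app {v : Γ.V} {p : (ℕ → Γ.E) → ℕ → Γ.E} {d : ℕ} (hq : (v, p, d) ∈ M.I) {m : ℕ}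
    {z : ℕ → Γ.E} {f : (ℕ → Γ.E) → ℕ → Γ.E} (hv : v ∈ S.core)
    (hf : ∀ ω ∈ nodeCone v, f ω = glue m z (p ω)) (hs : ∀ ω ∈ nodeCone v, f ω ∈ Γ.shift) :
    ∃ k B, Path M.mv {S.nodeChart hv f} k B ∧ (∀ χ ∈ B, χ ∈ S.coneCharts (m + d)) ∧
      ∀ x, cover B x = cover {S.nodeChart hv f} x := by
  have hd := M.data _ hq
  refine ⟨_, _, Path.fwd (mv := M.mv) (R := 0) ⟨_, hq⟩ (fun ω => f ω.1) ChartGroup.Path.refl, ?_, ?_⟩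
  · intro χ hχ
    rw [add_zero] at hχ
    obtain ⟨ω, hω, h', rfl⟩ := hd.toMoveOK.exists_of_mem_app (z := z) (m := m)
      (fun ω => hf ω.1 ω.2) hχ
    refine ⟨_, ?_, h', rfl⟩
    rw [← hf ω hω]
    exact hs ω hω
  · intro x
    have hinj : Function.Injective (fun ω : S.Mod (M.mv ⟨_, hq⟩).src => f ω.1) := by
      intro ω ω' h
      simp only at h
      rw [hf ω.1 ω.2, hf ω'.1 ω'.2] at h
      exact Subtype.ext (hd.inj _ ω.2 _ ω'.2 (glue_injective _ _ h))
    rw [add_zero, Move.cover_app _ hinj, cover_singleton]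
    rfl

theorem expand_one {φ : Chart S.Mod (ℕ → Γ.E)} {n : ℕ} (hφ : φ ∈ S.coneCharts n) :
    ∃ k B, Path M.mv {φ} k B ∧ (∀ χ ∈ B, χ ∈ S.coneCharts (n + 1)) ∧
      ∀ x, cover B x = cover {φ} x := by
  obtain ⟨x, hx, h, rfl⟩ := hφ
  exact M.path_app (M.id_mem _ h) h (fun ω _ => rfl)
    fun ω hω => glue_mem_shift hx hω.1 hω.2

theorem expand {φ : Chart S.Mod (ℕ → Γ.E)} {n L : ℕ} (hφ : φ ∈ S.coneCharts n) (h : n ≤ L) :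
    ∃ k B, Path M.mv {φ} k B ∧ (∀ χ ∈ B, χ ∈ S.coneCharts L) ∧
      ∀ x, cover B x = cover {φ} x := by
  induction L, h using Nat.le_induction with
  | base => exact ⟨0, _, ChartGroup.Path.refl, by simpa using hφ, fun _ => rfl⟩
  | succ L _ ih =>
    obtain ⟨k, B, hB, hp, hc⟩ := ih
    obtain ⟨k', B', hB', hp', hc'⟩ := Path.exists_cover fun χ hχ => M.expand_one (hp χ hχ)
    exact ⟨_, B', hB.trans hB', hp', fun x => (hc' x).trans (hc x)⟩

theorem expand_all (A : Multiset (Chart S.Mod (ℕ → Γ.E)))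
    (hA : ∀ φ ∈ A, ∃ n, φ ∈ S.coneCharts n) :
    ∃ L₀, ∀ L ≥ L₀, ∃ k B, Path M.mv A k B ∧ (∀ χ ∈ B, χ ∈ S.coneCharts L) ∧
      ∀ x, cover B x = cover A x := by
  have key : ∃ L₀, ∀ φ ∈ A, ∃ n ≤ L₀, φ ∈ S.coneCharts n := by
    induction A using Multiset.induction_on with
    | empty => exact ⟨0, by simp⟩
    | cons φ A ih =>
      obtain ⟨L, hL⟩ := ih fun ψ hψ => hA ψ (Multiset.mem_cons_of_mem hψ)
      obtain ⟨n, hn⟩ := hA φ (Multiset.mem_cons_self φ A)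
      refine ⟨max n L, fun ψ hψ => ?_⟩
      rcases Multiset.mem_cons.1 hψ with rfl | hψ
      · exact ⟨n, le_max_left _ _, hn⟩
      · obtain ⟨m, hm, h⟩ := hL ψ hψ
        exact ⟨m, hm.trans (le_max_right _ _), h⟩
  obtain ⟨L₀, hL₀⟩ := key
  refine ⟨L₀, fun L hL => Path.exists_cover fun φ hφ => ?_⟩
  obtain ⟨n, hn, h⟩ := hL₀ φ hφ
  exact M.expand h (hn.trans hL)

/-- Group elements supported on `Y` act on cylinder decompositions of `Y` by subdivisions
and their inverses. -/
theorem exists_path {A : Multiset (Chart S.Mod (ℕ → Γ.E))} {Y : Set (ℕ → Γ.E)} {n₀ : ℕ}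
    (hY : Sat Y n₀) (hYE : Y ⊂ S.E) (hA : ∀ φ ∈ A, φ ∈ S.coneCharts n₀)
    (hc : ∀ x, cover A x = if x ∈ Y then 1 else 0) {g : Equiv.Perm (ℕ → Γ.E)} (hg : g ∈ S.H)
    (hgY : ∀ x ∉ Y, g x = x) : ∃ k, Path M.mv A k (A.map (push g)) := by
  obtain ⟨N, hN⟩ := S.nuc_act g hg 1
  obtain ⟨L₀, hL₀⟩ := M.expand_all A fun φ hφ => ⟨n₀, hA φ hφ⟩
  set n := max (max N n₀) (max L₀ S.level) with hn
  have hn₁ : N ≤ n := (le_max_left _ _).trans (le_max_left _ _)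
  have hn₂ : n₀ ≤ n := (le_max_right _ _).trans (le_max_left _ _)
  have hn₃ : L₀ ≤ n := (le_max_left _ _).trans (le_max_right _ _)
  have hn₄ : S.level ≤ n := (le_max_right _ _).trans (le_max_right _ _)
  have hn₅ : 1 ≤ n := S.level_pos.trans hn₄
  obtain ⟨k₁, A₁, hp₁, hA₁, hc₁⟩ := hL₀ n hn₃
  have hY' := hY.mono hn₂
  have hstep : ∀ φ ∈ A₁.map (push g), ∃ k B, Path M.mv {φ} k B ∧
      (∀ χ ∈ B, ∃ l, χ ∈ S.coneCharts l) ∧ ∀ x, cover B x = cover {φ} x := by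
    intro φ hφ
    obtain ⟨ψ, hψ, rfl⟩ := Multiset.mem_map.1 hφ
    obtain ⟨y, hy, hyc, rfl⟩ := hA₁ ψ hψ
    have hyY : y ∈ Y := by
      have h₀ : 0 < cover A₁ y := cover_pos.2 ⟨_, hψ, by
        rw [img_coneChart hn₅ hy]; exact mem_cyl_self hy n⟩
      rw [hc₁, hc] at h₀
      by_contra h
      rw [if_neg h] at h₀
      exact absurd h₀ (lt_irrefl 0)
    have hcyl : cyl y n ⊂ S.E := (hY'.cyl y hyY).trans_ssubset hYE
    obtain ⟨m, -, ⟨v, p⟩, hp, hpv, hgp⟩ := hN y (hYE.1 hyY) n hn₁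
    simp only at hpv hgp
    subst hpv
    have hgp' : ∀ ω ∈ nodeCone (Γ.o (y n)), g (glue n y ω) = glue m (g y) (p ω) :=
      fun ω hω => hgp ω hω.1 hω.2
    obtain ⟨d, hd⟩ := M.nuc_mem _ hp (exists_moveData hg hn₅ hy hcyl hyc hgp')
    obtain ⟨k, B, hB, hBl, hBc⟩ := M.path_app (f := g ∘ glue n y) hd hyc hgp' fun ω hω =>
      S.sat.sub ((map_mem_iff hg).2 (hcyl.1 (glue_mem_cyl hy hω.1 hω.2)))
    exact ⟨k, B, hB, fun χ hχ => ⟨_, hBl χ hχ⟩, hBc⟩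
  obtain ⟨k₂, B, hp₂, hB, hc₂⟩ := Path.exists_cover hstep
  obtain ⟨L₁, hL₁⟩ := M.expand_all B hB
  set L := max (max L₀ L₁) 1 with hL
  obtain ⟨k₃, B', hp₃, hB', hc₃⟩ := hL₁ L ((le_max_right _ _).trans (le_max_left _ _))
  obtain ⟨k₄, A', hp₄, hA', hc₄⟩ := hL₀ L ((le_max_left _ _).trans (le_max_left _ _))
  have hAB : A' = B' := by
    refine eq_of_cover_eq (le_max_right _ _) hA' hB' (fun x => ?_) fun x => ?_
    · rw [hc₄, hc]; split_ifs <;> simp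
    · rw [hc₄, hc, hc₃, hc₂, cover_map, hc₁, hc]
      have : g⁻¹ x ∈ Y ↔ x ∈ Y := by
        constructor
        · intro h
          by_contra hx
          have := hgY x hx
          rw [← this, inv_apply_self] at h
          exact hx h
        · intro h
          by_contra hx
          have := hgY _ hx
          rw [apply_inv_self] at this
          rw [← this] at hx
          exact hx h
      simp only [this]
  exact ⟨_, hp₄.trans (hAB ▸ (((hp₁.map g).trans hp₂).trans hp₃).symm)⟩

end Moves

end Setting
end FinDigraph

namespace FinDigraph
namespace Setting

open ChartGroup

variable {Γ : FinDigraph} {S : Setting Γ}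

/-- Every saturated nonempty set contains infinitely many disjoint cylinders of arbitrary
types. -/
theorem exists_disjoint_cylinders (S : Setting Γ) {ι : Type} [Countable ι] {B : Set (ℕ → Γ.E)}
    {n : ℕ} (hB : Sat B n) (hne : B.Nonempty) (w : ι → {v // v ∈ S.core}) :
    ∃ (y : ι → ℕ → Γ.E) (m : ι → ℕ), (∀ q, n < m q ∧ y q ∈ B ∧ cyl (y q) (m q) ⊆ B ∧
      Γ.o (y q (m q)) = (w q).1) ∧
      ∀ q q', q ≠ q' → Disjoint (cyl (y q) (m q)) (cyl (y q') (m q')) := by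
  obtain ⟨x, hx⟩ := hne
  have hxs := hB.sub hx
  set 𝔻 : Set ℕ := {e | n ≤ e ∧ ∃ y ∈ cyl x e, y e ≠ x e} with h𝔻
  have hinf : 𝔻.Infinite := by
    refine Set.infinite_of_forall_exists_gt fun a => ?_
    obtain ⟨y, hy, hyx⟩ := S.exists_ne x hxs (max n (a + 1))
    have hex : ∃ i, y i ≠ x i := Function.ne_iff.1 hyx
    have h₁ : max n (a + 1) ≤ Nat.find hex := by
      by_contra h
      exact Nat.find_spec hex (hy.2 _ (not_le.1 h))
    refine ⟨Nat.find hex, ⟨(le_max_left _ _).trans h₁, y, ⟨hy.1, fun i hi => ?_⟩,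
      Nat.find_spec hex⟩, lt_of_lt_of_le (Nat.lt_succ_self a) ((le_max_right _ _).trans h₁)⟩
    simpa using Nat.find_min hex hi
  obtain ⟨f, hf⟩ := exists_injective_nat ι
  set e : ι → ℕ := fun q => hinf.natEmbedding _ (f q) with he
  have heinj : Function.Injective e := fun q q' h =>
    hf ((hinf.natEmbedding _).injective (Subtype.ext h))
  have hed : ∀ q, e q ∈ 𝔻 := fun q => (hinf.natEmbedding _ (f q)).2
  have key : ∀ q, ∃ y, ∃ m, e q < m ∧ y ∈ cyl x (e q) ∧ y (e q) ≠ x (e q) ∧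
      Γ.o (y m) = (w q).1 := by
    intro q
    obtain ⟨-, y₀, hy₀, hne⟩ := hed q
    obtain ⟨y, hy, m, hm, ho⟩ := S.core_reach y₀ hy₀.1 (e q + 1) (w q).1 (w q).2
    refine ⟨y, m, hm, ⟨hy.1, fun i hi => ?_⟩, ?_, ho⟩
    · rw [hy.2 i (by omega), hy₀.2 i hi]
    · rw [hy.2 _ (Nat.lt_succ_self _)]
      exact hne
  choose y m hm hy hyne ho using key
  have hyB : ∀ q, cyl (y q) (e q) ⊆ B := fun q =>
    (cyl_eq_of_mem (hy q)).subset.trans ((hB.mono (hed q).1).cyl x hx)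
  refine ⟨y, m, fun q => ⟨(hed q).1.trans_lt (hm q), hyB q (mem_cyl_self (hy q).1 _),
    (cyl_mono (hm q).le).trans (hyB q), ho q⟩, ?_⟩
  have hlt : ∀ q q', e q < e q' → Disjoint (cyl (y q) (m q)) (cyl (y q') (m q')) := by
    intro q q' h
    refine disjoint_cyl (hm q) (h.trans (hm q')) ?_
    rw [(hy q').2 _ h]
    exact hyne q
  intro q q' hqq
  rcases lt_trichotomy (e q) (e q') with h | h | h
  · exact hlt q q' h
  · exact absurd (heinj h) hqq
  · exact (hlt q' q h).symm

theorem isGroupChart_kid {v : Γ.V} {p : (ℕ → Γ.E) → ℕ → Γ.E} {d : ℕ} (hd : S.MoveData v p d)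
    {z : ℕ → Γ.E} {n : ℕ} (hn : 1 ≤ n) (hz : z ∈ Γ.shift) (hzE : cyl z n ⊂ S.E)
    {h : Γ.o (z n) ∈ S.core} {f : S.Mod ⟨v, hd.mem⟩ → ℕ → Γ.E}
    (hf : (⟨⟨v, hd.mem⟩, f⟩ : Chart S.Mod (ℕ → Γ.E)) = S.coneChart z n h)
    {ψ : Chart S.Mod (S.Mod ⟨v, hd.mem⟩)} (hψ : ψ ∈ hd.toMoveOK.move.ch) :
    S.IsGroupChart (push f ψ) := by
  obtain ⟨g, hg, x, hx, n', m, hn', hxE, hxv, hgx⟩ := hd.act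
  subst hxv
  have ho : Γ.o (x n') = Γ.o (z n) := congrArg (fun φ => φ.1.1) hf
  obtain ⟨k, hk, hkx⟩ := exists_map_coneChart (h := hd.mem) (h' := h) hn' hn hx hz hxE hzE ho
  have hfk : f = k ∘ fun ω : S.Mod ⟨_, hd.mem⟩ => glue n' x ω.1 := by
    have : (⟨⟨_, hd.mem⟩, f⟩ : Chart S.Mod (ℕ → Γ.E))
        = ⟨⟨_, hd.mem⟩, k ∘ fun ω : S.Mod ⟨_, hd.mem⟩ => glue n' x ω.1⟩ := hf.trans hkx.symm
    exact eq_of_heq (Sigma.mk.inj this).2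
  obtain ⟨ω, hω, hψω⟩ := hd.toMoveOK.mem_charts.1 hψ
  set u := glue m (g x) (p ω) with hu
  have huE : u ∈ S.E := by
    rw [hu, ← hgx ω hω]
    exact (map_mem_iff hg).2 (hxE.1 (glue_mem_cyl hx hω.1 hω.2))
  have huo : u (m + d) = p ω d := glue_add _ _ _ _
  have huc : Γ.o (u (m + d)) ∈ S.core := by rw [huo]; exact hd.core ω hω
  have hone : 1 ≤ m + d := hd.pos.trans (Nat.le_add_left _ _)
  set θ := push (fun ω : S.Mod ⟨_, hd.mem⟩ => glue n' x ω.1) ψ with hθ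
  have h₁ : push g θ = S.coneChart u (m + d) huc := by
    rw [← push_glue_coneChart (p ω) (g x) d m (hd.core ω hω), ← hψω]
    have : g ∘ (fun ω : S.Mod ⟨_, hd.mem⟩ => glue n' x ω.1)
        = glue m (g x) ∘ fun ω : S.Mod ⟨_, hd.mem⟩ => p ω.1 :=
      funext fun ω => hgx ω.1 ω.2
    have h₃ : push g θ = push (g ∘ fun ω : S.Mod ⟨_, hd.mem⟩ => glue n' x ω.1) ψ := rfl
    rw [h₃, this]
    rfl
  have h₂ : push f ψ = push k θ := by rw [hfk]; rfl
  refine ⟨k * g⁻¹, S.H.mul_mem hk (S.H.inv_mem hg), u, S.sat.sub huE, m + d, hone, ?_, huc, ?_⟩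
  · rw [← img_coneChart hone (S.sat.sub huE) huc, ← h₁, img_push, hθ]
    rintro _ ⟨a, ha, rfl⟩
    refine (map_mem_iff hg).2 (hxE.1 ?_)
    obtain ⟨τ, rfl⟩ := System.img_push_subset _ _ ha
    exact glue_mem_cyl hx τ.2.1 τ.2.2
  · rw [push_mul, ← h₁, push_inv_push, h₂]

/-- The charts of cylinders up to a given level that are contained in one of the pieces. -/
def roots (S : Setting Γ) (P : Fin 3 → Set (ℕ → Γ.E)) (L : ℕ) : Set (Chart S.Mod (ℕ → Γ.E)) :=
  {φ | ∃ n, 1 ≤ n ∧ n ≤ L ∧ φ ∈ S.coneCharts n ∧ ∃ i, img φ ⊆ P i}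

theorem finite_roots (P : Fin 3 → Set (ℕ → Γ.E)) (L : ℕ) : (S.roots P L).Finite := by
  have : (⋃ n ∈ Set.Icc 1 L, S.coneCharts n).Finite :=
    (Set.finite_Icc 1 L).biUnion fun n hn => finite_coneCharts hn.1
  refine this.subset ?_
  rintro φ ⟨n, h₁, h₂, h₃, -⟩
  exact Set.mem_biUnion (show n ∈ Set.Icc 1 L from ⟨h₁, h₂⟩) h₃

theorem exists_finite_of_pieces (P : Fin 3 → Set (ℕ → Γ.E)) {n₀ : ℕ}
    (hP : ∀ i, Sat (P i) n₀) (hPne : ∀ i, (P i).Nonempty) (hPE : ∀ i, P i ⊂ S.E)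
    (hd : ∀ i j, i ≠ j → Disjoint (P i) (P j)) (hPE' : P 1 ∪ P 2 ⊂ S.E) :
    ∃ F : Set (Equiv.Perm (ℕ → Γ.E)), F.Finite ∧
      (∀ g ∈ F, g ∈ S.H ∧ ∀ x, (∀ i, x ∉ P i) → g x = x) ∧
      ∀ g ∈ S.H, (∀ x, x ∉ P 1 ∪ P 2 → g x = x) → g ∈ Subgroup.closure F := by
  obtain ⟨M⟩ : Nonempty S.Moves := inferInstance
  have := M.fin.fintype
  set N := max n₀ S.level with hN
  have hN₁ : 1 ≤ N := S.level_pos.trans (le_max_right _ _)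
  have hPN : ∀ i, Sat (P i) N := fun i => (hP i).mono (le_max_left _ _)
  have hex : ∀ q : Fin 3 × {v // v ∈ S.core}, ∃ y ∈ P q.1, ∃ m, N ≤ m ∧
      Γ.o (y m) = q.2.1 := by
    rintro ⟨i, w⟩
    obtain ⟨x, hx⟩ := hPne i
    obtain ⟨y, hy, m, hm, ho⟩ := S.core_reach x ((hP i).sub hx) N w.1 w.2
    exact ⟨y, (hPN i).cyl x hx hy, m, hm, ho⟩
  choose y hy m hm ho using hex
  obtain ⟨L₀, hL₀⟩ := Finite.exists_le m
  set L := max L₀ N with hL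
  let T : System ↥M.I S.Mod (ℕ → Γ.E) :=
    { mv := M.mv
      root := S.roots P L
      piece := P
      disj := hd
      root_inj := by
        rintro φ ⟨n, -, -, ⟨x, -, h, rfl⟩, -⟩
        exact coneChart_injective x n h
      root_mem := by
        rintro φ ⟨n, -, -, -, h⟩
        exact h
      exists_root := by
        intro i w
        have hs := (hP i).sub (hy (i, w))
        have hc : Γ.o (y (i, w) (m (i, w))) ∈ S.core := by rw [ho]; exact w.2
        have h1 : 1 ≤ m (i, w) := hN₁.trans (hm _)
        have hsub : img (S.coneChart _ _ hc) ⊆ P i := by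
          rw [img_coneChart h1 hs]
          exact (cyl_mono (hm _)).trans ((hPN i).cyl _ (hy (i, w)))
        exact ⟨S.coneChart _ _ hc, ⟨_, h1, (hL₀ _).trans (le_max_left _ _), ⟨_, hs, hc, rfl⟩,
          i, hsub⟩, Subtype.ext (ho (i, w)), hsub⟩ }
  have hgen : ∀ n, N ≤ n → ∀ i, ∀ x ∈ P i, ∀ h, T.Gen (S.coneChart x n h) := by
    intro n hn
    induction n, hn using Nat.le_induction with
    | base =>
      intro i x hx h
      refine System.Gen.root ⟨N, hN₁, le_max_right _ _, ⟨x, (hP i).sub hx, h, rfl⟩, i, ?_⟩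
      rw [img_coneChart hN₁ ((hP i).sub hx)]
      exact (hPN i).cyl x hx
    | succ n hn ih =>
      intro i x hx h
      have hxs := (hP i).sub hx
      have hc : Γ.o (x n) ∈ S.core :=
        S.core_of_le x hxs n ((le_max_right _ _).trans hn)
      have hq := M.id_mem _ hc
      have hω : (fun j => x (n + j)) ∈ nodeCone (Γ.o (x n)) := ⟨tail_mem_shift hxs n, rfl⟩
      obtain ⟨χ, hχ, e⟩ := (M.data _ hq).toMoveOK.exists_chart hω
      have hkid := System.Gen.kid (S := T) ⟨_, hq⟩
        (fun ω : S.Mod ⟨_, hc⟩ => glue n x ω.1) χ (ih i x hx hc)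
        ((M.data _ hq).toMoveOK.mem_charts.2 hχ)
      have e₁ : push (fun ω : S.Mod ⟨_, hc⟩ => glue n x ω.1) χ
          = push (glue n x) (push (fun ω : S.Mod ⟨_, hc⟩ => id ω.1) χ) := rfl
      have e₂ : glue n x (fun j => x (n + j)) = x := glue_tail fun _ _ => rfl
      have e₃ : push (glue n x) (push (fun ω : S.Mod ⟨_, hc⟩ => id ω.1) χ)
          = S.coneChart x (n + 1) h := by
        refine (congrArg _ e).trans ?_
        refine (push_glue_coneChart _ x 1 n _ (by simp only [id, e₂]; exact h)).trans ?_
        simp only [id, e₂]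
      rw [← e₃, ← e₁]
      exact hkid
  set Y := P 1 ∪ P 2 with hY
  have hYs : Sat Y N := (hPN 1).union (hPN 2)
  obtain ⟨A, hA, hAc⟩ := exists_cones hYs (le_max_right n₀ S.level)
  have hAG : ∀ φ ∈ A, T.Gen φ := by
    intro φ hφ
    obtain ⟨⟨x, hx, h, rfl⟩, hsub⟩ := hA φ hφ
    rw [img_coneChart hN₁ hx] at hsub
    rcases hsub (mem_cyl_self hx N) with h' | h'
    · exact hgen N le_rfl 1 x h' h
    · exact hgen N le_rfl 2 x h' h
  have hAle : ∀ x, cover A x ≤ 1 := fun x => by rw [hAc]; split_ifs <;> simp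
  have hA0 : ∀ x, cover A x = 0 ↔ x ∉ Y := fun x => by rw [hAc]; split_ifs with h <;> simp [h]
  obtain ⟨z, l, hz, hzd⟩ := S.exists_disjoint_cylinders (ι := ↥M.I × ℕ) (hPN 0) (hPne 0)
    (fun q => (M.mv q.1).src)
  have hcat : T.IsCatalyst A fun i j ω => glue (l (i, j)) (z (i, j)) ω.1 := by
    have hr : ∀ i j, Set.range (fun ω : S.Mod (M.mv i).src => glue (l (i, j)) (z (i, j)) ω.1)
        ⊆ cyl (z (i, j)) (l (i, j)) := by
      rintro i j _ ⟨ω, rfl⟩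
      exact glue_mem_cyl ((hP 0).sub (hz (i, j)).2.1) ω.2.1
        (ω.2.2.trans (hz (i, j)).2.2.2.symm)
    refine ⟨fun i j => ?_, fun i j i' j' h => ?_, fun i j c => ?_⟩
    · have hc : Γ.o (z (i, j) (l (i, j))) ∈ S.core := by
        rw [(hz (i, j)).2.2.2]
        exact (M.mv i).src.2
      have := hgen _ (hz (i, j)).1.le 0 _ (hz (i, j)).2.1 hc
      have e : S.coneChart (z (i, j)) (l (i, j)) hc
          = S.nodeChart (M.mv i).src.2 (glue (l (i, j)) (z (i, j))) :=
        nodeChart_congr (hz (i, j)).2.2.2 fun _ _ => rfl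
      rw [e] at this
      exact this
    · exact (hzd _ _ h).mono (hr i j) (hr i' j')
    · rw [hA0]
      have h0 : glue (l (i, j)) (z (i, j)) c.1 ∈ P 0 := (hz (i, j)).2.2.1 (hr i j ⟨c, rfl⟩)
      rintro (h | h)
      · exact Set.disjoint_left.1 (hd 0 1 (by decide)) h0 h
      · exact Set.disjoint_left.1 (hd 0 2 (by decide)) h0 h
  let K : Subgroup (Equiv.Perm (ℕ → Γ.E)) :=
    { carrier := {g | g ∈ S.H ∧ ∀ x, x ∉ Y → g x = x}
      one_mem' := ⟨S.H.one_mem, fun _ _ => rfl⟩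
      mul_mem' := fun {a b} ha hb => ⟨S.H.mul_mem ha.1 hb.1, fun x hx => by
        rw [Equiv.Perm.mul_apply, hb.2 x hx, ha.2 x hx]⟩
      inv_mem' := fun {a} ha => ⟨S.H.inv_mem ha.1, fun x hx => by
        rw [Equiv.Perm.inv_eq_iff_eq, ha.2 x hx]⟩ }
  obtain ⟨F, hF, hFK, hKF⟩ := hcat.exists_finite hAG hAle K fun g hg =>
    ⟨fun x hx => hg.2 x ((hA0 x).1 hx), M.exists_path hYs hPE' (fun φ hφ => (hA φ hφ).1) hAc
      hg.1 hg.2⟩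
  have hΦ : (T.root ∪ T.kids).Finite := by
    have hr : T.root.Finite := finite_roots P L
    exact hr.union (System.kids_finite hr)
  have hgroup : ∀ φ ∈ T.root ∪ T.kids, S.IsGroupChart φ ∧ T.Gen φ := by
    rintro φ (h | h)
    · refine ⟨?_, System.Gen.root h⟩
      obtain ⟨n, h₁, -, ⟨x, hx, hc, rfl⟩, i, hi⟩ := h
      rw [img_coneChart h₁ hx] at hi
      exact isGroupChart_coneChart h₁ hx (hi.trans (hPE i).1) hc
    · obtain ⟨q, f, ψ, hf, hψ, rfl⟩ := h
      refine ⟨?_, System.Gen.kid q f ψ (System.Gen.root hf) hψ⟩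
      obtain ⟨n, h₁, -, ⟨x, hx, hc, e⟩, i, hi⟩ := hf
      rw [e, img_coneChart h₁ hx] at hi
      exact isGroupChart_kid (M.data q q.2) h₁ hx (hi.trans_ssubset (hPE i)) e hψ
  refine ⟨_, (finite_swaps hΦ).union hF, ?_, ?_⟩
  · rintro g (⟨φ, hφ, ψ, hψ, hdis, hs⟩ | hg)
    · refine ⟨(hgroup φ hφ).1.swap_mem (hgroup ψ hψ).1 ?_ hdis hs, fun x hx => hs.off x ?_ ?_⟩
      · have := congrArg Sigma.fst hs.left
        exact this
      · obtain ⟨i, hi⟩ := (hgroup φ hφ).2.piece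
        exact fun h => hx i (hi h)
      · obtain ⟨i, hi⟩ := (hgroup ψ hψ).2.piece
        exact fun h => hx i (hi h)
    · exact ⟨(hFK hg).1, fun x hx => (hFK hg).2 x fun h => h.elim (hx 1) (hx 2)⟩
  · intro g hg hgx
    have h₁ : g ∈ K := ⟨hg, hgx⟩
    have h₂ := hKF h₁
    rw [Subgroup.closure_union]
    exact h₂

/-- The elements supported on a proper part of `E` lie in a finitely generated subgroup of
elements with slightly larger support. -/
theorem exists_finite_of_support {B Y : Set (ℕ → Γ.E)} {a b : ℕ} (hB : Sat B a) (hY : Sat Y b)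
    (hBE : B ⊆ S.E) (hYE : Y ⊆ S.E) (hBne : B.Nonempty) (hYne : Y.Nonempty)
    (hd : Disjoint B Y) :
    ∃ F : Set (Equiv.Perm (ℕ → Γ.E)), F.Finite ∧
      (∀ g ∈ F, g ∈ S.H ∧ ∀ x, x ∉ B ∪ Y → g x = x) ∧
      ∀ g ∈ S.H, (∀ x, x ∉ Y → g x = x) → g ∈ Subgroup.closure F := by
  obtain ⟨x, hx, y, hy, i, hi, hxy⟩ := S.exists_two hY hYne
  set n := max (max a b) (i + 1) with hn
  have ha : a ≤ n := (le_max_left _ _).trans (le_max_left _ _)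
  have hb : b ≤ n := (le_max_right _ _).trans (le_max_left _ _)
  have hcx : Sat (cyl x (i + 1)) n := (sat_cyl x (i + 1)).mono (le_max_right _ _)
  have hcY : cyl x (i + 1) ⊆ Y := (hY.mono (by omega)).cyl x hx
  have hxc := mem_cyl_self (hY.sub hx) (i + 1)
  have hyc : y ∉ cyl x (i + 1) := fun h => hxy (h.2 i (Nat.lt_succ_self i)).symm
  obtain ⟨β, hβ⟩ := id hBne
  have hun : cyl x (i + 1) ∪ Y \ cyl x (i + 1) = Y := Set.union_sdiff_cancel hcY
  have hYs : Y ⊂ S.E := ssubset_of_notMem hYE (hBE hβ) fun h => Set.disjoint_left.1 hd hβ h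
  have hBs : B ⊂ S.E := ssubset_of_notMem hBE (hYE hx) fun h => Set.disjoint_left.1 hd h hx
  obtain ⟨F, hF, hF₁, hF₂⟩ := exists_finite_of_pieces (S := S) (n₀ := n)
    ![B, cyl x (i + 1), Y \ cyl x (i + 1)]
    (by
      intro j
      fin_cases j
      · exact hB.mono ha
      · exact hcx
      · exact (hY.mono hb).diff hcx)
    (by
      intro j
      fin_cases j
      · exact hBne
      · exact ⟨x, hxc⟩
      · exact ⟨y, hy, hyc⟩)
    (by
      intro j
      fin_cases j
      · exact hBs
      · exact hcY.trans_ssubset hYs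
      · exact Set.sdiff_subset.trans_ssubset hYs)
    (by
      have h01 : Disjoint B (cyl x (i + 1)) := hd.mono_right hcY
      have h02 : Disjoint B (Y \ cyl x (i + 1)) := hd.mono_right Set.sdiff_subset
      have h12 : Disjoint (cyl x (i + 1)) (Y \ cyl x (i + 1)) := Set.disjoint_sdiff_right
      intro j k hjk
      fin_cases j <;> fin_cases k
      · exact absurd rfl hjk
      · exact h01
      · exact h02
      · exact h01.symm
      · exact absurd rfl hjk
      · exact h12
      · exact h02.symm
      · exact h12.symm
      · exact absurd rfl hjk)
    (by
      change cyl x (i + 1) ∪ Y \ cyl x (i + 1) ⊂ S.E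
      rw [hun]
      exact hYs)
  refine ⟨F, hF, fun g hg => ⟨(hF₁ g hg).1, fun z hz => (hF₁ g hg).2 z fun j hj => hz ?_⟩,
    fun g hg hgY => hF₂ g hg fun z hz => hgY z fun h => hz ?_⟩
  · fin_cases j
    · exact Or.inl hj
    · exact Or.inr (hcY hj)
    · exact Or.inr hj.1
  · change z ∈ cyl x (i + 1) ∪ Y \ cyl x (i + 1)
    rw [hun]
    exact h

end Setting
end FinDigraph

namespace FinDigraph
namespace Setting

open ChartGroup

variable {Γ : FinDigraph} {S : Setting Γ}

theorem exists_mem_core (S : Setting Γ) : ∃ v, v ∈ S.core := by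
  obtain ⟨x, hx⟩ := S.ne
  exact ⟨_, S.core_of_le x (S.sat.sub hx) _ le_rfl⟩

/-- Exchange of two disjoint group charts of the same type. -/
theorem IsGroupChart.exists_swap {φ ψ : Chart S.Mod (ℕ → Γ.E)} (hφ : S.IsGroupChart φ)
    (hψ : S.IsGroupChart ψ) (hw : φ.1 = ψ.1) (hd : Disjoint (img φ) (img ψ)) :
    ∃ s ∈ S.H, IsSwap s φ ψ := by
  obtain ⟨s, hs⟩ := exists_isSwap hw hφ.inj hψ.inj hd
  exact ⟨s, hφ.swap_mem hψ hw hd hs, hs⟩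

theorem exists_swap_cyl {x y : ℕ → Γ.E} {n m : ℕ} (hn : 1 ≤ n) (hm : 1 ≤ m)
    (hx : cyl x n ⊆ S.E) (hy : cyl y m ⊆ S.E) (hxs : x ∈ Γ.shift) (hys : y ∈ Γ.shift)
    (hc : Γ.o (x n) ∈ S.core) (ho : Γ.o (x n) = Γ.o (y m))
    (hd : Disjoint (cyl x n) (cyl y m)) :
    ∃ s ∈ S.H, (∀ ω ∈ nodeCone (Γ.o (x n)), s (glue n x ω) = glue m y ω ∧
      s (glue m y ω) = glue n x ω) ∧ ∀ z, z ∉ cyl x n → z ∉ cyl y m → s z = z := by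
  have hc' : Γ.o (y m) ∈ S.core := ho ▸ hc
  have hyx : S.coneChart y m hc' = S.nodeChart hc (glue m y) :=
    nodeChart_congr ho.symm fun _ _ => rfl
  obtain ⟨s, hs, hsw⟩ := (isGroupChart_coneChart hn hxs hx hc).exists_swap
    (isGroupChart_coneChart hm hys hy hc') (Subtype.ext ho)
    (by rwa [img_coneChart hn hxs, img_coneChart hm hys])
  refine ⟨s, hs, fun ω hω => ?_, fun z h h' => hsw.off z ?_ ?_⟩
  · have h₁ := hsw.left.trans hyx
    have h₂ := hsw.right
    rw [hyx] at h₂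
    exact ⟨congrFun (eq_of_heq (Sigma.mk.inj h₁).2) ⟨ω, hω⟩,
      congrFun (eq_of_heq (Sigma.mk.inj h₂).2) ⟨ω, hω⟩⟩
  · rwa [img_coneChart hn hxs]
  · rwa [img_coneChart hm hys]

theorem Sat.disjoint_cyl_of_notMem {B : Set (ℕ → Γ.E)} {n : ℕ} (hB : Sat B n) {x : ℕ → Γ.E}
    (hx : x ∈ Γ.shift) (hxB : x ∉ B) : Disjoint (cyl x n) B :=
  Set.disjoint_left.2 fun _ hz hzB => hxB ((hB.mem_iff hx hz).1 hzB)

theorem exists_notMem_notMem {X : Type} {B : Fin 3 → Set X}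
    (hB : ∀ i j, i ≠ j → Disjoint (B i) (B j)) (x y : X) : ∃ i, x ∉ B i ∧ y ∉ B i := by
  have key : ∀ x, ∃ a, ∀ i, i ≠ a → x ∉ B i := by
    intro x
    by_cases h : ∃ a, x ∈ B a
    · obtain ⟨a, ha⟩ := h
      exact ⟨a, fun i hi hxi => Set.disjoint_left.1 (hB i a hi) hxi ha⟩
    · exact ⟨0, fun i _ hxi => h ⟨i, hxi⟩⟩
  obtain ⟨a, ha⟩ := key x
  obtain ⟨b, hb⟩ := key y
  obtain ⟨c, hca, hcb⟩ := System.exists_ne_ne a b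
  exact ⟨c, ha c hca, hb c hcb⟩

/-- The whole group is finitely generated. -/
theorem exists_finite_generators (S : Setting Γ) :
    ∃ F : Set (Equiv.Perm (ℕ → Γ.E)), F.Finite ∧ F ⊆ S.H ∧ S.H ≤ Subgroup.closure F := by
  obtain ⟨w, hw⟩ := S.exists_mem_core
  obtain ⟨y, m, hy, hyd⟩ := S.exists_disjoint_cylinders (ι := Fin 3) S.sat S.ne
    fun _ => ⟨w, hw⟩
  have hm : ∀ i, 1 ≤ m i := fun i => by have := (hy i).1; omega
  have hys : ∀ i, y i ∈ Γ.shift := fun i => S.sat.sub (hy i).2.1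
  set B : Fin 3 → Set (ℕ → Γ.E) := fun i => cyl (y i) (m i) with hB
  have hBs : ∀ i, Sat (B i) (m i) := fun i => sat_cyl _ _
  have hbase : ∀ i, ∃ F : Set (Equiv.Perm (ℕ → Γ.E)), F.Finite ∧ F ⊆ S.H ∧
      ∀ g ∈ S.H, (∀ x ∈ B i, g x = x) → g ∈ Subgroup.closure F := by
    intro i
    obtain ⟨j, hj, -⟩ := System.exists_ne_ne i i
    have hne : (S.E \ B i).Nonempty := ⟨y j, (hy j).2.1, fun h =>
      Set.disjoint_left.1 (hyd j i hj) (mem_cyl_self (hys j) _) h⟩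
    obtain ⟨F, hF, h₁, h₂⟩ := exists_finite_of_support (S := S) (hBs i)
      ((S.sat.mono (hy i).1.le).diff (hBs i)) (hy i).2.2.1 Set.sdiff_subset
      ⟨y i, mem_cyl_self (hys i) _⟩ hne Set.disjoint_sdiff_right
    refine ⟨F, hF, fun g hg => (h₁ g hg).1, fun g hg hgB => h₂ g hg fun x hx => ?_⟩
    by_cases hxE : x ∈ S.E
    · exact hgB x (by_contra fun h => hx ⟨hxE, h⟩)
    · exact S.off g hg x hxE
  choose F hF hFH hFB using hbase
  set L := Subgroup.closure (⋃ i, F i) with hL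
  have hLB : ∀ i, ∀ g ∈ S.H, (∀ x ∈ B i, g x = x) → g ∈ L := fun i g hg h =>
    Subgroup.closure_mono (Set.subset_iUnion F i) (hFB i g hg h)
  have hfix : ∀ g ∈ S.H, ∀ x ∈ S.E, ∀ n, (∀ z ∈ cyl x n, g z = z) → g ∈ L := by
    intro g hg x hx n hgx
    have hxs := S.sat.sub hx
    obtain ⟨i, hi, -⟩ := exists_notMem_notMem hyd x x
    obtain ⟨j, hji, hj⟩ : ∃ j, j ≠ i ∧ x ∉ B j := by
      obtain ⟨a, hai, -⟩ := System.exists_ne_ne i i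
      by_cases ha : x ∈ B a
      · obtain ⟨b, hbi, hba⟩ := System.exists_ne_ne i a
        exact ⟨b, hbi, fun h => Set.disjoint_left.1 (hyd b a hba) h ha⟩
      · exact ⟨a, hai, ha⟩
    obtain ⟨u, hu, l, hl, ho⟩ := S.core_reach x hxs (max (max n S.level) (max (m i) (m j))) w hw
    have hsub : ∀ a, a ≤ max (max n S.level) (max (m i) (m j)) → cyl u l ⊆ cyl x a :=
      fun a ha => (cyl_mono hl).trans ((cyl_eq_of_mem hu).subset.trans (cyl_mono ha))
    have hdi : Disjoint (B i) (cyl u l) := ((Sat.disjoint_cyl_of_notMem (hBs i) hxs hi).mono_left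
      (hsub _ (by omega))).symm
    have hdj : Disjoint (B j) (cyl u l) := ((Sat.disjoint_cyl_of_notMem (hBs j) hxs hj).mono_left
      (hsub _ (by omega))).symm
    have hwi : Γ.o (y i (m i)) = w := (hy i).2.2.2
    have hl₁ : S.level ≤ l := le_trans (by omega) hl
    obtain ⟨k, hk, hks, hko⟩ := exists_swap_cyl (S := S) (hm i) (S.level_pos.trans hl₁)
      (hy i).2.2.1 ((hsub _ (by omega)).trans (S.sat.cyl x hx)) (hys i) hu.1 (hwi ▸ hw)
      (hwi.trans ho.symm) hdi
    have hkL : k ∈ L := by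
      refine hLB j k hk fun z hz => hko z ?_ ?_
      · exact Set.disjoint_left.1 (hyd j i hji) hz
      · exact Set.disjoint_left.1 hdj hz
    have hconj : k⁻¹ * g * k ∈ L := by
      refine hLB i _ (S.H.mul_mem (S.H.mul_mem (S.H.inv_mem hk) hg) hk) fun z hz => ?_
      obtain ⟨ω, hω, hωo, rfl⟩ := exists_glue (hm i) (hys i) hz
      have h₁ := (hks ω ⟨hω, hωo⟩).1
      have h₂ : g (glue l u ω) = glue l u ω := by
        refine hgx _ (hsub n (by omega) (glue_mem_cyl hu.1 hω ?_))
        rw [hωo, hwi, ho]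
      rw [Equiv.Perm.mul_apply, Equiv.Perm.mul_apply, h₁, h₂, ← h₁, inv_apply_self]
    have := L.mul_mem (L.mul_mem hkL hconj) (L.inv_mem hkL)
    rwa [mul_assoc k⁻¹, mul_inv_cancel_left, mul_inv_cancel_right] at this
  refine ⟨⋃ i, F i, Set.finite_iUnion hF, Set.iUnion_subset hFH, fun g hg => ?_⟩
  by_cases hg1 : g = 1
  · rw [hg1]
    exact L.one_mem
  obtain ⟨x, hgx⟩ : ∃ x, g x ≠ x := by
    by_contra! h
    exact hg1 (Equiv.ext h)
  have hx : x ∈ S.E := by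
    by_contra h
    exact hgx (S.off g hg x h)
  have hxs := S.sat.sub hx
  have hgxs := S.sat.sub ((map_mem_iff hg).2 hx)
  obtain ⟨i, hi, hgi⟩ := exists_notMem_notMem hyd x (g x)
  obtain ⟨e, he⟩ := Function.ne_iff.1 hgx
  obtain ⟨a, ha⟩ := S.cont g hg (max (e + 1) (m i))
  set n := max (max a S.level) (max (e + 1) (m i)) with hn
  have hn₁ : 1 ≤ n := by omega
  have hcE : cyl x n ⊆ S.E := (S.sat.mono (by omega)).cyl x hx
  have hgc : ∀ z ∈ cyl x n, g z ∈ cyl (g x) (max (e + 1) (m i)) := fun z hz =>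
    ⟨S.sat.sub ((map_mem_iff hg).2 (hcE hz)), fun j hj =>
      ha z (hcE hz) x hx (fun i hi => hz.2 i (by omega)) j hj⟩
  have hc := S.core_of_le x hxs n (by omega)
  have hφ := isGroupChart_coneChart hn₁ hxs hcE hc
  have hψ : S.IsGroupChart (push g (S.coneChart x n hc)) :=
    ⟨g, hg, x, hxs, n, hn₁, hcE, hc, rfl⟩
  have himg : img (push g (S.coneChart x n hc)) ⊆ cyl (g x) (max (e + 1) (m i)) := by
    rw [img_push, img_coneChart hn₁ hxs]
    rintro _ ⟨z, hz, rfl⟩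
    exact hgc z hz
  obtain ⟨s, hs, hsw⟩ := hφ.exists_swap hψ rfl (by
    rw [img_coneChart hn₁ hxs]
    exact (disjoint_cyl (i := e) (by omega) (by omega) he.symm).mono_right himg)
  have hsL : s ∈ L := by
    refine hLB i s hs fun z hz => hsw.off z ?_ fun h => ?_
    · rw [img_coneChart hn₁ hxs]
      exact fun h => Set.disjoint_left.1 (Sat.disjoint_cyl_of_notMem (hBs i) hxs hi)
        (cyl_mono (by omega) h) hz
    · exact Set.disjoint_left.1 (Sat.disjoint_cyl_of_notMem (hBs i) hgxs hgi)
        (cyl_mono (by omega) (himg h)) hz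
  have hsg : s * g ∈ L := by
    refine hfix _ (S.H.mul_mem hs hg) x hx n fun z hz => ?_
    rw [← img_coneChart hn₁ hxs hc] at hz
    exact eq_of_push_eq_self ((push_mul s g _).trans hsw.right) hz
  have := L.mul_mem (L.inv_mem hsL) hsg
  rwa [inv_mul_cancel_left] at this

end Setting
end FinDigraph

namespace FinDigraph

variable {Γ : FinDigraph}

theorem apply_add_mul_period {x : ℕ → Γ.E} {n T : ℕ} (h : ∀ i, n ≤ i → x (i + T) = x i)
    (k : ℕ) {i : ℕ} (hi : n ≤ i) : x (i + k * T) = x i := by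
  induction k with
  | zero => simp
  | succ k ih => rw [add_mul, one_mul, ← add_assoc, h _ (by omega), ih]

theorem exists_common_period {A : Set (ℕ → Γ.E)} (hA : A.Finite)
    (h : ∀ x ∈ A, ∃ n T, 1 ≤ T ∧ ∀ i, n ≤ i → x (i + T) = x i) :
    ∃ n T, 1 ≤ T ∧ ∀ x ∈ A, ∀ i, n ≤ i → x (i + T) = x i := by
  induction A, hA using Set.Finite.induction_on with
  | empty => exact ⟨0, 1, le_rfl, fun x hx => absurd hx (Set.notMem_empty x)⟩
  | @insert a A _ _ ih =>
    obtain ⟨n, T, hT, hn⟩ := ih fun x hx => h x (Set.mem_insert_of_mem a hx)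
    obtain ⟨m, R, hR, hm⟩ := h a (Set.mem_insert a A)
    refine ⟨max n m, R * T, Nat.mul_pos hR hT, ?_⟩
    rintro x (rfl | hx) i hi
    · rw [mul_comm]
      exact apply_add_mul_period hm T (le_trans (le_max_right _ _) hi)
    · exact apply_add_mul_period (hn x hx) R (le_trans (le_max_left _ _) hi)

theorem glue_period {x : ℕ → Γ.E} {n T : ℕ} (h : ∀ i, n ≤ i → x (i + T) = x i) (b r : ℕ)
    (ω : ℕ → Γ.E) :
    glue (n + b * T) x (glue r (fun i => x (n + i)) ω) = glue (n + (b * T + r)) x ω := by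
  funext i
  by_cases h₁ : i < n + b * T
  · rw [glue_of_lt h₁, glue_of_lt (by omega)]
  rw [glue_of_le (not_lt.1 h₁)]
  by_cases h₂ : i < n + (b * T + r)
  · rw [glue_of_lt (by omega), glue_of_lt h₂, ← apply_add_mul_period h b (by omega)]
    congr 1; omega
  · rw [glue_of_le (by omega), glue_of_le (by omega)]; congr 1; omega

theorem glue_period_self {x : ℕ → Γ.E} {n T : ℕ} (h : ∀ i, n ≤ i → x (i + T) = x i) (b : ℕ) :
    glue (n + b * T) x (fun i => x (n + i)) = x := by
  funext i
  by_cases h₁ : i < n + b * T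
  · rw [glue_of_lt h₁]
  · rw [glue_of_le (not_lt.1 h₁), ← apply_add_mul_period h b (by omega)]; congr 1; omega

/-- A finite set of points has neighbourhoods of a common level that are pairwise disjoint. -/
theorem exists_separating_level {A : Set (ℕ → Γ.E)} (hA : A.Finite) :
    ∃ D, ∀ x ∈ A, ∀ y ∈ A, x ≠ y → ∃ i < D, x i ≠ y i := by
  have h : ∀ q : (ℕ → Γ.E) × (ℕ → Γ.E), ∃ d, q.1 ≠ q.2 → ∃ i < d, q.1 i ≠ q.2 i := by
    intro q
    by_cases hq : q.1 = q.2
    · exact ⟨0, fun h => absurd hq h⟩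
    · obtain ⟨i, hi⟩ := Function.ne_iff.1 hq
      exact ⟨i + 1, fun _ => ⟨i, Nat.lt_succ_self i, hi⟩⟩
  choose d hd using h
  obtain ⟨D, hD⟩ := ((hA.prod hA).image d).bddAbove
  refine ⟨D, fun x hx y hy hxy => ?_⟩
  obtain ⟨i, hi, hne⟩ := hd (x, y) hxy
  exact ⟨i, hi.trans_le (hD ⟨(x, y), ⟨hx, hy⟩, rfl⟩), hne⟩

theorem exists_finite_reps {G β : Type} [Finite β] (P : β → G → Prop) :
    ∃ R : Set G, R.Finite ∧ (∀ r ∈ R, ∃ b, P b r) ∧ ∀ b g, P b g → ∃ r ∈ R, P b r :=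
  ⟨Set.range fun b : {b // ∃ g, P b g} => b.2.choose, Set.finite_range _,
    by rintro _ ⟨b, rfl⟩; exact ⟨b.1, b.2.choose_spec⟩,
    fun b g h => ⟨_, ⟨⟨b, g, h⟩, rfl⟩, (⟨g, h⟩ : ∃ g, P b g).choose_spec⟩⟩

namespace Setting

variable {S : Setting Γ}

/-- The elements of the group that fix every point of `A`. -/
def fixer (S : Setting Γ) (A : Set (ℕ → Γ.E)) : Subgroup (Equiv.Perm (ℕ → Γ.E)) :=
  S.H ⊓ fixingSubgroup (Equiv.Perm (ℕ → Γ.E)) A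

theorem mem_fixer {A : Set (ℕ → Γ.E)} {g : Equiv.Perm (ℕ → Γ.E)} :
    g ∈ S.fixer A ↔ g ∈ S.H ∧ ∀ x ∈ A, g x = x := by
  rw [fixer, Subgroup.mem_inf, mem_fixingSubgroup_iff]
  rfl

theorem exists_notMem_of_finite (S : Setting Γ) {A : Set (ℕ → Γ.E)} (hA : A.Finite) :
    ∃ z ∈ S.E, z ∉ A := by
  obtain ⟨w, hw⟩ := S.exists_mem_core
  obtain ⟨y, m, hy, hd⟩ := S.exists_disjoint_cylinders (ι := ℕ) S.sat S.ne fun _ => ⟨w, hw⟩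
  have hinj : Function.Injective y := fun i j hij => by
    by_contra h
    have hs := S.sat.sub (hy i).2.1
    exact Set.disjoint_left.1 (hd i j h) (mem_cyl_self hs _) (hij ▸ mem_cyl_self hs _)
  by_contra! h
  exact Set.infinite_range_of_injective hinj
    (hA.subset (Set.range_subset_iff.2 fun i => h _ (hy i).2.1))

/-- An element of the group that contracts a neighbourhood of an eventually periodic point
along its period. -/
theorem exists_contraction {x z : ℕ → Γ.E} {U : Set (ℕ → Γ.E)} {n T : ℕ}
    (hn : S.level ≤ n) (hT : ∀ i, n ≤ i → x (i + T) = x i) (hU : Sat U n) (hUE : U ⊆ S.E)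
    (hx : x ∈ U) (hz : z ∈ S.E) (hzU : z ∉ U) :
    ∃ s ∈ S.H, (∀ ω ∈ nodeCone (Γ.o (x n)), s (glue n x ω) = glue (n + T) x ω) ∧
      ∀ u ∈ U, u ∉ cyl x n → s u = u := by
  have hxs := hU.sub hx
  have hzs := S.sat.sub hz
  have hn₁ : 1 ≤ n := S.level_pos.trans hn
  have hc := S.core_of_le x hxs n hn
  obtain ⟨y, hy, m, hm, ho⟩ := S.core_reach z hzs n _ hc
  have hyz : cyl y m ⊆ cyl z n := (cyl_mono hm).trans (cyl_eq_of_mem hy).subset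
  have hyU : Disjoint (cyl y m) U := (Sat.disjoint_cyl_of_notMem hU hzs hzU).mono_left hyz
  have hyE : cyl y m ⊆ S.E := hyz.trans ((S.sat.mono hn).cyl z hz)
  have hxU : cyl x n ⊆ U := hU.cyl x hx
  have hxT : cyl x (n + T) ⊆ cyl x n := cyl_mono (Nat.le_add_right n T)
  obtain ⟨s, hs, hsa, hso⟩ := exists_swap_cyl hn₁ (hn₁.trans hm) (hxU.trans hUE) hyE hxs hy.1 hc
    ho.symm (hyU.symm.mono_left hxU)
  have hoT : Γ.o (x (n + T)) = Γ.o (x n) := by rw [hT n le_rfl]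
  obtain ⟨t, ht, hta, hto⟩ := exists_swap_cyl (hn₁.trans (Nat.le_add_right n T)) (hn₁.trans hm)
    (hxT.trans (hxU.trans hUE)) hyE hxs hy.1 (hoT ▸ hc) (hoT.trans ho.symm)
    (hyU.symm.mono_left (hxT.trans hxU))
  refine ⟨t * s, S.H.mul_mem ht hs, fun ω hω => ?_, fun u hu hux => ?_⟩
  · rw [Equiv.Perm.mul_apply, (hsa ω hω).1, (hta ω (by rwa [hoT])).2]
  · have huy : u ∉ cyl y m := fun h => Set.disjoint_left.1 hyU h hu
    rw [Equiv.Perm.mul_apply, hso u hux huy, hto u (fun h => hux (hxT h)) huy]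

theorem contraction_pow {x : ℕ → Γ.E} {n T : ℕ} (hT₁ : 1 ≤ T) (hx : x ∈ Γ.shift)
    (hT : ∀ i, n ≤ i → x (i + T) = x i) {s : Equiv.Perm (ℕ → Γ.E)}
    (hs : ∀ ω ∈ nodeCone (Γ.o (x n)), s (glue n x ω) = glue (n + T) x ω) (b : ℕ) :
    ∀ ω ∈ nodeCone (Γ.o (x n)), (s ^ b) (glue n x ω) = glue (n + b * T) x ω := by
  induction b with
  | zero => simp
  | succ b ih =>
    intro ω hω
    have h₁ : glue (n + T) x ω = glue n x (glue T (fun i => x (n + i)) ω) := by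
      simpa using (glue_period hT 0 T ω).symm
    have hω' : glue T (fun i => x (n + i)) ω ∈ nodeCone (Γ.o (x n)) :=
      ⟨glue_mem_shift (tail_mem_shift hx n) hω.1 (by rw [hω.2, hT n le_rfl]),
        by rw [glue_of_lt hT₁, add_zero]⟩
    rw [pow_succ, Equiv.Perm.mul_apply, hs ω hω, h₁, ih _ hω', glue_period hT, add_mul, one_mul]

theorem exists_contraction_pow {A : Set (ℕ → Γ.E)} (hA : A.Finite) {n T : ℕ} (hn : 1 ≤ n)
    (hT₁ : 1 ≤ T) (hAs : A ⊆ Γ.shift) (hT : ∀ x ∈ A, ∀ i, n ≤ i → x (i + T) = x i)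
    {Z : (ℕ → Γ.E) → Equiv.Perm (ℕ → Γ.E)}
    (hZ : ∀ x ∈ A, ∀ ω ∈ nodeCone (Γ.o (x n)), Z x (glue n x ω) = glue (n + T) x ω)
    (hZo : ∀ x ∈ A, ∀ y ∈ A, x ≠ y → ∀ u ∈ cyl y n, Z x u = u) (b : (ℕ → Γ.E) → ℕ) :
    ∃ z ∈ Subgroup.closure (Z '' A), ∀ x ∈ A, ∀ ω ∈ nodeCone (Γ.o (x n)),
      z (glue n x ω) = glue (n + b x * T) x ω := by
  have key : ∀ B : Finset (ℕ → Γ.E), ↑B ⊆ A → ∃ z ∈ Subgroup.closure (Z '' A), ∀ x ∈ A,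
      ∀ ω ∈ nodeCone (Γ.o (x n)),
        z (glue n x ω) = if x ∈ B then glue (n + b x * T) x ω else glue n x ω := by
    intro B
    induction B using Finset.induction_on with
    | empty => exact fun _ => ⟨1, Subgroup.one_mem _, fun x _ ω _ => by simp⟩
    | @insert a B ha ih =>
      intro hB
      rw [Finset.coe_insert, Set.insert_subset_iff] at hB
      obtain ⟨z, hz, hzB⟩ := ih hB.2
      have haA := hB.1
      refine ⟨z * Z a ^ b a, Subgroup.mul_mem _ hz (Subgroup.pow_mem _
        (Subgroup.subset_closure (Set.mem_image_of_mem Z haA)) _), fun x hx ω hω => ?_⟩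
      rw [Equiv.Perm.mul_apply]
      by_cases hxa : x = a
      · subst hxa
        rw [contraction_pow hT₁ (hAs hx) (hT x hx) (hZ x hx) _ ω hω,
          if_pos (Finset.mem_insert_self _ _)]
        have hmem : glue (n + b x * T) x ω ∈ cyl x n := cyl_mono (Nat.le_add_right _ _)
          (glue_mem_cyl (hAs hx) hω.1
            (by rw [hω.2, apply_add_mul_period (hT x hx) _ le_rfl]))
        obtain ⟨ω', hω', ho, h⟩ := exists_glue hn (hAs hx) hmem
        rw [← h, hzB x hx ω' ⟨hω', ho⟩, if_neg ha]
      · have hfix : (Z a ^ b a) (glue n x ω) = glue n x ω :=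
          Function.IsFixedPt.perm_pow (e := Z a)
            (hZo a haA x hx (Ne.symm hxa) _ (glue_mem_cyl (hAs hx) hω.1 hω.2)) _
        rw [hfix, hzB x hx ω hω]
        simp [hxa]
  obtain ⟨z, hz, h⟩ := key hA.toFinset (by simp)
  exact ⟨z, hz, fun x hx ω hω => by rw [h x hx ω hω, if_pos (hA.mem_toFinset.2 hx)]⟩

/-- The pointwise stabilizer of a finite nonempty set of eventually periodic points is
finitely generated. -/
theorem exists_finite_generators_fixer {A : Set (ℕ → Γ.E)} (hAf : A.Finite) (hne : A.Nonempty)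
    (hAE : A ⊆ S.E) (hA : ∀ x ∈ A, ∃ n T, 1 ≤ T ∧ ∀ i, n ≤ i → x (i + T) = x i) :
    ∃ F : Set (Equiv.Perm (ℕ → Γ.E)), F.Finite ∧ F ⊆ S.fixer A ∧
      S.fixer A ≤ Subgroup.closure F := by
  have hAs : A ⊆ Γ.shift := hAE.trans S.sat.sub
  obtain ⟨n₀, T, hT₁, hT₀⟩ := exists_common_period hAf hA
  obtain ⟨z, hz, hzA⟩ := S.exists_notMem_of_finite hAf
  obtain ⟨D, hD⟩ := exists_separating_level (hAf.insert z)
  obtain ⟨n, hn₀, hnD, hnl⟩ : ∃ n, n₀ ≤ n ∧ D ≤ n ∧ S.level ≤ n :=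
    ⟨max (max n₀ D) S.level, by omega, by omega, by omega⟩
  have hn₁ : 1 ≤ n := S.level_pos.trans hnl
  have hT : ∀ x ∈ A, ∀ i, n ≤ i → x (i + T) = x i := fun x hx i hi => hT₀ x hx i (hn₀.trans hi)
  have hd : ∀ x ∈ insert z A, ∀ y ∈ insert z A, x ≠ y → Disjoint (cyl x n) (cyl y n) := by
    intro x hx y hy hxy
    obtain ⟨i, hi, h⟩ := hD x hx y hy hxy
    exact disjoint_cyl (hi.trans_le hnD) (hi.trans_le hnD) h
  have hAd : ∀ x ∈ A, ∀ y ∈ A, x ≠ y → Disjoint (cyl x n) (cyl y n) := fun x hx y hy =>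
    hd x (Set.mem_insert_of_mem z hx) y (Set.mem_insert_of_mem z hy)
  set U : Set (ℕ → Γ.E) := ⋃ x ∈ A, cyl x n with hU
  have hAU : ∀ x ∈ A, cyl x n ⊆ U := fun x hx => Set.subset_biUnion_of_mem (u := (cyl · n)) hx
  have hUs : Sat U n := by
    refine ⟨Set.iUnion₂_subset fun x _ => cyl_subset_shift x n, fun u hu => ?_⟩
    obtain ⟨x, hx, hux⟩ := Set.mem_iUnion₂.1 hu
    rw [cyl_eq_of_mem hux]
    exact hAU x hx
  have hUE : U ⊆ S.E := Set.iUnion₂_subset fun x hx => (S.sat.mono hnl).cyl x (hAE hx)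
  have hzU : z ∉ U := by
    intro h
    obtain ⟨x, hx, hzx⟩ := Set.mem_iUnion₂.1 h
    exact Set.disjoint_left.1 (hd x (Set.mem_insert_of_mem z hx) z (Set.mem_insert z A)
      fun h => hzA (h ▸ hx)) hzx (mem_cyl_self hzx.1 n)
  obtain ⟨F, hF, hFK, hFU⟩ : ∃ F : Set (Equiv.Perm (ℕ → Γ.E)), F.Finite ∧ F ⊆ S.fixer A ∧
      ∀ g ∈ S.H, (∀ u ∈ U, g u = u) → g ∈ Subgroup.closure F := by
    obtain ⟨x, hx⟩ := hne
    obtain ⟨y, hy, hyx⟩ := S.exists_ne x (hAs hx) n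
    obtain ⟨e, he⟩ := Function.ne_iff.1 hyx
    have hB : cyl y (max n (e + 1)) ⊆ cyl x n :=
      (cyl_mono (le_max_left _ _)).trans (cyl_eq_of_mem hy).subset
    obtain ⟨F, hF, h₁, h₂⟩ := exists_finite_of_support (S := S) (sat_cyl y (max n (e + 1)))
      ((S.sat.mono hnl).diff hUs) (hB.trans ((hAU x hx).trans hUE)) Set.sdiff_subset
      ⟨y, mem_cyl_self hy.1 _⟩ ⟨z, hz, hzU⟩
      (Set.disjoint_sdiff_right.mono_left (hB.trans (hAU x hx)))
    refine ⟨F, hF, fun g hg => mem_fixer.2 ⟨(h₁ g hg).1, fun a ha => (h₁ g hg).2 a ?_⟩,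
      fun g hg hgU => h₂ g hg fun u hu => ?_⟩
    · rintro (h | h)
      · by_cases hax : a = x
        · subst hax
          exact he (h.2 e (by omega)).symm
        · exact Set.disjoint_left.1 (hAd a ha x hx hax) (mem_cyl_self (hAs ha) n) (hB h)
      · exact h.2 (hAU a ha (mem_cyl_self (hAs ha) n))
    · by_cases huE : u ∈ S.E
      · exact hgU u (by_contra fun h => hu ⟨huE, h⟩)
      · exact S.off g hg u huE
  have hZ : ∀ x, ∃ s : Equiv.Perm (ℕ → Γ.E), x ∈ A → s ∈ S.H ∧
      (∀ ω ∈ nodeCone (Γ.o (x n)), s (glue n x ω) = glue (n + T) x ω) ∧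
      ∀ u ∈ U, u ∉ cyl x n → s u = u := by
    intro x
    by_cases hx : x ∈ A
    · obtain ⟨s, h⟩ := exists_contraction hnl (hT x hx) hUs hUE
        (hAU x hx (mem_cyl_self (hAs hx) n)) hz hzU
      exact ⟨s, fun _ => h⟩
    · exact ⟨1, fun h => absurd h hx⟩
  choose Z hZ using hZ
  have hZo : ∀ x ∈ A, ∀ y ∈ A, x ≠ y → ∀ u ∈ cyl y n, Z x u = u := fun x hx y hy hxy u hu =>
    (hZ x hx).2.2 u (hAU y hy hu) (Set.disjoint_right.1 (hAd x hx y hy hxy) hu)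
  have htail : ∀ x ∈ A, (fun i => x (n + i)) ∈ nodeCone (Γ.o (x n)) := fun x hx =>
    ⟨tail_mem_shift (hAs hx) n, rfl⟩
  have hZK : Z '' A ⊆ S.fixer A := by
    rintro _ ⟨x, hx, rfl⟩
    refine mem_fixer.2 ⟨(hZ x hx).1, fun y hy => ?_⟩
    by_cases hxy : x = y
    · subst hxy
      have h₁ : glue n x (fun i => x (n + i)) = x := glue_tail fun _ _ => rfl
      have h₂ := glue_period_self (hT x hx) 1
      have h₃ := (hZ x hx).2.1 _ (htail x hx)
      rwa [h₁, ← one_mul T, h₂] at h₃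
    · exact hZo x hx y hy hxy y (mem_cyl_self (hAs hy) n)
  have hpow := exists_contraction_pow hAf hn₁ hT₁ hAs hT (fun x hx => (hZ x hx).2.1) hZo
  have := hAf.to_subtype
  have := S.nuc_finite.to_subtype
  obtain ⟨R, hR, hRP, hRr⟩ := exists_finite_reps
    fun (q : ↥A → Fin T × ↥S.nuc) (g : Equiv.Perm (ℕ → Γ.E)) => g ∈ S.fixer A ∧
      ∀ x : ↥A, ∀ ω ∈ nodeCone (Γ.o (x.1 n)),
        g (glue n x.1 ω) = glue (n + (q x).1) x.1 ((q x).2.1.2 ω)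
  refine ⟨F ∪ Z '' A ∪ R, (hF.union (hAf.image Z)).union hR,
    Set.union_subset (Set.union_subset hFK hZK) fun r hr => (hRP r hr).choose_spec.1,
    fun k hk => ?_⟩
  have hk' := mem_fixer.1 hk
  have hFc : Subgroup.closure F ≤ Subgroup.closure (F ∪ Z '' A ∪ R) :=
    Subgroup.closure_mono (Set.subset_union_left.trans Set.subset_union_left)
  have hZc : Subgroup.closure (Z '' A) ≤ Subgroup.closure (F ∪ Z '' A ∪ R) :=
    Subgroup.closure_mono (Set.subset_union_right.trans Set.subset_union_left)
  have hZK' : Subgroup.closure (Z '' A) ≤ S.fixer A := (Subgroup.closure_le _).2 hZK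
  obtain ⟨N, hN⟩ := S.nuc_act k hk'.1 n
  have hN' : ∀ x : ↥A, ∃ m, n ≤ m ∧ ∃ p : ↥S.nuc, ∀ ω ∈ nodeCone (Γ.o (x.1 n)),
      k (glue (n + N * T) x.1 ω) = glue m x.1 (p.1.2 ω) := by
    intro x
    obtain ⟨m, hm, p, hp, -, h⟩ := hN x.1 (hAE x.2) (n + N * T)
      ((Nat.le_mul_of_pos_right N hT₁).trans (Nat.le_add_left _ _))
    refine ⟨m, hm, ⟨p, hp⟩, fun ω hω => ?_⟩
    rw [h ω hω.1 (by rw [hω.2, apply_add_mul_period (hT x.1 x.2) _ le_rfl]), hk'.2 x.1 x.2]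
  choose m hm p hp using hN'
  obtain ⟨z₁, hz₁, hz₁A⟩ := hpow fun _ => N
  obtain ⟨z₂, hz₂, hz₂A⟩ := hpow fun x => if hx : x ∈ A then (m ⟨x, hx⟩ - n) / T else 0
  set k' := z₂⁻¹ * k * z₁ with hk'_def
  have hk'K : k' ∈ S.fixer A := (S.fixer A).mul_mem
    ((S.fixer A).mul_mem ((S.fixer A).inv_mem (hZK' hz₂)) hk) (hZK' hz₁)
  have hk'A : ∀ x : ↥A, ∀ ω ∈ nodeCone (Γ.o (x.1 n)),
      k' (glue n x.1 ω) = glue (n + (m x - n) % T) x.1 ((p x).1.2 ω) := by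
    rintro ⟨x, hx⟩ ω hω
    set q := (m ⟨x, hx⟩ - n) / T with hq
    set r := (m ⟨x, hx⟩ - n) % T with hr
    have hmq : m ⟨x, hx⟩ = n + (q * T + r) := by
      have h₁ : q * T + r = m ⟨x, hx⟩ - n := Nat.div_add_mod' _ _
      have h₂ := hm ⟨x, hx⟩
      omega
    have h₁ : k (z₁ (glue n x ω)) = glue (n + (q * T + r)) x ((p ⟨x, hx⟩).1.2 ω) := by
      rw [hz₁A x hx ω hω, ← hmq]
      exact hp ⟨x, hx⟩ ω hω
    have hoN : Γ.o (x (n + N * T)) = Γ.o (x n) := by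
      rw [apply_add_mul_period (hT x hx) _ le_rfl]
    have h₂ : k (z₁ (glue n x ω)) ∈ Γ.shift := by
      refine S.sat.sub ((map_mem_iff hk'.1).2 ?_)
      rw [hz₁A x hx ω hω]
      exact (S.sat.mono (by omega)).cyl x (hAE hx)
        (glue_mem_cyl (hAs hx) hω.1 (hω.2.trans hoN.symm))
    have h₃ : k (z₁ (glue n x ω)) ∈ cyl x (n + q * T) :=
      ⟨h₂, fun i hi => by rw [h₁, glue_of_lt (by omega)]⟩
    obtain ⟨ω', hω', ho, h₄⟩ := exists_glue (by omega) (hAs hx) h₃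
    rw [apply_add_mul_period (hT x hx) _ le_rfl] at ho
    have h₅ : ω' = glue r (fun i => x (n + i)) ((p ⟨x, hx⟩).1.2 ω) := by
      refine glue_injective (n + q * T) x ?_
      rw [h₄, h₁, glue_period (hT x hx)]
    have h₆ := hz₂A x hx ω' ⟨hω', ho⟩
    rw [dif_pos hx, ← hq, h₄] at h₆
    rw [hk'_def, Equiv.Perm.mul_apply, Equiv.Perm.mul_apply, ← h₆, inv_apply_self, h₅]
    simpa using glue_period (hT x hx) 0 r ((p ⟨x, hx⟩).1.2 ω)
  obtain ⟨r, hr, hrK, hrA⟩ := hRr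
    (fun x => (⟨(m x - n) % T, Nat.mod_lt _ hT₁⟩, p x)) k' ⟨hk'K, hk'A⟩
  have hrk : r⁻¹ * k' ∈ Subgroup.closure F := by
    refine hFU _ (S.H.mul_mem (S.H.inv_mem (mem_fixer.1 hrK).1) (mem_fixer.1 hk'K).1)
      fun u hu => ?_
    obtain ⟨x, hx, hux⟩ := Set.mem_iUnion₂.1 hu
    obtain ⟨ω, hω, ho, rfl⟩ := exists_glue hn₁ (hAs hx) hux
    rw [Equiv.Perm.mul_apply, hk'A ⟨x, hx⟩ ω ⟨hω, ho⟩, ← hrA ⟨x, hx⟩ ω ⟨hω, ho⟩,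
      inv_apply_self]
  have hk'c : k' ∈ Subgroup.closure (F ∪ Z '' A ∪ R) := by
    have hrF : r ∈ Subgroup.closure (F ∪ Z '' A ∪ R) := Subgroup.subset_closure (Or.inr hr)
    have := Subgroup.mul_mem _ hrF (hFc hrk)
    rwa [mul_inv_cancel_left] at this
  have := Subgroup.mul_mem _ (Subgroup.mul_mem _ (hZc hz₂) hk'c) (Subgroup.inv_mem _ (hZc hz₁))
  rwa [hk'_def, mul_assoc z₂⁻¹, mul_inv_cancel_left, mul_inv_cancel_right] at this

/-- The setwise stabilizer of a finite set of eventually periodic points is finitely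
generated. -/
theorem exists_finite_generators_stabilizer {A : Set (ℕ → Γ.E)} (hAf : A.Finite) (hAE : A ⊆ S.E)
    (hA : ∀ x ∈ A, ∃ n T, 1 ≤ T ∧ ∀ i, n ≤ i → x (i + T) = x i) :
    ∃ F : Set (Equiv.Perm (ℕ → Γ.E)), F.Finite ∧ F ⊆ {g | g ∈ S.H ∧ g '' A = A} ∧
      {g | g ∈ S.H ∧ g '' A = A} ⊆ Subgroup.closure F := by
  rcases A.eq_empty_or_nonempty with rfl | hne
  · obtain ⟨F, hF, hFH, hHF⟩ := S.exists_finite_generators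
    exact ⟨F, hF, fun g hg => ⟨hFH hg, Set.image_empty _⟩, fun g hg => hHF hg.1⟩
  obtain ⟨F, hF, hFK, hKF⟩ := exists_finite_generators_fixer hAf hne hAE hA
  have := hAf.to_subtype
  obtain ⟨R, hR, hRP, hRr⟩ := exists_finite_reps
    fun (q : ↥A → ↥A) (g : Equiv.Perm (ℕ → Γ.E)) => (g ∈ S.H ∧ g '' A = A) ∧
      ∀ x : ↥A, g x.1 = q x
  refine ⟨F ∪ R, hF.union hR, ?_, ?_⟩
  · rintro g (hg | hg)
    · have h := mem_fixer.1 (hFK hg)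
      exact ⟨h.1, (Set.image_congr h.2).trans (Set.image_id' A)⟩
    · exact (hRP g hg).choose_spec.1
  · intro g hg
    obtain ⟨r, hr, hrH, hrA⟩ := hRr (fun x => ⟨g x.1, hg.2.subset (Set.mem_image_of_mem g x.2)⟩)
      g ⟨hg, fun _ => rfl⟩
    have hrg : r⁻¹ * g ∈ S.fixer A := by
      refine mem_fixer.2 ⟨S.H.mul_mem (S.H.inv_mem hrH.1) hg.1, fun x hx => ?_⟩
      have h := hrA ⟨x, hx⟩
      rw [Equiv.Perm.mul_apply, ← show r x = g x from h, inv_apply_self]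
    have hrF : r ∈ Subgroup.closure (F ∪ R) := Subgroup.subset_closure (Or.inr hr)
    have := Subgroup.mul_mem _ hrF (Subgroup.closure_mono Set.subset_union_left (hKF hrg))
    rwa [mul_inv_cancel_left] at this

end Setting
end FinDigraph

/-- If `G ≤ R_{Γ,E}` is a full, contracting RSG and `S'` is a finite set of rational
points of `E`, then the setwise stabilizer `Stab_G(S')` is finitely generated. -/
theorem stabilizer_of_rational_points_finitely_generated (Γ : FinDigraph)
    (hiso : Γ.NoIsolatedPoints) (hcones : Γ.NoEmptyCones)
    (E : Set (ℕ → Γ.E)) (hEsub : E ⊆ Γ.shift) (hEne : E.Nonempty)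
    (hEclopen : Γ.ClopenIn E)
    (G : Subgroup (Equiv.Perm ↥E)) (hRSG : Γ.IsRSG E G)
    (hContr : Γ.IsContracting E G) (hFull : Γ.IsFullOn E G)
    (S' : Set (ℕ → Γ.E)) (hS'E : S' ⊆ E) (hS'fin : S'.Finite)
    (hS'rat : ∀ x ∈ S', Γ.IsRationalPt x) :
    ∃ F : Set (Equiv.Perm ↥E), F.Finite ∧
      F ⊆ {g | g ∈ G ∧ Γ.permExt E g '' S' = S'} ∧
      {g | g ∈ G ∧ Γ.permExt E g '' S' = S'} ⊆
        (Subgroup.closure F : Subgroup (Equiv.Perm ↥E)) := by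
  obtain ⟨S, hSE, hSH⟩ := FinDigraph.exists_setting hiso hcones E hEsub hEne hEclopen G hRSG hContr hFull
  have hinj := Equiv.Perm.ofSubtype_injective (p := (· ∈ E))
  obtain ⟨F, hF, hFS, hSF⟩ := S.exists_finite_generators_stabilizer hS'fin (hSE ▸ hS'E)
    fun x hx => (hS'rat x hx).eventually_periodic
  have himg : Equiv.Perm.ofSubtype '' (Equiv.Perm.ofSubtype (p := (· ∈ E)) ⁻¹' F) = F := by
    refine Set.image_preimage_eq_of_subset fun g hg => ?_
    obtain ⟨g', -, rfl⟩ := hSH ▸ (hFS hg).1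
    exact ⟨g', rfl⟩
  have hmem : ∀ g : Equiv.Perm ↥E, Equiv.Perm.ofSubtype g ∈ S.H ↔ g ∈ G := fun g => by
    rw [hSH]
    exact Subgroup.mem_map_iff_mem hinj
  refine ⟨Equiv.Perm.ofSubtype ⁻¹' F, hF.preimage hinj.injOn, fun g hg => ?_, fun g hg => ?_⟩
  · rw [Set.mem_ofPred_eq, FinDigraph.permExt_eq]
    exact ⟨(hmem g).1 (hFS hg).1, (hFS hg).2⟩
  · have h : Equiv.Perm.ofSubtype g ∈ Subgroup.closure F :=
      hSF ⟨(hmem g).2 hg.1, by rw [← FinDigraph.permExt_eq]; exact hg.2⟩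
    rw [← himg, ← MonoidHom.map_closure] at h
    exact (Subgroup.mem_map_iff_mem hinj).1 h

end
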